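/- Let A be a C₀(X)-algebra and B a C₀(Y)-algebra, and suppose either A or B is separable and exact. Then the minimal tensor product A⊗B, viewed as a C₀(X×Y)-algebra via the map Φ_X ⊗ Φ_Y, has fibres (A⊗B)_{(x,y)} = A_x ⊗ B_y for all (x,y) ∈ X×Y. -/

import Mathlib

/-!
Statement 8: if `A` is a `C₀(X)`-algebra and `B` a `C₀(Y)`-algebra, and one of them is
separable and exact, then the fibres of the minimal tensor product `A ⊗ B` (as a
`C₀(X×Y)`-algebra) are `(A ⊗ B)_{(x,y)} = A_x ⊗ B_y`.
-/

noncomputable section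
open ZeroAtInfty MultiplierAlgebra Function

/-- A `C₀(X)`-algebra structure on a C*-algebra `A`. -/
structure C0Structure (X : Type) [TopologicalSpace X] (A : Type)
    [NonUnitalCStarAlgebra A] where
  Φ : C₀(X, ℂ) →⋆ₙₐ[ℂ] 𝓜(ℂ, A)
  central : ∀ f, Φ f ∈ Set.center 𝓜(ℂ, A)
  nondegenerate :
    (Submodule.span ℂ {x : A | ∃ (f : C₀(X, ℂ)) (a : A), x = (Φ f).fst a}).topologicalClosure = ⊤

/-- The action of `C₀(X)` on `A`. -/
def C0Structure.smul {X : Type} [TopologicalSpace X] {A : Type} [NonUnitalCStarAlgebra A]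
    (S : C0Structure X A) (f : C₀(X, ℂ)) (a : A) : A :=
  (S.Φ f).fst a

/-- The ideal `Iₓ = closure (C₀(X∖{x})·A)` of a `C₀(X)`-algebra at `x ∈ X`. -/
def fiberIdeal {X : Type} [TopologicalSpace X] {A : Type} [NonUnitalCStarAlgebra A]
    (S : C0Structure X A) (x : X) : Set A :=
  closure (Submodule.span ℂ
    {y : A | ∃ (f : C₀(X, ℂ)) (a : A), f x = 0 ∧ y = S.smul f a} : Set A)

/-- Data exhibiting `F` as the fibre `Aₓ = A/Iₓ` of `A` at `x`. -/
structure FibreData {X : Type} [TopologicalSpace X] {A : Type} [NonUnitalCStarAlgebra A]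
    (S : C0Structure X A) (x : X) (F : Type) [NonUnitalCStarAlgebra F] where
  π : A →⋆ₙₐ[ℂ] F
  surjective : Function.Surjective π
  ker_eq : {a : A | π a = 0} = fiberIdeal S x

/-- Data realizing `T` as a C*-completion of the algebraic tensor product `A ⊙ B`:
a bilinear, multiplicative, star-preserving pairing with dense span, which is a cross norm. -/
structure TensorData (A B T : Type) [NonUnitalCStarAlgebra A] [NonUnitalCStarAlgebra B]
    [NonUnitalCStarAlgebra T] where
  tmul : A → B → T
  add_left : ∀ (a a' : A) (b : B), tmul (a + a') b = tmul a b + tmul a' b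
  add_right : ∀ (a : A) (b b' : B), tmul a (b + b') = tmul a b + tmul a b'
  smul_left : ∀ (c : ℂ) (a : A) (b : B), tmul (c • a) b = c • tmul a b
  smul_right : ∀ (c : ℂ) (a : A) (b : B), tmul a (c • b) = c • tmul a b
  mul_tmul : ∀ (a a' : A) (b b' : B), tmul a b * tmul a' b' = tmul (a * a') (b * b')
  star_tmul : ∀ (a : A) (b : B), star (tmul a b) = tmul (star a) (star b)
  norm_tmul : ∀ (a : A) (b : B), ‖tmul a b‖ = ‖a‖ * ‖b‖
  dense :
    (Submodule.span ℂ (Set.range fun p : A × B => tmul p.1 p.2)).topologicalClosure = ⊤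

/-- Data exhibiting `T` as the *minimal* tensor product `A ⊗ B`: a C*-completion of
`A ⊙ B` which is minimal, i.e. receives a `*`-homomorphism from every other
C*-completion of `A ⊙ B`. -/
structure MinTensorData (A B T : Type) [NonUnitalCStarAlgebra A] [NonUnitalCStarAlgebra B]
    [NonUnitalCStarAlgebra T] extends TensorData A B T where
  minimal : ∀ (T' : Type) [NonUnitalCStarAlgebra T'] (d : TensorData A B T'),
    ∃ θ : T' →⋆ₙₐ[ℂ] T, ∀ (a : A) (b : B), θ (d.tmul a b) = tmul a b

/-- A C*-algebra `D` is exact if minimally tensoring with `D` preserves short exact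
sequences of C*-algebras. -/
def IsExactCStar (D : Type) [NonUnitalCStarAlgebra D] : Prop :=
  ∀ (I A B : Type) [NonUnitalCStarAlgebra I] [NonUnitalCStarAlgebra A]
    [NonUnitalCStarAlgebra B]
    (ι : I →⋆ₙₐ[ℂ] A) (q : A →⋆ₙₐ[ℂ] B),
    Function.Injective ι → Function.Surjective q → {a : A | q a = 0} = Set.range ι →
    ∀ (TI TA TB : Type) [NonUnitalCStarAlgebra TI] [NonUnitalCStarAlgebra TA]
      [NonUnitalCStarAlgebra TB]
      (dI : MinTensorData I D TI) (dA : MinTensorData A D TA) (dB : MinTensorData B D TB)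
      (ιT : TI →⋆ₙₐ[ℂ] TA) (qT : TA →⋆ₙₐ[ℂ] TB),
      (∀ (x : I) (d : D), ιT (dI.tmul x d) = dA.tmul (ι x) d) →
      (∀ (a : A) (d : D), qT (dA.tmul a d) = dB.tmul (q a) d) →
      Function.Injective ιT ∧ Function.Surjective qT ∧ {t : TA | qT t = 0} = Set.range ιT

namespace FM
set_option linter.all false
set_option linter.style.haveILetI false
set_option linter.unnecessarySimpa false
open scoped ComplexOrder InnerProductSpace ComplexStarModule

section ext
variable {A : Type} [NonUnitalCStarAlgebra A]

lemma norm_posPart_le_iff (x : A) (hx : IsSelfAdjoint x) (r : ℝ) (hr : 0 ≤ r) :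
    ‖x⁺‖ ≤ r ↔ ∀ t ∈ quasispectrum ℝ x, t ≤ r := by
  rw [CFC.posPart_def, norm_cfcₙ_le_iff (fun t : ℝ => t⁺) x r (hf₀ := by simp) (ha := hx)]
  constructor
  · intro h t ht
    exact le_trans (le_posPart t) (le_trans (le_abs_self _) (h t ht))
  · intro h t ht
    rw [Real.norm_eq_abs, abs_of_nonneg (posPart_nonneg t)]
    exact sup_le (h t ht) hr

lemma norm_posPart_le_iff' (x : A) (hx : IsSelfAdjoint x) (r : ℝ) (hr : 0 ≤ r) :
    letI := CStarAlgebra.spectralOrder (Unitization ℂ A)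
    ‖x⁺‖ ≤ r ↔ (x : Unitization ℂ A) ≤ algebraMap ℝ _ r := by
  letI := CStarAlgebra.spectralOrder (Unitization ℂ A)
  haveI := CStarAlgebra.spectralOrderedRing (Unitization ℂ A)
  rw [norm_posPart_le_iff x hx r hr, Unitization.quasispectrum_eq_spectrum_inr' ℝ ℂ,
    le_algebraMap_iff_spectrum_le (ha := by simpa using hx)]

lemma norm_posPart_add_le (x y : A) (hx : IsSelfAdjoint x) (hy : IsSelfAdjoint y) :
    ‖(x + y)⁺‖ ≤ ‖x⁺‖ + ‖y⁺‖ := by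
  letI := CStarAlgebra.spectralOrder (Unitization ℂ A)
  haveI := CStarAlgebra.spectralOrderedRing (Unitization ℂ A)
  rw [norm_posPart_le_iff' _ (hx.add hy) _ (by positivity), map_add, Unitization.inr_add]
  exact add_le_add ((norm_posPart_le_iff' x hx _ (norm_nonneg _)).1 le_rfl)
    ((norm_posPart_le_iff' y hy _ (norm_nonneg _)).1 le_rfl)

/-- the sublinear functional. -/
def pp (a : A) : ℝ := ‖(ℜ a : A)⁺‖

lemma pp_sa (a : A) (ha : IsSelfAdjoint a) : pp a = ‖a⁺‖ := by
  rw [pp, ha.coe_realPart]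

lemma pp_nonneg (a : A) : 0 ≤ pp a := norm_nonneg _

lemma pp_le_norm (a : A) : pp a ≤ ‖a‖ := by
  unfold pp
  exact (CStarAlgebra.norm_posPart_le _).trans (realPart.norm_le a)

lemma pp_smul (c : ℝ) (hc : 0 < c) (a : A) : pp (c • a) = c * pp a := by
  unfold pp
  rw [map_smul]
  have : ((c • (ℜ a) : selfAdjoint A) : A) = c • (ℜ a : A) := rfl
  rw [this, CFC.posPart_smul_of_nonneg hc.le, norm_smul, Real.norm_eq_abs, abs_of_pos hc]

lemma pp_add (a b : A) : pp (a + b) ≤ pp a + pp b := by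
  unfold pp
  rw [map_add]
  exact norm_posPart_add_le _ _ (ℜ a).2 (ℜ b).2

lemma pp_I_smul (a : A) (ha : IsSelfAdjoint a) : pp (Complex.I • a) = 0 := by
  unfold pp
  rw [realPart_I_smul, ha.imaginaryPart]; simp

lemma pp_neg_star_mul_self (a : A) : pp (-(star a * a)) = 0 := by
  letI := CStarAlgebra.spectralOrder A
  haveI := CStarAlgebra.spectralOrderedRing A
  rw [pp_sa _ (IsSelfAdjoint.star_mul_self a).neg, norm_eq_zero,
    CFC.posPart_eq_zero_iff _ (IsSelfAdjoint.star_mul_self a).neg]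
  simpa using star_mul_self_nonneg a

/-- positive functional -/
def IsPos (f : A →ₗ[ℂ] ℂ) : Prop := ∀ a, 0 ≤ f (star a * a)

/-- quasi-states -/
structure QState (f : A →ₗ[ℂ] ℂ) : Prop where
  pos : IsPos f
  le : ∀ a, ‖f a‖ ≤ ‖a‖

lemma exists_qstate_of_le_pp (g : A →ₗ[ℝ] ℝ) (hg : ∀ a, g a ≤ pp a) :
    ∃ f : A →ₗ[ℂ] ℂ, QState f ∧ ∀ a, (f a).re = g a := by
  let f : A →ₗ[ℂ] ℂ := Module.Dual.extendRCLike (𝕜 := ℂ) g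
  have hre : ∀ a, (f a).re = g a := fun a => Module.Dual.re_extendRCLike_apply (𝕜 := ℂ) g a
  have him : ∀ a, (f a).im = - g (Complex.I • a) := fun a => by
    rw [← hre, map_smul]; simp
  have hI : ∀ a : A, IsSelfAdjoint a → g (Complex.I • a) = 0 := by
    intro a ha
    have h1 := hg (Complex.I • a)
    have h2 := hg (Complex.I • (-a))
    rw [pp_I_smul _ ha] at h1
    rw [pp_I_smul _ ha.neg, smul_neg, map_neg] at h2
    linarith
  refine ⟨f, ⟨?_, ?_⟩, hre⟩
  · intro a
    rw [Complex.nonneg_iff, hre, him, hI _ (IsSelfAdjoint.star_mul_self a)]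
    have := hg (-(star a * a))
    rw [pp_neg_star_mul_self, map_neg] at this
    exact ⟨by linarith, by simp⟩
  · intro a
    by_cases h0 : f a = 0
    · simp [h0]
    set c : ℂ := star (f a) / ‖f a‖
    have hn : (‖f a‖ : ℂ) ≠ 0 := by simpa using h0
    have hc : ‖c‖ = 1 := by simp [c, h0]
    have h1 : f (c • a) = ‖f a‖ := by
      rw [map_smul, smul_eq_mul]
      simp only [c]
      rw [div_mul_eq_mul_div, div_eq_iff hn, mul_comm, Complex.star_def, Complex.mul_conj,
        Complex.normSq_eq_norm_sq]
      push_cast; ring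
    have h2 := (hg (c • a)).trans (pp_le_norm _)
    rw [← hre, h1, norm_smul, hc] at h2
    simpa using h2

lemma exists_qstate_ext (f : A →ₗ.[ℝ] ℝ) (hf : ∀ x : f.domain, f x ≤ pp (x : A)) :
    ∃ F : A →ₗ[ℂ] ℂ, QState F ∧ ∀ x : f.domain, (F x).re = f x := by
  obtain ⟨g, h1, h2⟩ := exists_extension_of_le_sublinear f pp pp_smul pp_add hf
  obtain ⟨F, hF, h3⟩ := exists_qstate_of_le_pp g h2
  exact ⟨F, hF, fun x => by rw [h3, h1]⟩

end ext
end FM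

namespace FM
set_option linter.all false
set_option linter.style.haveILetI false
set_option linter.unnecessarySimpa false
open scoped ComplexOrder InnerProductSpace ComplexStarModule

section pos
variable {A : Type} [NonUnitalCStarAlgebra A]

lemma IsPos.map_nonneg {f : A →ₗ[ℂ] ℂ} (hf : IsPos f) :
    letI := CStarAlgebra.spectralOrder A
    ∀ x : A, 0 ≤ x → 0 ≤ f x := by
  letI := CStarAlgebra.spectralOrder A
  haveI := CStarAlgebra.spectralOrderedRing A
  intro x hx
  obtain ⟨b, rfl⟩ := CStarAlgebra.nonneg_iff_eq_star_mul_self.mp hx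
  exact hf b

/-- associated bundled positive map -/
def toP (f : A →ₗ[ℂ] ℂ) (hf : IsPos f) :
    letI := CStarAlgebra.spectralOrder A
    A →ₚ[ℂ] ℂ :=
  letI := CStarAlgebra.spectralOrder A
  haveI := CStarAlgebra.spectralOrderedRing A
  PositiveLinearMap.mk₀ f hf.map_nonneg

lemma IsPos.map_star {f : A →ₗ[ℂ] ℂ} (hf : IsPos f) (a : A) : f (star a) = star (f a) := by
  letI := CStarAlgebra.spectralOrder A
  haveI := CStarAlgebra.spectralOrderedRing A
  exact StarHomClass.map_star (toP f hf) a

lemma IsPos.bound {f : A →ₗ[ℂ] ℂ} (hf : IsPos f) : ∃ C : ℝ, 0 ≤ C ∧ ∀ a, ‖f a‖ ≤ C * ‖a‖ := by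
  letI := CStarAlgebra.spectralOrder A
  haveI := CStarAlgebra.spectralOrderedRing A
  obtain ⟨C, hC⟩ := PositiveLinearMap.exists_norm_apply_le (toP f hf)
  exact ⟨C, C.2, hC⟩

lemma IsPos.cs {f : A →ₗ[ℂ] ℂ} (hf : IsPos f) (a b : A) :
    ‖f (star a * b)‖ ^ 2 ≤ (f (star a * a)).re * (f (star b * b)).re := by
  letI := CStarAlgebra.spectralOrder A
  haveI := CStarAlgebra.spectralOrderedRing A
  let g := toP f hf
  have h := norm_inner_le_norm (𝕜 := ℂ) (g.toPreGNS a) (g.toPreGNS b)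
  rw [g.preGNS_inner_def] at h
  have h1 : ‖g.toPreGNS a‖ ^ 2 = (f (star a * a)).re := by
    have := congrArg Complex.re (g.preGNS_norm_sq (g.toPreGNS a))
    rw [← Complex.ofReal_pow, Complex.ofReal_re] at this
    exact this
  have h2 : ‖g.toPreGNS b‖ ^ 2 = (f (star b * b)).re := by
    have := congrArg Complex.re (g.preGNS_norm_sq (g.toPreGNS b))
    rw [← Complex.ofReal_pow, Complex.ofReal_re] at this
    exact this
  rw [← h1, ← h2, ← mul_pow]
  exact pow_le_pow_left₀ (norm_nonneg _) h 2

lemma IsPos.re_of_sa {f : A →ₗ[ℂ] ℂ} (hf : IsPos f) (a : A) (ha : IsSelfAdjoint a) :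
    f a = ((f a).re : ℂ) := by
  have := hf.map_star a
  rw [ha.star_eq] at this
  exact (Complex.conj_eq_iff_re.1 this.symm).symm

lemma QState.le_pp {f : A →ₗ[ℂ] ℂ} (hf : QState f) (a : A) (ha : IsSelfAdjoint a) :
    (f a).re ≤ ‖a⁺‖ := by
  letI := CStarAlgebra.spectralOrder A
  haveI := CStarAlgebra.spectralOrderedRing A
  have h1 : 0 ≤ f (a⁺ - a) := hf.pos.map_nonneg _ (sub_nonneg.2 (CFC.le_posPart ha))
  rw [map_sub, Complex.nonneg_iff, Complex.sub_re] at h1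
  exact (sub_nonneg.1 h1.1).trans ((Complex.re_le_norm _).trans (hf.le _))

end pos

section ideal
variable {A : Type} [NonUnitalCStarAlgebra A]

/-- closed two-sided star ideals -/
structure IsCIdeal (K : Submodule ℂ A) : Prop where
  closed : IsClosed (K : Set A)
  mul_left : ∀ a k, k ∈ K → a * k ∈ K
  mul_right : ∀ k a, k ∈ K → k * a ∈ K
  star_mem : ∀ k, k ∈ K → star k ∈ K

lemma local_unit (k : A) (hk : IsSelfAdjoint k) (ε : ℝ) (hε : 0 < ε) :
    letI := CStarAlgebra.spectralOrder A
    ∃ u w : A, u = k * w ∧ IsSelfAdjoint u ∧ 0 ≤ u ∧ ‖u‖ ≤ 1 ∧ ‖k - u * k‖ ≤ ε := by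
  letI := CStarAlgebra.spectralOrder A
  haveI := CStarAlgebra.spectralOrderedRing A
  have hpos : ∀ t : ℝ, 0 < t ^ 2 + ε ^ 2 := fun t => by positivity
  have c1 : Continuous fun t : ℝ => t / (t ^ 2 + ε ^ 2) :=
    by fun_prop (disch := intro x; exact (hpos x).ne')
  have c2 : Continuous fun t : ℝ => t * (t / (t ^ 2 + ε ^ 2)) := continuous_id.mul c1
  refine ⟨cfcₙ (fun t : ℝ => t * (t / (t ^ 2 + ε ^ 2))) k, cfcₙ (fun t : ℝ => t / (t ^ 2 + ε ^ 2)) k,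
    ?_, IsSelfAdjoint.cfcₙ, ?_, ?_, ?_⟩
  · have := cfcₙ_mul (fun t : ℝ => t) (fun t : ℝ => t / (t ^ 2 + ε ^ 2)) k (by fun_prop) (by simp)
      (c1.continuousOn) (by simp)
    rw [this, cfcₙ_id' ℝ k]
  · apply cfcₙ_nonneg
    intro t _
    rw [mul_div_assoc']
    exact div_nonneg (mul_self_nonneg t) (hpos t).le
  · refine norm_cfcₙ_le ?_
    intro t _
    rw [mul_div_assoc', Real.norm_eq_abs, abs_of_nonneg (div_nonneg (mul_self_nonneg t) (hpos t).le),
      div_le_one (hpos t)]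
    nlinarith
  · have h1 := cfcₙ_mul (fun t : ℝ => t * (t / (t ^ 2 + ε ^ 2))) (fun t : ℝ => t) k
      (c2.continuousOn) (by simp) (by fun_prop) (by simp)
    have h2 := cfcₙ_sub (fun t : ℝ => t) (fun t : ℝ => t * (t / (t ^ 2 + ε ^ 2)) * t) k (by fun_prop) (by simp)
      ((c2.mul continuous_id).continuousOn) (by simp)
    rw [h1, cfcₙ_id' ℝ k] at h2
    rw [← h2]
    refine norm_cfcₙ_le ?_
    intro t _
    have e : t - t * (t / (t ^ 2 + ε ^ 2)) * t = ε ^ 2 * t / (t ^ 2 + ε ^ 2) := by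
      have := (hpos t).ne'
      field_simp
      ring
    rw [e, Real.norm_eq_abs, abs_div, abs_of_pos (hpos t), div_le_iff₀ (hpos t), abs_mul,
      abs_of_pos (by positivity : 0 < ε ^ 2)]
    have : 0 ≤ |t| := abs_nonneg t
    rw [← sq_abs t]
    nlinarith [mul_nonneg hε.le (sq_nonneg (|t| - ε)), mul_nonneg hε.le (mul_nonneg hε.le this), mul_nonneg hε.le (sq_nonneg t),  mul_nonneg hε.le (sq_nonneg (|t|)) ]

lemma ideal_pp (K : Submodule ℂ A) (hK : IsCIdeal K) (t k : A) (hk : k ∈ K) (hks : IsSelfAdjoint k)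
    : (Metric.infDist t K) ^ 2 ≤ ‖(k + star t * t)⁺‖ := by
  letI := CStarAlgebra.spectralOrder A
  haveI := CStarAlgebra.spectralOrderedRing A
  letI := CStarAlgebra.spectralOrder (Unitization ℂ A)
  haveI := CStarAlgebra.spectralOrderedRing (Unitization ℂ A)
  apply le_of_forall_pos_le_add
  intro ε hε
  set r := ‖(k + star t * t)⁺‖ with hr
  obtain ⟨u, w, hu, hus, hu0, hu1, hku⟩ := local_unit k hks ε hε
  have huK : u ∈ K := hu ▸ hK.mul_right _ _ hk
  have h1 : Metric.infDist t K ≤ ‖t - t * u‖ := by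
    have := Metric.infDist_le_dist_of_mem (x := t) (hK.mul_left t u huK)
    rwa [dist_eq_norm] at this
  refine (pow_le_pow_left₀ Metric.infDist_nonneg h1 2).trans ?_
  rw [sq, ← CStarRing.norm_star_mul_self]
  have hsa : IsSelfAdjoint (k + star t * t) := hks.add (.star_mul_self t)
  have hle := (norm_posPart_le_iff' _ hsa r (norm_nonneg _)).1 le_rfl
  set v : Unitization ℂ A := 1 - (u : Unitization ℂ A)
  have hvs : star v = v := by
    simp only [v, star_sub, star_one, ← Unitization.inr_star, hus.star_eq]
  obtain ⟨hu0', hu1'⟩ := CStarAlgebra.inr_mem_Icc_iff_norm_le.2 ⟨hu0, hu1⟩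
  have hv1 : ‖v‖ ≤ 1 := by
    rw [CStarAlgebra.norm_le_one_iff_of_nonneg v (sub_nonneg.2 hu1')]
    exact sub_le_self _ hu0'
  have hconj := star_left_conjugate_le_conjugate hle v
  have e1 : star v * ((k + star t * t : A) : Unitization ℂ A) * v =
      ((star (t - t * u) * (t - t * u) : A) : Unitization ℂ A) +
      (((k - u * k) - (k - u * k) * u : A) : Unitization ℂ A) := by
    rw [hvs]
    simp only [v, star_sub, star_mul, hus.star_eq, Unitization.inr_add, Unitization.inr_sub, Unitization.inr_mul]
    noncomm_ring
  have e2 : star v * algebraMap ℝ (Unitization ℂ A) r * v ≤ algebraMap ℝ _ r := by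
    have : star v * algebraMap ℝ (Unitization ℂ A) r * v = r • (star v * v) := by
      simp [Algebra.algebraMap_eq_smul_one]
    rw [this, Algebra.algebraMap_eq_smul_one]
    apply smul_le_smul_of_nonneg_left _ (norm_nonneg _)
    have h := CStarAlgebra.star_mul_le_algebraMap_norm_sq (a := v)
    refine h.trans ?_
    rw [Algebra.algebraMap_eq_smul_one]
    have : ‖v‖ ^ 2 ≤ 1 := by nlinarith [norm_nonneg v]
    calc _ ≤ (1:ℝ) • (1 : Unitization ℂ A) := smul_le_smul_of_nonneg_right this zero_le_one
      _ = 1 := one_smul _ _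
  have hn : ‖(k - u * k) - (k - u * k) * u‖ ≤ ε := by
    have : ((((k - u * k) - (k - u * k) * u : A)) : Unitization ℂ A) = ((k - u * k : A) : Unitization ℂ A) * v := by
      simp only [v, Unitization.inr_sub, Unitization.inr_mul]
      noncomm_ring
    rw [← Unitization.norm_inr (𝕜 := ℂ), this]
    refine (norm_mul_le _ _).trans ?_
    rw [Unitization.norm_inr]
    calc _ ≤ ε * 1 := by gcongr
      _ = ε := mul_one _
  set z := (k - u * k) - (k - u * k) * u with hz
  have hzs : IsSelfAdjoint z := by
    rw [IsSelfAdjoint]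
    simp only [hz, star_sub, star_mul, hus.star_eq, hks.star_eq]
    noncomm_ring
  rw [e1] at hconj
  have hfin : ((star (t - t * u) * (t - t * u) : A) : Unitization ℂ A) ≤ algebraMap ℝ _ (r + ε) := by
    have h3 := (IsSelfAdjoint.neg_algebraMap_norm_le_self (a := (z : Unitization ℂ A))
      (by exact hzs.inr ℂ))
    have h4 : algebraMap ℝ (Unitization ℂ A) ‖(z : Unitization ℂ A)‖ ≤ algebraMap ℝ _ ε := by
      rw [Unitization.norm_inr]
      exact algebraMap_mono _ hn
    rw [map_add]
    have h5 := hconj.trans e2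
    have h6 := add_le_add h5 (neg_le_neg h3)
    have h7 := add_le_add_right h4 (algebraMap ℝ (Unitization ℂ A) r)
    rw [neg_neg] at h6
    refine le_trans (le_of_eq ?_) (h6.trans h7)
    abel
  rw [← Unitization.norm_inr (𝕜 := ℂ), CStarAlgebra.norm_le_iff_le_algebraMap _ (by positivity) (Unitization.inr_nonneg_iff.2 (star_mul_self_nonneg _))]
  exact hfin

lemma exists_qstate_ideal (K : Submodule ℂ A) (hK : IsCIdeal K) (t : A) (ht : t ∉ K) :
    ∃ F : A →ₗ[ℂ] ℂ, QState F ∧ (∀ k ∈ K, F k = 0) ∧ F (star t * t) ≠ 0 := by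
  set d := Metric.infDist t K
  have hd : 0 < d := (hK.closed.notMem_iff_infDist_pos ⟨0, K.zero_mem⟩).1 ht
  have key : ∀ k ∈ K, d ^ 2 ≤ pp (k + star t * t) := by
    intro k hk
    unfold pp
    rw [map_add]
    have : (ℜ (star t * t) : A) = star t * t := (IsSelfAdjoint.star_mul_self t).coe_realPart
    simp only [AddSubgroup.coe_add, this]
    refine ideal_pp K hK t _ ?_ (ℜ k).2
    rw [realPart_apply_coe]
    exact K.smul_of_tower_mem _ (K.add_mem hk (hK.star_mem k hk))
  have hx : star t * t ∉ K.restrictScalars ℝ := by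
    intro h
    have := key (-(star t * t)) (K.neg_mem h)
    rw [neg_add_cancel] at this
    have h0 : pp (0 : A) = 0 := by simp [pp]
    rw [h0] at this
    nlinarith
  let f0 : A →ₗ.[ℝ] ℝ := ⟨K.restrictScalars ℝ, 0⟩
  let f := f0.supSpanSingleton (star t * t) (d ^ 2) hx
  obtain ⟨F, hF, hFf⟩ := exists_qstate_ext f (by
    rintro ⟨x, hxx⟩
    obtain ⟨k, hk, y, hy, rfl⟩ := Submodule.mem_sup.1 hxx
    obtain ⟨c, rfl⟩ := Submodule.mem_span_singleton.1 hy
    have := f0.supSpanSingleton_apply_mk (star t * t) (d ^ 2) hx k hk c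
    change f _ ≤ _
    rw [this]
    simp only [f0, LinearMap.zero_apply, smul_eq_mul]
    change 0 + c * d ^ 2 ≤ pp (k + c • (star t * t))
    rw [zero_add]
    rcases le_or_gt c 0 with hc | hc
    · exact (mul_nonpos_of_nonpos_of_nonneg hc (sq_nonneg d)).trans (pp_nonneg _)
    · have hk' : c⁻¹ • k ∈ K := K.smul_of_tower_mem _ hk
      have := mul_le_mul_of_nonneg_left (key _ hk') hc.le
      rwa [← pp_smul c hc, smul_add, smul_smul, mul_inv_cancel₀ hc.ne', one_smul] at this)
  refine ⟨F, hF, ?_, ?_⟩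
  · have hre : ∀ k ∈ K, (F k).re = 0 := by
      intro k hk
      have h1 := hFf ⟨k, Submodule.mem_sup_left hk⟩
      have h2 := f0.supSpanSingleton_apply_mk_of_mem (x := star t * t) (d ^ 2) hx hk
      rw [h1]
      exact h2
    intro k hk
    apply Complex.ext
    · exact hre k hk
    · have := hre _ (K.smul_mem (-Complex.I) hk)
      simpa using this
  · have h1 := hFf ⟨star t * t, Submodule.mem_sup_right (Submodule.mem_span_singleton_self _)⟩
    have h2 := f0.supSpanSingleton_apply_self (d ^ 2) hx
    intro h0
    have : (F (star t * t)).re = d ^ 2 := h1.trans h2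
    rw [h0] at this
    simp at this
    nlinarith

end ideal
end FM

namespace FM
set_option linter.all false
set_option linter.style.haveILetI false
set_option linter.unnecessarySimpa false
open scoped ComplexOrder InnerProductSpace ComplexStarModule

section dsum
open scoped ENNReal
variable {A : Type} [NonUnitalCStarAlgebra A] {ι : Type} (H : ι → Type)
  [∀ i, NormedAddCommGroup (H i)] [∀ i, InnerProductSpace ℂ (H i)] [∀ i, CompleteSpace (H i)]

lemma dsum_mem (T : ∀ i, H i →L[ℂ] H i) (C : ℝ) (hC : ∀ i, ‖T i‖ ≤ C) (x : lp H 2) :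
    Memℓp (fun i => T i (x i)) 2 := by
  refine Memℓp.mono' ((lp.memℓp x).const_smul (C : ℂ)) ?_
  intro i
  rw [Pi.smul_apply, norm_smul]
  refine ((T i).le_opNorm _).trans ?_
  gcongr
  exact (hC i).trans (by simpa using le_abs_self C)

/-- direct sum of operators -/
def dsumOp (T : ∀ i, H i →L[ℂ] H i) (C : ℝ) (hC : ∀ i, ‖T i‖ ≤ C) : lp H 2 →L[ℂ] lp H 2 :=
  LinearMap.mkContinuous
    { toFun := fun x => ⟨fun i => T i (x i), dsum_mem H T C hC x⟩
      map_add' := fun x y => by ext i; simp; rfl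
      map_smul' := fun c x => by ext i; simp }
    ‖(C : ℂ)‖ (fun x => by
      rw [← norm_smul]
      refine lp.norm_mono (by norm_num) ?_
      intro i
      rw [lp.coeFn_smul, Pi.smul_apply, norm_smul]
      change ‖T i (x i)‖ ≤ _
      refine ((T i).le_opNorm _).trans ?_
      gcongr
      exact (hC i).trans (by simpa using le_abs_self C))

lemma dsumOp_apply (T : ∀ i, H i →L[ℂ] H i) (C : ℝ) (hC : ∀ i, ‖T i‖ ≤ C) (x : lp H 2) (i : ι) :
    dsumOp H T C hC x i = T i (x i) := rfl

lemma nush_norm_le {B : Type*} [NonUnitalCStarAlgebra B] (π : A →⋆ₙₐ[ℂ] B) (a : A) : ‖π a‖ ≤ ‖a‖ :=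
  NonUnitalStarAlgHom.norm_apply_le π a

lemma nush_cont {B : Type*} [NonUnitalCStarAlgebra B] (π : A →⋆ₙₐ[ℂ] B) : Continuous π :=
  AddMonoidHomClass.continuous_of_bound π 1 (fun a => by simpa using nush_norm_le π a)

/-- direct sum of representations -/
def dsumRep (π : ∀ i, A →⋆ₙₐ[ℂ] (H i →L[ℂ] H i)) : A →⋆ₙₐ[ℂ] (lp H 2 →L[ℂ] lp H 2) where
  toFun a := dsumOp H (fun i => π i a) ‖a‖ (fun i => nush_norm_le (π i) a)
  map_smul' c a := by ext x i; simp [dsumOp_apply]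
  map_zero' := by ext x i; simp [dsumOp_apply]
  map_add' a b := by ext x i; simp [dsumOp_apply]
  map_mul' a b := by ext x i; simp [dsumOp_apply]
  map_star' a := by
    rw [ContinuousLinearMap.star_eq_adjoint, ContinuousLinearMap.eq_adjoint_iff]
    intro x y
    rw [lp.inner_eq_tsum, lp.inner_eq_tsum]
    congr 1
    ext i
    rw [dsumOp_apply, dsumOp_apply, map_star, ContinuousLinearMap.star_eq_adjoint,
      ContinuousLinearMap.adjoint_inner_left]

lemma dsumRep_eq_zero_iff (π : ∀ i, A →⋆ₙₐ[ℂ] (H i →L[ℂ] H i)) (a : A) :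
    dsumRep H π a = 0 ↔ ∀ i, π i a = 0 := by
  classical
  constructor
  · intro h i
    ext x
    have := congrArg (fun y : lp H 2 => y i) (DFunLike.congr_fun h (lp.single 2 i x))
    simpa [dsumRep, dsumOp_apply] using this
  · intro h
    ext x i
    change (π i a) (x i) = 0
    rw [h i]; rfl

end dsum

section rep
variable {A : Type} [NonUnitalCStarAlgebra A]

lemma gns_eq_zero_iff (f : A →ₗ[ℂ] ℂ) (hf : IsPos f) (a : A) :
    letI := CStarAlgebra.spectralOrder A
    haveI := CStarAlgebra.spectralOrderedRing A
    (toP f hf).gnsNonUnitalStarAlgHom a = 0 ↔ ∀ b, f (star (a * b) * (a * b)) = 0 := by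
  letI := CStarAlgebra.spectralOrder A
  haveI := CStarAlgebra.spectralOrderedRing A
  set g := toP f hf
  have key : ∀ b : g.PreGNS, ‖g.gnsNonUnitalStarAlgHom a b‖ ^ 2 =
      (f (star (a * g.ofPreGNS b) * (a * g.ofPreGNS b)) : ℂ) := by
    intro b
    rw [g.gnsNonUnitalStarAlgHom_apply_coe, UniformSpace.Completion.norm_coe, g.preGNS_norm_sq]
    rfl
  constructor
  · intro h b
    have := key (g.toPreGNS b)
    rw [h] at this
    simpa using this.symm
  · intro h
    ext x
    induction x using UniformSpace.Completion.induction_on with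
    | hp => exact isClosed_eq (by fun_prop) (by fun_prop)
    | ih b =>
      have := key b
      rw [h] at this
      have h2 : ‖g.gnsNonUnitalStarAlgHom a b‖ = 0 := by
        have h3 : ((‖g.gnsNonUnitalStarAlgHom a b‖ ^ 2 : ℝ) : ℂ) = 0 := by push_cast; exact this
        exact pow_eq_zero_iff (two_ne_zero) |>.1 (by exact_mod_cast h3)
      exact norm_eq_zero.1 h2

lemma mem_of_star_mul_self_mem (K : Submodule ℂ A) (hK : IsCIdeal K) (t : A) (h : star t * t ∈ K) :
    t ∈ K := by
  by_contra ht
  obtain ⟨F, -, h1, h2⟩ := exists_qstate_ideal K hK t ht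
  exact h2 (h1 _ h)

theorem exists_rep (K : Submodule ℂ A) (hK : IsCIdeal K) :
    ∃ (H : Type) (_ : NormedAddCommGroup H) (_ : InnerProductSpace ℂ H) (_ : CompleteSpace H)
      (π : A →⋆ₙₐ[ℂ] (H →L[ℂ] H)), ∀ a, π a = 0 ↔ a ∈ K := by
  letI := CStarAlgebra.spectralOrder A
  haveI := CStarAlgebra.spectralOrderedRing A
  let ι := {f : A →ₗ[ℂ] ℂ // IsPos f ∧ ∀ k ∈ K, f k = 0}
  let H : ι → Type := fun i => (toP i.1 i.2.1).GNS
  refine ⟨lp H 2, inferInstance, inferInstance, inferInstance,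
    dsumRep H (fun i => (toP i.1 i.2.1).gnsNonUnitalStarAlgHom), ?_⟩
  intro a
  rw [dsumRep_eq_zero_iff]
  constructor
  · intro h
    by_contra ha
    have h1 : a * star a ∉ K := by
      intro h2
      have h3 := mem_of_star_mul_self_mem K hK (star a) (by simpa using h2)
      exact ha (by simpa using hK.star_mem _ h3)
    obtain ⟨F, hF, h4, h5⟩ := exists_qstate_ideal K hK _ h1
    exact h5 ((gns_eq_zero_iff F hF.pos a).1 (h ⟨F, hF.pos, h4⟩) (star a))
  · intro ha i
    refine (gns_eq_zero_iff i.1 i.2.1 a).2 fun b => i.2.2 _ ?_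
    exact hK.mul_left _ _ (hK.mul_right _ _ ha)

theorem exists_faithful_rep (A : Type) [NonUnitalCStarAlgebra A] :
    ∃ (H : Type) (_ : NormedAddCommGroup H) (_ : InnerProductSpace ℂ H) (_ : CompleteSpace H)
      (π : A →⋆ₙₐ[ℂ] (H →L[ℂ] H)), Function.Injective π := by
  obtain ⟨H, i1, i2, i3, π, h⟩ := exists_rep (⊥ : Submodule ℂ A)
    ⟨by simp, by simp +contextual, by simp +contextual, by simp +contextual⟩
  refine ⟨H, i1, i2, i3, π, (injective_iff_map_eq_zero π).2 fun a ha => ?_⟩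
  simpa using (h a).1 ha

end rep

section range
variable {A B : Type} [NonUnitalCStarAlgebra A] [NonUnitalCStarAlgebra B]

lemma lift_sa (π : A →⋆ₙₐ[ℂ] B) (a : A) (ha : IsSelfAdjoint a) :
    ∃ a', IsSelfAdjoint a' ∧ π a' = π a ∧ ‖a'‖ ≤ ‖π a‖ := by
  set r := ‖π a‖
  let f : ℝ → ℝ := fun t => max (-r) (min t r)
  have hr : 0 ≤ r := norm_nonneg _
  have hf0 : f 0 = 0 := by simp [f, hr]
  have hc : Continuous f := by fun_prop
  refine ⟨cfcₙ f a, IsSelfAdjoint.cfcₙ, ?_, ?_⟩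
  · have hπa : IsSelfAdjoint (π a) := ha.map π
    have := NonUnitalStarAlgHom.map_cfcₙ π f a hc.continuousOn hf0
      (nush_cont π) ha hπa
    rw [this]
    conv_rhs => rw [← cfcₙ_id ℝ (π a)]
    apply cfcₙ_congr
    intro t ht
    have h1 : |t| ≤ r := by
      have := (norm_cfcₙ_le_iff (𝕜 := ℝ) (fun t => t) (π a) r).1 (by rw [cfcₙ_id' ℝ (π a)]) t ht
      simpa using this
    rw [abs_le] at h1
    simp [f, h1.1, h1.2]
  · refine norm_cfcₙ_le ?_
    intro t _
    rw [Real.norm_eq_abs, abs_le]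
    exact ⟨le_max_left _ _, max_le (by linarith) (min_le_right _ _)⟩

lemma lift_norm (π : A →⋆ₙₐ[ℂ] B) (a : A) :
    ∃ a', π a' = π a ∧ ‖a'‖ ≤ 2 * ‖π a‖ := by
  obtain ⟨x, hx, hx1, hx2⟩ := lift_sa π (ℜ a : A) (ℜ a).2
  obtain ⟨y, hy, hy1, hy2⟩ := lift_sa π (ℑ a : A) (ℑ a).2
  refine ⟨x + Complex.I • y, ?_, ?_⟩
  · rw [map_add, map_smul, hx1, hy1, ← map_smul, ← map_add, realPart_add_I_smul_imaginaryPart]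
  · have e1 : π (ℜ a : A) = (ℜ (π a) : B) := by
      rw [realPart_apply_coe, realPart_apply_coe]
      rw [← Complex.coe_smul, ← Complex.coe_smul, map_smul]; simp [map_add, map_star]
    have e2 : π (ℑ a : A) = (ℑ (π a) : B) := by
      rw [imaginaryPart_apply_coe, imaginaryPart_apply_coe]
      rw [← Complex.coe_smul, ← Complex.coe_smul]; simp [map_sub, map_star]
    rw [e1] at hx2
    rw [e2] at hy2
    have h3 := realPart.norm_le (π a)
    have h4 := imaginaryPart.norm_le (π a)
    calc _ ≤ ‖x‖ + ‖Complex.I • y‖ := norm_add_le _ _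
      _ = ‖x‖ + ‖y‖ := by rw [norm_smul]; simp
      _ ≤ ‖π a‖ + ‖π a‖ := add_le_add (hx2.trans h3) (hy2.trans h4)
      _ = _ := by ring

theorem isClosed_range (π : A →⋆ₙₐ[ℂ] B) : IsClosed (Set.range π) := by
  have hc : Continuous π := (nush_cont π)
  rw [← isSeqClosed_iff_isClosed]
  intro u b hu hb
  -- fast subsequence
  have hcs : CauchySeq u := hb.cauchySeq
  obtain ⟨φ, hφ, hφ2⟩ := cauchySeq_iff_le_tendsto_0.1 hcs |> fun _ =>
    (show ∃ φ : ℕ → ℕ, StrictMono φ ∧ ∀ n, ‖u (φ (n+1)) - u (φ n)‖ < (1/2:ℝ)^n by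
      obtain ⟨φ, h1, h2⟩ := hcs.subseq_mem (V := fun n => {p : B × B | dist p.1 p.2 < (1/2:ℝ)^n})
        (fun n => Metric.dist_mem_uniformity (by positivity))
      exact ⟨φ, h1, fun n => by have := h2 n; rwa [Set.mem_setOf_eq, dist_eq_norm] at this⟩)
  choose v hv using hu
  have : ∀ n, ∃ w : A, π w = u (φ (n+1)) - u (φ n) ∧ ‖w‖ ≤ 2 * (1/2:ℝ)^n := by
    intro n
    obtain ⟨w, hw1, hw2⟩ := lift_norm π (v (φ (n+1)) - v (φ n))
    rw [map_sub, hv, hv] at hw1 hw2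
    exact ⟨w, hw1, hw2.trans (by have := (hφ2 n).le; linarith)⟩
  choose w hw1 hw2 using this
  have hs : Summable w := Summable.of_norm_bounded
    ((summable_geometric_two).mul_left 2) hw2
  refine ⟨v (φ 0) + ∑' n, w n, ?_⟩
  have h1 : Filter.Tendsto (fun n => π (v (φ 0) + ∑ i ∈ Finset.range n, w i)) Filter.atTop
      (nhds (π (v (φ 0) + ∑' n, w n))) :=
    (hc.tendsto _).comp (tendsto_const_nhds.add hs.hasSum.tendsto_sum_nat)
  have h2 : (fun n => π (v (φ 0) + ∑ i ∈ Finset.range n, w i)) = u ∘ φ := by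
    ext n
    rw [map_add, map_sum, hv]
    simp_rw [hw1]
    rw [Finset.sum_range_sub (fun n => u (φ n))]
    simp
  rw [h2] at h1
  exact tendsto_nhds_unique h1 (hb.comp hφ.tendsto_atTop)

end range
end FM

namespace FM
set_option linter.all false
set_option linter.style.haveILetI false
set_option linter.unnecessarySimpa false
open scoped ComplexOrder InnerProductSpace ComplexStarModule

section slice
variable {E : Type*} [AddCommGroup E] [Module ℝ E] [TopologicalSpace E]
  [IsTopologicalAddGroup E] [ContinuousSMul ℝ E]

lemma isCompact_convexJoin {s t : Set E} (hs : IsCompact s) (ht : IsCompact t) :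
    IsCompact (convexJoin ℝ s t) := by
  have : convexJoin ℝ s t = (fun p : (E × E) × ℝ => (1 - p.2) • p.1.1 + p.2 • p.1.2) ''
      ((s ×ˢ t) ×ˢ Set.Icc 0 1) := by
    ext x
    simp only [mem_convexJoin, segment_eq_image, Set.mem_image, Prod.exists, Set.mem_prod]
    constructor
    · rintro ⟨a, ha, b, hb, θ, hθ, rfl⟩
      exact ⟨a, b, θ, ⟨⟨ha, hb⟩, hθ⟩, rfl⟩
    · rintro ⟨a, b, θ, ⟨⟨ha, hb⟩, hθ⟩, rfl⟩
      exact ⟨a, ha, b, hb, θ, hθ, rfl⟩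
  rw [this]
  refine ((hs.prod ht).prod isCompact_Icc).image ?_
  fun_prop

lemma ext_hull {ι : Type*} {K : Set E} (hK : Convex ℝ K) {f : E} (hf : f ∈ K.extremePoints ℝ)
    (D0 : Set E) (h0 : IsCompact D0) (h0c : Convex ℝ D0) (h0K : D0 ⊆ K) (h0f : f ∉ D0)
    (h0n : D0.Nonempty)
    (C : ι → Set E) (hC : ∀ i, IsCompact (C i)) (hCc : ∀ i, Convex ℝ (C i)) (hCK : ∀ i, C i ⊆ K)
    (hCf : ∀ i, f ∉ C i) (s : Finset ι) :
    ∃ D : Set E, IsCompact D ∧ Convex ℝ D ∧ D ⊆ K ∧ f ∉ D ∧ D0 ⊆ D ∧ ∀ i ∈ s, C i ⊆ D := by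
  classical
  induction s using Finset.induction_on with
  | empty => exact ⟨D0, h0, h0c, h0K, h0f, le_rfl, by simp⟩
  | insert i s hi ih =>
    obtain ⟨D, d1, d2, d3, d4, d5, d6⟩ := ih
    by_cases hne : (C i).Nonempty
    · refine ⟨convexJoin ℝ D (C i), isCompact_convexJoin d1 (hC i), d2.convexJoin (hCc i),
        convexJoin_subset d3 (hCK i) hK, ?_, d5.trans (subset_convexJoin_left hne), ?_⟩
      · intro h
        obtain ⟨a, ha, b, hb, hab⟩ := mem_convexJoin.1 h
        have h2 := (mem_extremePoints_iff_forall_segment.1 hf).2 a (d3 ha) b (hCK i hb) hab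
        rcases h2 with h2 | h2
        · exact d4 (h2 ▸ ha)
        · exact hCf i (h2 ▸ hb)
      · intro j hj
        rcases Finset.mem_insert.1 hj with rfl | hj
        · exact subset_convexJoin_right (h0n.mono d5)
        · exact (d6 j hj).trans (subset_convexJoin_left hne)
    · refine ⟨D, d1, d2, d3, d4, d5, ?_⟩
      intro j hj
      rcases Finset.mem_insert.1 hj with rfl | hj
      · rw [Set.not_nonempty_iff_eq_empty.1 hne]; simp
      · exact d6 j hj
end slice

section QS
variable (A : Type) [NonUnitalCStarAlgebra A]

/-- set of quasi-states as functions -/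
def QS : Set (A → ℂ) := {φ | ∃ f : A →ₗ[ℂ] ℂ, QState f ∧ φ = f}

variable {A}
lemma QState.add_smul {f g : A →ₗ[ℂ] ℂ} (hf : QState f) (hg : QState g) (s t : ℝ) (hs : 0 ≤ s)
    (ht : 0 ≤ t) (hst : s + t = 1) : QState ((s : ℂ) • f + (t : ℂ) • g) := by
  constructor
  · intro a
    have h1 := hf.pos a
    have h2 := hg.pos a
    simp only [LinearMap.add_apply, LinearMap.smul_apply, smul_eq_mul]
    have : (0:ℂ) ≤ s := by exact_mod_cast hs
    have : (0:ℂ) ≤ t := by exact_mod_cast ht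
    positivity
  · intro a
    have h1 := hf.le a
    have h2 := hg.le a
    simp only [LinearMap.add_apply, LinearMap.smul_apply, smul_eq_mul]
    calc _ ≤ ‖(s:ℂ) * f a‖ + ‖(t:ℂ) * g a‖ := norm_add_le _ _
      _ = s * ‖f a‖ + t * ‖g a‖ := by simp [abs_of_nonneg hs, abs_of_nonneg ht]
      _ ≤ s * ‖a‖ + t * ‖a‖ := by gcongr
      _ = ‖a‖ := by rw [← add_mul, hst, one_mul]

lemma convex_QS : Convex ℝ (QS A) := by
  rintro _ ⟨f, hf, rfl⟩ _ ⟨g, hg, rfl⟩ s t hs ht hst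
  exact ⟨_, hf.add_smul hg s t hs ht hst, by ext a; simp⟩

lemma isClosed_QS : IsClosed (QS A) := by
  have : QS A = {φ : A → ℂ | (∀ a b, φ (a + b) = φ a + φ b) ∧ (∀ (c : ℂ) a, φ (c • a) = c * φ a) ∧
      (∀ a, 0 ≤ φ (star a * a)) ∧ ∀ a, ‖φ a‖ ≤ ‖a‖} := by
    ext φ
    constructor
    · rintro ⟨f, hf, rfl⟩
      exact ⟨by simp, by simp, hf.pos, hf.le⟩
    · rintro ⟨h1, h2, h3, h4⟩
      exact ⟨{ toFun := φ, map_add' := h1, map_smul' := h2 }, ⟨h3, h4⟩, rfl⟩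
  rw [this]
  simp only [Set.setOf_and, Set.setOf_forall]
  refine (isClosed_iInter fun a => isClosed_iInter fun b => isClosed_eq (by fun_prop) (by fun_prop)).inter
    ((isClosed_iInter fun a => isClosed_iInter fun b => isClosed_eq (by fun_prop) (by fun_prop)).inter
    ((isClosed_iInter fun a => isClosed_le (by fun_prop) (by fun_prop)).inter
    (isClosed_iInter fun a => isClosed_le (by fun_prop) (by fun_prop))))

lemma isCompact_QS : IsCompact (QS A) := by
  have h : IsCompact (Set.pi Set.univ fun a : A => Metric.closedBall (0:ℂ) ‖a‖) :=
    isCompact_univ_pi fun a => isCompact_closedBall _ _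
  refine h.of_isClosed_subset isClosed_QS ?_
  rintro _ ⟨f, hf, rfl⟩ a -
  simpa using hf.le a

lemma pi_dual {V : Type*} [AddCommGroup V] [Module ℂ V] (l : (V → ℂ) →L[ℝ] ℝ) :
    ∃ v : V, ∀ f : V →ₗ[ℂ] ℂ, l f = (f v).re := by
  classical
  -- continuity gives a finite set
  have h0 : {φ : V → ℂ | ‖l φ‖ < 1} ∈ nhds (0 : V → ℂ) := by
    refine (isOpen_lt (by fun_prop) continuous_const).mem_nhds ?_
    simp
  rw [nhds_pi, Filter.mem_pi'] at h0
  obtain ⟨I, t, ht, hI⟩ := h0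
  have hz : ∀ φ : V → ℂ, (∀ i ∈ I, φ i = 0) → l φ = 0 := by
    intro φ hφ
    by_contra hne
    have : ((2 / l φ) • φ) ∈ {φ : V → ℂ | ‖l φ‖ < 1} := by
      apply hI
      intro i hi
      simp only [Pi.smul_apply, hφ i hi, smul_zero]
      exact mem_of_mem_nhds (ht i)
    simp only [Set.mem_setOf_eq, map_smul, smul_eq_mul] at this
    rw [div_mul_cancel₀ _ hne] at this
    norm_num at this
  have hrep : ∀ φ : V → ℂ, l φ = ∑ i ∈ I, ((φ i).re * l (Pi.single i 1) + (φ i).im * l (Pi.single i Complex.I)) := by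
    intro φ
    have h1 : l (φ - ∑ i ∈ I, ((φ i).re • (Pi.single i (1:ℂ) : V → ℂ) + (φ i).im • (Pi.single i Complex.I : V → ℂ))) = 0 := by
      apply hz
      intro j hj
      rw [Pi.sub_apply, Finset.sum_apply, Finset.sum_eq_single j]
      · simp [Complex.re_add_im]
      · intro i _ hij
        simp [Pi.single_eq_of_ne hij.symm]
      · exact fun h => absurd hj h
    rw [map_sub, map_sum, sub_eq_zero] at h1
    rw [h1]
    simp
  refine ⟨∑ i ∈ I, ((l (Pi.single i 1) : ℂ) - Complex.I * l (Pi.single i Complex.I)) • i, fun f => ?_⟩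
  rw [hrep, map_sum, Complex.re_sum]
  refine Finset.sum_congr rfl fun i _ => ?_
  simp
  ring
end QS
end FM

namespace FM
set_option linter.all false
set_option linter.style.haveILetI false
set_option linter.unnecessarySimpa false
open scoped ComplexOrder InnerProductSpace ComplexStarModule

section exc
variable {A : Type} [NonUnitalCStarAlgebra A]

lemma exists_qstate_pp (y : A) (hy : IsSelfAdjoint y) : ∃ g : A →ₗ[ℂ] ℂ, QState g ∧ (g y).re = ‖y⁺‖ := by
  by_cases h0 : y = 0
  · refine ⟨0, ⟨fun a => by simp, fun a => by simp⟩, by simp [h0]⟩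
  obtain ⟨F, hF, h⟩ := exists_qstate_ext (A := A)
    (LinearPMap.mkSpanSingleton (K := ℝ) y ‖y⁺‖ h0) (by
      rintro ⟨x, hx⟩
      obtain ⟨c, rfl⟩ := Submodule.mem_span_singleton.1 hx
      have : (LinearPMap.mkSpanSingleton (K := ℝ) y ‖y⁺‖ h0) ⟨c • y, hx⟩ = c • ‖y⁺‖ :=
        LinearPMap.mkSpanSingleton'_apply _ _ _ _ _
      rw [this]
      rcases lt_or_ge 0 c with hc | hc
      · rw [pp_smul c hc, pp_sa y hy, smul_eq_mul]
      · refine le_trans ?_ (pp_nonneg _)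
        rw [smul_eq_mul]
        exact mul_nonpos_of_nonpos_of_nonneg hc (norm_nonneg _))
  refine ⟨F, hF, ?_⟩
  have := h ⟨y, Submodule.mem_span_singleton_self y⟩
  rw [this]
  exact LinearPMap.mkSpanSingleton_apply ℝ ℝ h0 ‖y⁺‖

lemma norm_le_of_pp (y : A) (hy : IsSelfAdjoint y) (C : ℝ) (hC : 0 ≤ C) (h1 : ‖y⁺‖ ≤ C)
    (h2 : ‖(-y)⁺‖ ≤ C) : ‖y‖ ≤ C := by
  have h1' := (norm_posPart_le_iff y hy C hC).1 h1
  have h2' := (norm_posPart_le_iff (-y) hy.neg C hC).1 h2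
  conv_lhs => rw [← cfcₙ_id' ℝ y]
  refine norm_cfcₙ_le fun t ht => ?_
  rw [Real.norm_eq_abs, abs_le]
  refine ⟨?_, h1' t ht⟩
  have : -t ∈ quasispectrum ℝ (-y) := by
    rw [Unitization.quasispectrum_eq_spectrum_inr' ℝ ℂ] at ht ⊢
    rw [Unitization.inr_neg, ← spectrum.neg_eq]
    simpa using ht
  linarith [h2' _ this]

lemma norm_le_of_qstate_sa (y : A) (hy : IsSelfAdjoint y) (C : ℝ)
    (h : ∀ g : A →ₗ[ℂ] ℂ, QState g → ‖g y‖ ≤ C) : ‖y‖ ≤ C := by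
  have hC : 0 ≤ C := (norm_nonneg _).trans (h 0 ⟨fun a => by simp, fun a => by simp⟩)
  refine norm_le_of_pp y hy C hC ?_ ?_
  · obtain ⟨g, hg, h1⟩ := exists_qstate_pp y hy
    rw [← h1]; exact ((Complex.re_le_norm _).trans (h g hg))
  · obtain ⟨g, hg, h1⟩ := exists_qstate_pp (-y) hy.neg
    rw [← h1]; refine ((Complex.re_le_norm _).trans ?_)
    rw [map_neg, norm_neg]; exact h g hg

lemma norm_le_of_qstate (y : A) (C : ℝ)
    (h : ∀ g : A →ₗ[ℂ] ℂ, QState g → ‖g y‖ ≤ C) : ‖y‖ ≤ 2 * C := by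
  have key : ∀ g : A →ₗ[ℂ] ℂ, QState g → ‖g (star y)‖ ≤ C := by
    intro g hg
    rw [hg.pos.map_star, norm_star]; exact h g hg
  have h1 : ‖(ℜ y : A)‖ ≤ C := by
    refine norm_le_of_qstate_sa _ (ℜ y).2 C fun g hg => ?_
    rw [realPart_apply_coe, ← Complex.coe_smul, map_smul, map_add, norm_smul]
    have := norm_add_le (g y) (g (star y))
    have a := h g hg
    have b := key g hg
    simp
    linarith
  have h2 : ‖(ℑ y : A)‖ ≤ C := by
    refine norm_le_of_qstate_sa _ (ℑ y).2 C fun g hg => ?_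
    rw [imaginaryPart_apply_coe, ← Complex.coe_smul, map_smul, map_smul, map_sub, norm_smul, norm_smul]
    have := norm_sub_le (g y) (g (star y))
    have a := h g hg
    have b := key g hg
    simp
    linarith
  calc ‖y‖ = ‖(ℜ y : A) + Complex.I • (ℑ y : A)‖ := by rw [realPart_add_I_smul_imaginaryPart]
    _ ≤ ‖(ℜ y : A)‖ + ‖Complex.I • (ℑ y : A)‖ := norm_add_le _ _
    _ ≤ 2 * C := by rw [norm_smul]; simp; linarith

lemma IsPos.mono_re {g : A →ₗ[ℂ] ℂ} (hg : IsPos g) :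
    letI := CStarAlgebra.spectralOrder A
    ∀ x y : A, x ≤ y → (g x).re ≤ (g y).re := by
  letI := CStarAlgebra.spectralOrder A
  haveI := CStarAlgebra.spectralOrderedRing A
  intro x y h
  have h1 := hg.map_nonneg _ (sub_nonneg.2 h)
  rw [map_sub] at h1
  have := (Complex.le_def.1 h1).1
  simp at this; linarith

lemma IsPos.conj_le {g : A →ₗ[ℂ] ℂ} (hg : IsPos g) (e x : A) :
    (g (star e * (star x * x) * e)).re ≤ ‖x‖ ^ 2 * (g (star e * e)).re := by
  letI := CStarAlgebra.spectralOrder A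
  haveI := CStarAlgebra.spectralOrderedRing A
  have := hg.mono_re _ _ (CStarAlgebra.star_left_conjugate_le_norm_smul (a := e) (b := star x * x)
    (IsSelfAdjoint.star_mul_self x))
  rw [← Complex.coe_smul, map_smul, CStarRing.norm_star_mul_self] at this
  simp at this
  simpa [sq] using this

lemma IsPos.norm_conj_le {g : A →ₗ[ℂ] ℂ} (hg : IsPos g) (e x : A) :
    ‖g (star e * x * e)‖ ≤ ‖x‖ * (g (star e * e)).re := by
  have h0 : 0 ≤ (g (star e * e)).re := (Complex.le_def.1 (hg e)).1
  have h1 := hg.cs e (x * e)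
  have h2 := hg.conj_le e x
  have : star (x * e) * (x * e) = star e * (star x * x) * e := by simp [mul_assoc]
  rw [this, ← mul_assoc] at h1
  refine abs_le_of_sq_le_sq' ?_ (by positivity) |>.2
  nlinarith

lemma excision {f : A →ₗ[ℂ] ℂ} (hf : (f : A → ℂ) ∈ (QS A).extremePoints ℝ) (hf0 : f ≠ 0)
    (s : Finset A) (ε : ℝ) (hε : 0 < ε) :
    ∃ e : A, IsSelfAdjoint e ∧ ‖e‖ = 1 ∧ ∀ a ∈ s, ‖e * a * e - f a • (e * e)‖ ≤ ε := by
  classical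
  obtain ⟨C, hC⟩ : ∃ C : A → Set (A → ℂ), C = fun a => QS A ∩ {φ | (f a).re + ε / 4 ≤ (φ a).re} :=
    ⟨_, rfl⟩
  have hfQ : QState f := by
    obtain ⟨f', h1, h2⟩ := hf.1
    have : f = f' := DFunLike.coe_injective h2
    rwa [this]
  have h0Q : (0 : A → ℂ) ∈ QS A := ⟨0, ⟨fun a => by simp, fun a => by simp⟩, rfl⟩
  obtain ⟨D, d1, d2, d3, d4, d5, d6⟩ := ext_hull convex_QS hf {0} isCompact_singleton
    (convex_singleton 0) (by simpa using h0Q) (by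
      simp only [Set.mem_singleton_iff]; intro h; exact hf0 (DFunLike.coe_injective h))
    (Set.singleton_nonempty _) C
    (fun a => by
      rw [hC]; exact isCompact_QS.inter_right (isClosed_le (by fun_prop) (by fun_prop)))
    (fun a => by
      rw [hC]
      refine convex_QS.inter ?_
      intro φ hφ ψ hψ s t hs ht hst
      simp only [Set.mem_setOf_eq] at *
      simp
      calc (f a).re + ε / 4 = s * ((f a).re + ε / 4) + t * ((f a).re + ε / 4) := by
            rw [← add_mul, hst, one_mul]
        _ ≤ _ := by gcongr)
    (fun a => by rw [hC]; exact fun φ h => h.1)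
    (fun a => by rw [hC]; rintro ⟨-, h⟩; rw [Set.mem_setOf_eq] at h; linarith)
    (s ∪ s.image (fun a => -a) ∪ s.image (fun a => Complex.I • a) ∪ s.image (fun a => -(Complex.I • a)))
  obtain ⟨l, u, hl1, hl2⟩ := geometric_hahn_banach_closed_point d2 d1.isClosed d4
  obtain ⟨v, hv⟩ := pi_dual l
  have hu : 0 < u := by simpa using hl1 0 (d5 rfl)
  -- pass to self-adjoint part
  have hre : ∀ g : A →ₗ[ℂ] ℂ, QState g → (g (ℜ v : A)).re = (g v).re := by
    intro g hg
    rw [realPart_apply_coe, ← Complex.coe_smul, map_smul, map_add, hg.pos.map_star]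
    simp; ring
  obtain ⟨a, haa⟩ : ∃ a : A, a = (ℜ v : A) := ⟨_, rfl⟩
  have ha : IsSelfAdjoint a := haa ▸ (ℜ v).2
  have hfa : u < (f a).re := by rw [haa, hre f hfQ, ← hv]; exact hl2
  have hclose : ∀ g : A →ₗ[ℂ] ℂ, QState g → u ≤ (g a).re → ∀ x ∈ s, ‖g x - f x‖ ≤ ε / 2 := by
    intro g hg hga x hx
    have hgD : (g : A → ℂ) ∉ D := by
      intro h
      have := hl1 _ h
      rw [hv, ← hre g hg, ← haa] at this
      linarith
    have hn : ∀ y, y ∈ (s ∪ s.image (fun a => -a) ∪ s.image (fun a => Complex.I • a) ∪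
        s.image (fun a => -(Complex.I • a))) → (g y).re < (f y).re + ε / 4 := by
      intro y hy
      by_contra hcon
      apply hgD
      apply d6 y hy
      rw [hC]
      exact ⟨⟨g, hg, rfl⟩, not_lt.1 hcon⟩
    have n1 := hn x (by simp [hx])
    have n2 := hn (-x) (by simp only [Finset.mem_union]; exact Or.inl (Or.inl (Or.inr (Finset.mem_image_of_mem _ hx))))
    have n3 := hn (Complex.I • x) (by simp only [Finset.mem_union]; exact (Or.inl (Or.inr (Finset.mem_image_of_mem _ hx))))
    have n4 := hn (-(Complex.I • x)) (by simp only [Finset.mem_union]; exact ((Or.inr (Finset.mem_image_of_mem _ hx))))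
    simp at n2 n3 n4
    refine (Complex.norm_le_abs_re_add_abs_im _).trans ?_
    have e1 : |(g x - f x).re| ≤ ε / 4 := by rw [abs_le]; simp; constructor <;> linarith
    have e2 : |(g x - f x).im| ≤ ε / 4 := by rw [abs_le]; simp; constructor <;> linarith
    linarith
  -- the element
  let F : ℝ → ℝ := fun t => max (t - u) 0
  have hF0 : F 0 = 0 := by simp [F, hu.le]
  have hFc : Continuous F := by fun_prop
  letI := CStarAlgebra.spectralOrder A
  haveI := CStarAlgebra.spectralOrderedRing A
  obtain ⟨k, hk⟩ : ∃ k, k = cfcₙ F a := ⟨_, rfl⟩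
  have hks : IsSelfAdjoint k := hk ▸ IsSelfAdjoint.cfcₙ
  have hkne : k ≠ 0 := by
    intro h
    have h1 := hfQ.le_pp a ha
    have h2 : ‖a⁺‖ ≤ u := by
      rw [norm_posPart_le_iff a ha u hu.le]
      intro t ht
      by_contra hcon
      push Not at hcon
      have := (norm_cfcₙ_le_iff F a 0 (hf₀ := hF0) (ha := ha)).1 (by rw [← hk, h, norm_zero]) t ht
      rw [norm_le_zero_iff] at this
      simp [F] at this
      linarith
    linarith
  have hkak : u • (k * k) ≤ k * a * k := by
    rw [← sub_nonneg]
    have : k * a * k - u • (k * k) = cfcₙ (fun t => F t * t * F t - u • (F t * F t)) a := by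
      rw [cfcₙ_sub (fun t => F t * t * F t) (fun t => u • (F t * F t)) a (by fun_prop) (by simp [hF0]) (by fun_prop) (by simp [hF0]),
        cfcₙ_smul u (fun t => F t * F t) a (by fun_prop) (by simp [hF0]),
        cfcₙ_mul (fun t => F t * t) F a (by fun_prop) (by simp [hF0]) (by fun_prop) hF0,
        cfcₙ_mul F F a (by fun_prop) hF0 (by fun_prop) hF0,
        cfcₙ_mul F (fun t => t) a (by fun_prop) hF0 (by fun_prop) rfl, cfcₙ_id' ℝ a, hk]
    rw [this]
    refine cfcₙ_nonneg fun t ht => ?_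
    have : F t * t * F t - u • (F t * F t) = (F t * F t) * (t - u) := by simp; ring
    rw [this]
    rcases le_total t u with h | h
    · have : F t = 0 := by simp [F, h]
      simp [this]
    · exact mul_nonneg (mul_self_nonneg _) (by linarith)
  have main : ∀ x ∈ s, ‖k * x * k - f x • (k * k)‖ ≤ ε * ‖k‖ ^ 2 := by
    intro x hx
    have := norm_le_of_qstate (k * x * k - f x • (k * k)) (ε / 2 * ‖k‖ ^ 2) ?_
    · linarith
    intro g hg
    have hkk : star k * k = k * k := by rw [hks.star_eq]
    have hp : 0 ≤ g (k * k) := hkk ▸ hg.pos k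
    obtain ⟨r, hr⟩ : ∃ r : ℝ, r = (g (k * k)).re := ⟨_, rfl⟩
    have hgr : g (k * k) = r := by rw [hr, ← hkk]; exact hg.pos.re_of_sa _ (IsSelfAdjoint.star_mul_self k)
    have hr0 : 0 ≤ r := by rw [hgr] at hp; exact_mod_cast hp
    have hrk : r ≤ ‖k‖ ^ 2 := by
      rw [hr]
      refine (Complex.re_le_norm _).trans ((hg.le _).trans ?_)
      rw [sq]; exact norm_mul_le _ _
    have hnc : ∀ y, ‖g (k * y * k)‖ ≤ ‖y‖ * r := by
      intro y
      have := hg.pos.norm_conj_le k y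
      rwa [hks.star_eq, ← hr] at this
    rw [map_sub, map_smul, hgr, smul_eq_mul]
    rcases hr0.eq_or_lt with h | h
    · have := hnc x
      rw [← h] at this ⊢
      simp only [Complex.ofReal_zero, mul_zero, sub_zero] at this ⊢
      exact this.trans (by positivity)
    · let g' : A →ₗ[ℂ] ℂ := ((r⁻¹ : ℝ) : ℂ) • g ∘ₗ (LinearMap.mulLeft ℂ k) ∘ₗ (LinearMap.mulRight ℂ k)
      have hg' : ∀ y, g' y = ((r⁻¹ : ℝ) : ℂ) * g (k * y * k) := by
        intro y; simp [g', mul_assoc]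
      have hgQ : QState g' := by
        constructor
        · intro y
          rw [hg']
          have h1 := hg.pos (y * k)
          have h2 : star (y * k) * (y * k) = k * (star y * y) * k := by
            simp [mul_assoc, hks.star_eq]
          rw [h2] at h1
          have : (0:ℂ) ≤ ((r⁻¹ : ℝ) : ℂ) := by exact_mod_cast (inv_pos.2 h).le
          positivity
        · intro y
          rw [hg', norm_mul, Complex.norm_real, Real.norm_of_nonneg (inv_pos.2 h).le]
          rw [inv_mul_le_iff₀ h, mul_comm]
          exact hnc y
      have h3 := hclose g' hgQ (by
        rw [hg', Complex.re_ofReal_mul, inv_mul_eq_div, le_div_iff₀ h]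
        have := hg.pos.mono_re _ _ hkak
        rw [← Complex.coe_smul, map_smul, hgr] at this
        simpa using this) x hx
      rw [hg'] at h3
      have h4 : g (k * x * k) - f x * r = r * (((r⁻¹ : ℝ) : ℂ) * g (k * x * k) - f x) := by
        have : (r : ℂ) ≠ 0 := by exact_mod_cast h.ne'
        push_cast
        field_simp
      rw [h4, norm_mul, Complex.norm_real, Real.norm_of_nonneg hr0]
      calc _ ≤ r * (ε / 2) := by gcongr
        _ ≤ _ := by nlinarith
  have hkn : 0 < ‖k‖ := norm_pos_iff.2 hkne
  refine ⟨((‖k‖⁻¹ : ℝ) : ℂ) • k, ?_, ?_, ?_⟩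
  · rw [Complex.coe_smul]; exact (IsSelfAdjoint.all _).smul hks
  · rw [norm_smul, Complex.norm_real, norm_inv, norm_norm, inv_mul_cancel₀ hkn.ne']
  · intro x hx
    have : ((‖k‖⁻¹ : ℝ) : ℂ) • k * x * ((‖k‖⁻¹ : ℝ) : ℂ) • k - f x • (((‖k‖⁻¹ : ℝ) : ℂ) • k * ((‖k‖⁻¹ : ℝ) : ℂ) • k)
        = (((‖k‖⁻¹ : ℝ) : ℂ) * ((‖k‖⁻¹ : ℝ) : ℂ)) • (k * x * k - f x • (k * k)) := by
      simp only [smul_mul_assoc, mul_smul_comm, smul_smul, smul_sub]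
      congr 2; ring
    rw [this, norm_smul, norm_mul, Complex.norm_real, norm_inv, norm_norm]
    calc _ ≤ ‖k‖⁻¹ * ‖k‖⁻¹ * (ε * ‖k‖ ^ 2) := by gcongr; exact main x hx
      _ = ε := by field_simp
end exc
end FM

namespace FM
set_option linter.all false
set_option linter.style.haveILetI false
set_option linter.unnecessarySimpa false
open scoped ComplexOrder InnerProductSpace ComplexStarModule
open scoped TensorProduct Topology
open Filter

section tens
variable {A B T : Type} [NonUnitalCStarAlgebra A] [NonUnitalCStarAlgebra B] [NonUnitalCStarAlgebra T]

/-- the linear map from the algebraic tensor product -/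
def TJ (d : TensorData A B T) : A ⊗[ℂ] B →ₗ[ℂ] T :=
  TensorProduct.lift (LinearMap.mk₂ ℂ d.tmul d.add_left d.smul_left d.add_right d.smul_right)

@[simp] lemma TJ_tmul (d : TensorData A B T) (a : A) (b : B) : TJ d (a ⊗ₜ b) = d.tmul a b := by
  simp [TJ]

lemma TJ_dense (d : TensorData A B T) : DenseRange (TJ d) := by
  have h := d.dense
  rw [← Submodule.dense_iff_topologicalClosure_eq_top] at h
  refine h.mono ?_
  rw [← LinearMap.coe_range]
  rw [SetLike.coe_subset_coe, Submodule.span_le]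
  rintro _ ⟨p, rfl⟩
  exact ⟨p.1 ⊗ₜ p.2, by simp⟩

lemma TJ_mul (d : TensorData A B T) (x y : A ⊗[ℂ] B) : TJ d (x * y) = TJ d x * TJ d y := by
  induction x with
  | zero => simp
  | add x x' h h' => rw [add_mul, map_add, h, h', map_add, add_mul]
  | tmul a b =>
    induction y with
    | zero => simp
    | add x x' h h' => rw [mul_add, map_add, h, h', map_add, mul_add]
    | tmul a' b' => simp [d.mul_tmul]

lemma TJ_star (d : TensorData A B T) (x : A ⊗[ℂ] B) : TJ d (star x) = star (TJ d x) := by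
  induction x with
  | zero => simp
  | add x x' h h' => simp [h, h']
  | tmul a b => simp [d.star_tmul]

/-- tensor product of functionals -/
def tf (f : A →ₗ[ℂ] ℂ) (g : B →ₗ[ℂ] ℂ) : A ⊗[ℂ] B →ₗ[ℂ] ℂ :=
  LinearMap.mul' ℂ ℂ ∘ₗ TensorProduct.map f g

@[simp] lemma tf_tmul (f : A →ₗ[ℂ] ℂ) (g : B →ₗ[ℂ] ℂ) (a : A) (b : B) :
    tf f g (a ⊗ₜ b) = f a * g b := by simp [tf]

lemma tf_add_left (f f' : A →ₗ[ℂ] ℂ) (g : B →ₗ[ℂ] ℂ) : tf (f + f') g = tf f g + tf f' g := by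
  ext; simp [add_mul]
lemma tf_smul_left (c : ℂ) (f : A →ₗ[ℂ] ℂ) (g : B →ₗ[ℂ] ℂ) : tf (c • f) g = c • tf f g := by
  ext; simp [mul_assoc]
lemma tf_add_right (f : A →ₗ[ℂ] ℂ) (g g' : B →ₗ[ℂ] ℂ) : tf f (g + g') = tf f g + tf f g' := by
  ext; simp [mul_add]
lemma tf_smul_right (c : ℂ) (f : A →ₗ[ℂ] ℂ) (g : B →ₗ[ℂ] ℂ) : tf f (c • g) = c • tf f g := by
  ext; simp; ring

lemma tmul_neg (d : TensorData A B T) (a : A) (b : B) : d.tmul (-a) b = - d.tmul a b := by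
  rw [← TJ_tmul, ← TJ_tmul, TensorProduct.neg_tmul, map_neg]

lemma takesaki_ext (d : TensorData A B T) {f : A →ₗ[ℂ] ℂ} {g : B →ₗ[ℂ] ℂ}
    (hf : (f : A → ℂ) ∈ (QS A).extremePoints ℝ) (hg : (g : B → ℂ) ∈ (QS B).extremePoints ℝ)
    (z : A ⊗[ℂ] B) : ‖tf f g z‖ ≤ ‖TJ d z‖ := by
  classical
  by_cases hf0 : f = 0
  · have : tf f g = 0 := by ext; simp [hf0]
    simp [this]
  by_cases hg0 : g = 0
  · have : tf f g = 0 := by ext; simp [hg0]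
    simp [this]
  have hfQ : QState f := by
    obtain ⟨f', h1, h2⟩ := hf.1
    rwa [show f = f' from DFunLike.coe_injective h2]
  obtain ⟨S, rfl⟩ := TensorProduct.exists_finset z
  refine le_of_forall_pos_le_add fun ε hε => ?_
  obtain ⟨M, hM⟩ : ∃ M, M = ∑ p ∈ S, (‖p.1‖ + ‖p.2‖) := ⟨_, rfl⟩
  have hM0 : 0 ≤ M := by rw [hM]; positivity
  obtain ⟨e, e1, e2, e3⟩ := excision hf hf0 (S.image Prod.fst) (ε / (M + 1)) (by positivity)
  obtain ⟨k, k1, k2, k3⟩ := excision hg hg0 (S.image Prod.snd) (ε / (M + 1)) (by positivity)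
  have hee : ‖e * e‖ = 1 := by
    have := CStarRing.norm_star_mul_self (x := e)
    rw [e1.star_eq] at this; rw [this, e2]; simp
  have hkk : ‖k * k‖ = 1 := by
    have := CStarRing.norm_star_mul_self (x := k)
    rw [k1.star_eq] at this; rw [this, k2]; simp
  have hek : ‖d.tmul e k‖ = 1 := by rw [d.norm_tmul, e2, k2]; simp
  have h1 : ‖d.tmul e k * TJ d (∑ p ∈ S, p.1 ⊗ₜ[ℂ] p.2) * d.tmul e k‖ ≤ ‖TJ d (∑ p ∈ S, p.1 ⊗ₜ[ℂ] p.2)‖ := by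
    refine (norm_mul_le _ _).trans ?_
    rw [hek, mul_one]
    refine (norm_mul_le _ _).trans ?_
    rw [hek, one_mul]
  have h2 : ‖d.tmul e k * TJ d (∑ p ∈ S, p.1 ⊗ₜ[ℂ] p.2) * d.tmul e k
      - tf f g (∑ p ∈ S, p.1 ⊗ₜ[ℂ] p.2) • d.tmul (e * e) (k * k)‖ ≤ ε := by
    simp only [map_sum, Finset.mul_sum, Finset.sum_mul, Finset.sum_smul, ← Finset.sum_sub_distrib]
    refine (norm_sum_le _ _).trans ?_
    calc _ ≤ ∑ p ∈ S, (‖p.1‖ + ‖p.2‖) * (ε / (M + 1)) := by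
          refine Finset.sum_le_sum fun p hp => ?_
          have a1 := e3 p.1 (Finset.mem_image_of_mem _ hp)
          have a2 := k3 p.2 (Finset.mem_image_of_mem _ hp)
          have : d.tmul e k * TJ d (p.1 ⊗ₜ[ℂ] p.2) * d.tmul e k - tf f g (p.1 ⊗ₜ[ℂ] p.2) • d.tmul (e * e) (k * k)
            = d.tmul (e * p.1 * e - f p.1 • (e * e)) (k * p.2 * k) + d.tmul (f p.1 • (e * e)) (k * p.2 * k - g p.2 • (k * k)) := by
            simp only [sub_eq_add_neg, d.add_left, d.add_right, TJ_tmul, d.mul_tmul, tf_tmul]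
            rw [tmul_neg, ← neg_one_smul ℂ (g p.2 • (k * k)), d.smul_right, d.smul_right, d.smul_left, d.smul_left]
            module
          rw [this]
          refine (norm_add_le _ _).trans ?_
          rw [d.norm_tmul, d.norm_tmul, norm_smul, hee]
          have b1 : ‖k * p.2 * k‖ ≤ ‖p.2‖ := by
            refine (norm_mul_le _ _).trans ?_
            rw [k2, mul_one]
            refine (norm_mul_le _ _).trans ?_
            rw [k2, one_mul]
          have b2 := hfQ.le p.1
          have : 0 ≤ ε / (M + 1) := by positivity
          calc _ ≤ (ε / (M + 1)) * ‖p.2‖ + ‖p.1‖ * 1 * (ε / (M + 1)) := by gcongr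
            _ = _ := by ring
      _ = M * (ε / (M + 1)) := by rw [← Finset.sum_mul, ← hM]
      _ ≤ ε := by
        rw [← mul_div_assoc, div_le_iff₀ (by linarith)]; nlinarith
  have h3 : ‖tf f g (∑ p ∈ S, p.1 ⊗ₜ[ℂ] p.2) • d.tmul (e * e) (k * k)‖ = ‖tf f g (∑ p ∈ S, p.1 ⊗ₜ[ℂ] p.2)‖ := by
    rw [norm_smul, d.norm_tmul, hee, hkk]; simp
  rw [← h3]
  have := norm_sub_norm_le (tf f g (∑ p ∈ S, p.1 ⊗ₜ[ℂ] p.2) • d.tmul (e * e) (k * k)) (d.tmul e k * TJ d (∑ p ∈ S, p.1 ⊗ₜ[ℂ] p.2) * d.tmul e k)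
  rw [norm_sub_rev] at this
  linarith

/-- a closed convex condition valid on extreme points is valid on quasi states -/
lemma qs_induct (P : Set (A → ℂ)) (hP : IsClosed P) (hPc : Convex ℝ P)
    (h : ∀ f : A →ₗ[ℂ] ℂ, (f : A → ℂ) ∈ (QS A).extremePoints ℝ → (f : A → ℂ) ∈ P)
    (f : A →ₗ[ℂ] ℂ) (hf : QState f) : (f : A → ℂ) ∈ P := by
  have h1 : closure (convexHull ℝ ((QS A).extremePoints ℝ)) ⊆ P := by
    refine closure_minimal (convexHull_min ?_ hPc) hP
    intro φ hφ
    obtain ⟨f', -, rfl⟩ := hφ.1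
    exact h f' hφ
  rw [closure_convexHull_extremePoints isCompact_QS convex_QS] at h1
  exact h1 ⟨f, hf, rfl⟩

lemma convex_norm_le {E : Type*} [AddCommGroup E] [Module ℝ E] (L : E →ₗ[ℝ] ℂ) (C : ℝ) :
    Convex ℝ {x | ‖L x‖ ≤ C} := by
  have : {x | ‖L x‖ ≤ C} = L ⁻¹' (Metric.closedBall 0 C) := by ext; simp
  rw [this]
  exact (convex_closedBall 0 C).linear_preimage L

theorem takesaki (d : TensorData A B T) {f : A →ₗ[ℂ] ℂ} {g : B →ₗ[ℂ] ℂ}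
    (hf : QState f) (hg : QState g) (z : A ⊗[ℂ] B) : ‖tf f g z‖ ≤ ‖TJ d z‖ := by
  obtain ⟨S, rfl⟩ := TensorProduct.exists_finset z
  have key : ∀ (f : A →ₗ[ℂ] ℂ) (g : B →ₗ[ℂ] ℂ), tf f g (∑ p ∈ S, p.1 ⊗ₜ[ℂ] p.2) = ∑ p ∈ S, f p.1 * g p.2 := by
    intro f g; simp
  have step : ∀ f : A →ₗ[ℂ] ℂ, QState f → ∀ g : B →ₗ[ℂ] ℂ, (g : B → ℂ) ∈ (QS B).extremePoints ℝ →
      ‖∑ p ∈ S, f p.1 * g p.2‖ ≤ ‖TJ d (∑ p ∈ S, p.1 ⊗ₜ[ℂ] p.2)‖ := by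
    intro f hf g hg
    let L : (A → ℂ) →ₗ[ℝ] ℂ := 
      { toFun := fun φ => ∑ p ∈ S, φ p.1 * g p.2
        map_add' := by intro x y; simp [add_mul, Finset.sum_add_distrib]
        map_smul' := by intro c x; simp [Finset.smul_sum, mul_assoc] }
    have hL : Continuous L := by change Continuous (fun φ : A → ℂ => ∑ p ∈ S, φ p.1 * g p.2); fun_prop
    refine qs_induct {φ | ‖L φ‖ ≤ ‖TJ d (∑ p ∈ S, p.1 ⊗ₜ[ℂ] p.2)‖} (isClosed_le (by fun_prop) (by fun_prop))
      (convex_norm_le L _) ?_ f hf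
    intro f' hf'
    have := takesaki_ext d hf' hg (∑ p ∈ S, p.1 ⊗ₜ[ℂ] p.2)
    rw [key] at this
    exact this
  rw [key]
  let L : (B → ℂ) →ₗ[ℝ] ℂ := 
      { toFun := fun φ => ∑ p ∈ S, f p.1 * φ p.2
        map_add' := by intro x y; simp [mul_add, Finset.sum_add_distrib]
        map_smul' := by intro c x; simp [Finset.smul_sum, mul_left_comm] }
  have hL : Continuous L := by change Continuous (fun φ : B → ℂ => ∑ p ∈ S, f p.1 * φ p.2); fun_prop
  exact qs_induct {φ | ‖L φ‖ ≤ ‖TJ d (∑ p ∈ S, p.1 ⊗ₜ[ℂ] p.2)‖} (isClosed_le (by fun_prop) (by fun_prop))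
      (convex_norm_le L _) (step f hf) g hg

/-- span of quasi-states -/
def SQ (A : Type) [NonUnitalCStarAlgebra A] : Submodule ℂ (A →ₗ[ℂ] ℂ) :=
  Submodule.span ℂ {f | QState f}

lemma IsPos.mem_SQ {f : A →ₗ[ℂ] ℂ} (hf : IsPos f) : f ∈ SQ A := by
  obtain ⟨C, hC, h⟩ := hf.bound
  have h1 : QState (((C + 1)⁻¹ : ℝ) • f : A →ₗ[ℂ] ℂ) := by
    constructor
    · intro a
      have : (0:ℂ) ≤ (((C + 1)⁻¹ : ℝ) : ℂ) := by exact_mod_cast (by positivity : (0:ℝ) ≤ (C+1)⁻¹)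
      have h2 := hf a
      simp only [LinearMap.smul_apply, Complex.real_smul]
      positivity
    · intro a
      simp only [LinearMap.smul_apply, norm_smul]
      rw [Real.norm_of_nonneg (by positivity), inv_mul_le_iff₀ (by positivity)]
      exact (h a).trans (by gcongr; linarith)
  have h2 : f = ((C + 1 : ℝ) : ℂ) • (((C + 1)⁻¹ : ℝ) • f : A →ₗ[ℂ] ℂ) := by
    ext a
    simp only [LinearMap.smul_apply, Complex.real_smul, smul_eq_mul]
    have : ((C + 1 : ℝ) : ℂ) ≠ 0 := by exact_mod_cast (by positivity : (C + 1) ≠ 0)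
    push_cast at this ⊢
    field_simp
  rw [h2]
  exact Submodule.smul_mem _ _ (Submodule.subset_span h1)

theorem tf_bounded (d : TensorData A B T) {f : A →ₗ[ℂ] ℂ} {g : B →ₗ[ℂ] ℂ}
    (hf : f ∈ SQ A) (hg : g ∈ SQ B) : ∃ C, ∀ z, ‖tf f g z‖ ≤ C * ‖TJ d z‖ := by
  induction hf using Submodule.span_induction with
  | zero => exact ⟨0, fun z => by simp [show tf (0 : A →ₗ[ℂ] ℂ) g = 0 by ext; simp]⟩
  | add f f' _ _ h h' =>
    obtain ⟨C, h⟩ := h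
    obtain ⟨C', h'⟩ := h'
    refine ⟨C + C', fun z => ?_⟩
    rw [tf_add_left, LinearMap.add_apply, add_mul]
    exact (norm_add_le _ _).trans (add_le_add (h z) (h' z))
  | smul c f _ h =>
    obtain ⟨C, h⟩ := h
    refine ⟨‖c‖ * C, fun z => ?_⟩
    rw [tf_smul_left, LinearMap.smul_apply, norm_smul, mul_assoc]
    gcongr; exact h z
  | mem f hf =>
    induction hg using Submodule.span_induction with
    | zero => exact ⟨0, fun z => by simp [show tf f (0 : B →ₗ[ℂ] ℂ) = 0 by ext; simp]⟩
    | add f f' _ _ h h' =>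
      obtain ⟨C, h⟩ := h
      obtain ⟨C', h'⟩ := h'
      refine ⟨C + C', fun z => ?_⟩
      rw [tf_add_right, LinearMap.add_apply, add_mul]
      exact (norm_add_le _ _).trans (add_le_add (h z) (h' z))
    | smul c f _ h =>
      obtain ⟨C, h⟩ := h
      refine ⟨‖c‖ * C, fun z => ?_⟩
      rw [tf_smul_right, LinearMap.smul_apply, norm_smul, mul_assoc]
      gcongr; exact h z
    | mem g hg => exact ⟨1, fun z => by simpa using takesaki d hf hg z⟩

/-- bounded on `T` -/
def TBdd (d : TensorData A B T) (φ : A ⊗[ℂ] B →ₗ[ℂ] ℂ) : Prop := ∃ C, ∀ z, ‖φ z‖ ≤ C * ‖TJ d z‖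

lemma TBdd.add {d : TensorData A B T} {φ ψ : A ⊗[ℂ] B →ₗ[ℂ] ℂ} (h : TBdd d φ) (h' : TBdd d ψ) :
    TBdd d (φ + ψ) := by
  obtain ⟨C, h⟩ := h
  obtain ⟨C', h'⟩ := h'
  refine ⟨C + C', fun z => ?_⟩
  rw [LinearMap.add_apply, add_mul]
  exact (norm_add_le _ _).trans (add_le_add (h z) (h' z))

lemma TBdd.sum {d : TensorData A B T} {ι : Type*} (s : Finset ι) (φ : ι → A ⊗[ℂ] B →ₗ[ℂ] ℂ)
    (h : ∀ i ∈ s, TBdd d (φ i)) : TBdd d (∑ i ∈ s, φ i) := by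
  classical
  induction s using Finset.induction_on with
  | empty => exact ⟨0, fun z => by simp⟩
  | insert i s hi ih =>
    rw [Finset.sum_insert hi]
    exact (h i (by simp)).add (ih fun j hj => h j (by simp [hj]))

lemma TBdd.ext {d : TensorData A B T} {φ : A ⊗[ℂ] B →ₗ[ℂ] ℂ} (h : TBdd d φ) :
    ∃ Φ : T →L[ℂ] ℂ, ∀ z, Φ (TJ d z) = φ z :=
  ⟨φ.extendOfNorm (TJ d), fun z => LinearMap.extendOfNorm_eq (TJ_dense d) h z⟩

lemma isPos_of_dense (d : TensorData A B T) (Φ : T →L[ℂ] ℂ)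
    (h : ∀ z, 0 ≤ Φ (TJ d (star z * z))) : IsPos (Φ : T →ₗ[ℂ] ℂ) := by
  intro t
  refine (TJ_dense d).induction_on (p := fun t => 0 ≤ Φ (star t * t)) t
    (isClosed_le (by fun_prop) (by fun_prop)) fun z => ?_
  have := h z
  rwa [TJ_mul, TJ_star] at this

lemma norm_of_approx (d : TensorData A B T) (Φ : T →L[ℂ] ℂ) (hΦ : IsPos (Φ : T →ₗ[ℂ] ℂ)) (M : ℝ)
    (hM : ∀ a b, ‖a‖ ≤ 1 → ‖b‖ ≤ 1 → (Φ (d.tmul (star a * a) (star b * b))).re ≤ M) : ‖Φ‖ ≤ M := by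
  letI := CStarAlgebra.spectralOrder A
  haveI := CStarAlgebra.spectralOrderedRing A
  letI := CStarAlgebra.spectralOrder B
  haveI := CStarAlgebra.spectralOrderedRing B
  have hM0 : 0 ≤ M := by
    have := hM 0 0 (by simp) (by simp)
    rw [← TJ_tmul] at this; simpa using this
  have key : ∀ t, ‖Φ t‖ ^ 2 ≤ M * (‖Φ‖ * ‖t‖ ^ 2) := by
    intro t
    refine (TJ_dense d).induction_on (p := fun t => ‖Φ t‖ ^ 2 ≤ M * (‖Φ‖ * ‖t‖ ^ 2)) t
      (isClosed_le (by fun_prop) (by fun_prop)) fun z => ?_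
    have hA := CStarAlgebra.increasingApproximateUnit (A := A)
    have hB := CStarAlgebra.increasingApproximateUnit (A := B)
    haveI := hA.neBot
    haveI := hB.neBot
    obtain ⟨l, hl⟩ : ∃ l : Filter (A × B), l = CStarAlgebra.approximateUnit A ×ˢ CStarAlgebra.approximateUnit B := ⟨_, rfl⟩
    haveI : l.NeBot := hl ▸ inferInstance
    have hcont : ∀ (a : A) (b : B), Tendsto (fun p : A × B => d.tmul (p.1 * a) (p.2 * b)) l (𝓝 (d.tmul a b)) := by
      intro a b
      have hc : Continuous (fun p : A × B => d.tmul p.1 p.2) := by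
        let L : A →L[ℂ] B →L[ℂ] T := LinearMap.mkContinuous₂
          (LinearMap.mk₂ ℂ d.tmul d.add_left d.smul_left d.add_right d.smul_right) 1
          (fun a b => by simp [d.norm_tmul])
        have : (fun p : A × B => d.tmul p.1 p.2) = fun p => L p.1 p.2 := by
          ext p; simp [L]
        rw [this]; fun_prop
      refine Tendsto.comp (f := fun p : A × B => (p.1 * a, p.2 * b)) (hc.tendsto (a, b)) ?_
      rw [hl, nhds_prod_eq]
      exact ((hA.tendsto_mul_right a).comp tendsto_fst).prodMk ((hB.tendsto_mul_right b).comp tendsto_snd)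
    have htend : Tendsto (fun p : A × B => d.tmul p.1 p.2 * TJ d z) l (𝓝 (TJ d z)) := by
      induction z with
      | zero => simp
      | add x y hx hy => simp only [map_add, mul_add]; exact hx.add hy
      | tmul a b => simpa [d.mul_tmul] using hcont a b
    have h2 : Tendsto (fun p : A × B => ‖Φ (d.tmul p.1 p.2 * TJ d z)‖ ^ 2) l (𝓝 (‖Φ (TJ d z)‖ ^ 2)) :=
      ((continuous_norm.comp Φ.continuous).tendsto _ |>.comp htend).pow 2
    refine le_of_tendsto h2 ?_
    have ev : ∀ᶠ p : A × B in l, (IsSelfAdjoint p.1 ∧ ‖p.1‖ ≤ 1) ∧ (IsSelfAdjoint p.2 ∧ ‖p.2‖ ≤ 1) := by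
      rw [hl]
      exact (hA.eventually_isSelfAdjoint.and hA.eventually_norm).prod_mk (hB.eventually_isSelfAdjoint.and hB.eventually_norm)
    filter_upwards [ev] with p hp
    obtain ⟨⟨p1, p2⟩, p3, p4⟩ := hp
    have hs : star (d.tmul p.1 p.2) = d.tmul p.1 p.2 := by rw [d.star_tmul, p1.star_eq, p3.star_eq]
    have h3 := hΦ.cs (d.tmul p.1 p.2) (TJ d z)
    rw [hs] at h3
    have h4 := hM p.1 p.2 p2 p4
    rw [p1.star_eq, p3.star_eq] at h4
    rw [d.mul_tmul] at h3
    have h5 : (Φ (star (TJ d z) * TJ d z)).re ≤ ‖Φ‖ * ‖TJ d z‖ ^ 2 := by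
      refine (Complex.re_le_norm _).trans ((Φ.le_opNorm _).trans ?_)
      rw [CStarRing.norm_star_mul_self, sq]
    have h6 : 0 ≤ (Φ (star (TJ d z) * TJ d z)).re := (Complex.le_def.1 (hΦ (TJ d z))).1
    refine h3.trans ?_
    exact mul_le_mul h4 h5 h6 hM0
  have h7 : ‖Φ‖ ≤ Real.sqrt (M * ‖Φ‖) := by
    refine Φ.opNorm_le_bound (Real.sqrt_nonneg _) fun t => ?_
    refine abs_le_of_sq_le_sq' ?_ (by positivity) |>.2
    rw [mul_pow, Real.sq_sqrt (by positivity)]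
    calc _ ≤ _ := key t
      _ = _ := by ring
  have h8 : ‖Φ‖ ^ 2 ≤ M * ‖Φ‖ := by
    have := pow_le_pow_left₀ (norm_nonneg _) h7 2
    rwa [Real.sq_sqrt (by positivity)] at this
  by_contra hcon
  push Not at hcon
  nlinarith [norm_nonneg Φ]
end tens
end FM

namespace FM
set_option linter.all false
set_option linter.style.haveILetI false
set_option linter.unnecessarySimpa false
open scoped ComplexOrder InnerProductSpace ComplexStarModule
open scoped TensorProduct Topology
open Filter

section vf
variable {A : Type} [NonUnitalCStarAlgebra A]
variable {H : Type} [NormedAddCommGroup H] [InnerProductSpace ℂ H] [CompleteSpace H]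

/-- vector functionals -/
def vf (π : A →⋆ₙₐ[ℂ] (H →L[ℂ] H)) (ξ η : H) : A →ₗ[ℂ] ℂ where
  toFun a := ⟪ξ, π a η⟫_ℂ
  map_add' := by intros; simp [inner_add_right]
  map_smul' := by intros; simp [inner_smul_right]

@[simp] lemma vf_apply (π : A →⋆ₙₐ[ℂ] (H →L[ℂ] H)) (ξ η : H) (a : A) : vf π ξ η a = ⟪ξ, π a η⟫_ℂ := rfl

lemma inner_pi_star_mul (π : A →⋆ₙₐ[ℂ] (H →L[ℂ] H)) (ξ η : H) (a b : A) :
    ⟪ξ, π (star a * b) η⟫_ℂ = ⟪π a ξ, π b η⟫_ℂ := by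
  rw [map_mul, map_star, ContinuousLinearMap.mul_apply, ContinuousLinearMap.star_eq_adjoint, ContinuousLinearMap.adjoint_inner_right]

lemma vf_pos (π : A →⋆ₙₐ[ℂ] (H →L[ℂ] H)) (ξ : H) : IsPos (vf π ξ ξ) := by
  intro a
  rw [vf_apply, inner_pi_star_mul, inner_self_eq_norm_sq_to_K]
  rw [← RCLike.ofReal_pow]
  exact Complex.zero_le_real.2 (sq_nonneg _)

lemma vf_polar (π : A →⋆ₙₐ[ℂ] (H →L[ℂ] H)) (ξ η : H) :
    vf π ξ η = (1/4 : ℂ) • (vf π (ξ + η) (ξ + η) - vf π (ξ - η) (ξ - η)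
      - Complex.I • vf π (ξ + Complex.I • η) (ξ + Complex.I • η)
      + Complex.I • vf π (ξ - Complex.I • η) (ξ - Complex.I • η)) := by
  ext a
  simp only [LinearMap.smul_apply, LinearMap.add_apply, LinearMap.sub_apply, vf_apply, map_add, map_sub, map_smul,
    inner_add_left, inner_add_right, inner_sub_left, inner_sub_right, inner_smul_left, inner_smul_right, Complex.conj_I, smul_eq_mul]
  ring_nf
  simp only [Complex.I_sq, show Complex.I ^ 3 = - Complex.I from Complex.I_pow_three]
  ring

lemma vf_mem_SQ (π : A →⋆ₙₐ[ℂ] (H →L[ℂ] H)) (ξ η : H) : vf π ξ η ∈ SQ A := by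
  rw [vf_polar]
  have h := fun x => (vf_pos π x).mem_SQ
  exact Submodule.smul_mem _ _ (Submodule.add_mem _ (Submodule.sub_mem _ (Submodule.sub_mem _ (h _) (h _))
    (Submodule.smul_mem _ _ (h _))) (Submodule.smul_mem _ _ (h _)))
end vf

section rho
variable {A B T : Type} [NonUnitalCStarAlgebra A] [NonUnitalCStarAlgebra B] [NonUnitalCStarAlgebra T]
variable {H K : Type} [NormedAddCommGroup H] [InnerProductSpace ℂ H] [CompleteSpace H]
 [NormedAddCommGroup K] [InnerProductSpace ℂ K] [CompleteSpace K]

/-- Hilbert tensor product -/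
def HT (H K : Type) [NormedAddCommGroup H] [InnerProductSpace ℂ H] 
   [NormedAddCommGroup K] [InnerProductSpace ℂ K] : Type := UniformSpace.Completion (H ⊗[ℂ] K)

instance instHT1 (H K : Type) [NormedAddCommGroup H] [InnerProductSpace ℂ H] 
   [NormedAddCommGroup K] [InnerProductSpace ℂ K] : NormedAddCommGroup (HT H K) :=
  inferInstanceAs (NormedAddCommGroup (UniformSpace.Completion (H ⊗[ℂ] K)))
instance instHT2 (H K : Type) [NormedAddCommGroup H] [InnerProductSpace ℂ H] 
   [NormedAddCommGroup K] [InnerProductSpace ℂ K] : InnerProductSpace ℂ (HT H K) :=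
  inferInstanceAs (InnerProductSpace ℂ (UniformSpace.Completion (H ⊗[ℂ] K)))
instance instHT3 (H K : Type) [NormedAddCommGroup H] [InnerProductSpace ℂ H] 
   [NormedAddCommGroup K] [InnerProductSpace ℂ K] : CompleteSpace (HT H K) :=
  inferInstanceAs (CompleteSpace (UniformSpace.Completion (H ⊗[ℂ] K)))

/-- inclusion of the algebraic tensor product -/
def hti (H K : Type) [NormedAddCommGroup H] [InnerProductSpace ℂ H] 
   [NormedAddCommGroup K] [InnerProductSpace ℂ K] : H ⊗[ℂ] K →ₗᵢ[ℂ] HT H K :=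
  (UniformSpace.Completion.toComplₗᵢ : H ⊗[ℂ] K →ₗᵢ[ℂ] UniformSpace.Completion (H ⊗[ℂ] K))

lemma hti_dense : DenseRange (hti H K) :=
  UniformSpace.Completion.denseRange_coe (α := H ⊗[ℂ] K)

/-- tensor product of operators -/
def RT (s : H →L[ℂ] H) (r : K →L[ℂ] K) : HT H K →L[ℂ] HT H K :=
  ((hti H K).toLinearMap ∘ₗ (TensorProduct.mapL s r).toLinearMap).extendOfNorm (hti H K).toLinearMap

@[simp] lemma RT_coe (s : H →L[ℂ] H) (r : K →L[ℂ] K) (x : H ⊗[ℂ] K) :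
    RT s r (hti H K x) = hti H K (TensorProduct.mapL s r x : H ⊗[ℂ] K) :=
  LinearMap.extendOfNorm_eq (e := (hti H K).toLinearMap) hti_dense ⟨‖TensorProduct.mapL s r‖, fun x => by
    rw [LinearMap.comp_apply, LinearIsometry.coe_toLinearMap, LinearIsometry.norm_map, LinearIsometry.norm_map]
    exact ContinuousLinearMap.le_opNorm _ _⟩ x

lemma RT_tmul (s : H →L[ℂ] H) (r : K →L[ℂ] K) (x : H) (y : K) :
    RT s r (hti H K (x ⊗ₜ[ℂ] y)) = hti H K (s x ⊗ₜ[ℂ] r y) := by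
  rw [RT_coe, TensorProduct.mapL_tmul]

lemma HT_ext {f g : HT H K →L[ℂ] HT H K} (h : ∀ x : H ⊗[ℂ] K, f (hti H K x) = g (hti H K x)) : f = g := by
  ext x
  exact hti_dense.induction_on (p := fun x => f x = g x) x (isClosed_eq f.continuous g.continuous) h

lemma HT_ext_tmul {f g : HT H K →L[ℂ] HT H K}
    (h : ∀ (x : H) (y : K), f (hti H K (x ⊗ₜ[ℂ] y)) = g (hti H K (x ⊗ₜ[ℂ] y))) : f = g := by
  refine HT_ext fun x => ?_
  induction x with
  | zero => simp
  | add x y hx hy => rw [map_add, map_add, map_add, hx, hy]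
  | tmul x y => exact h x y

lemma RT_mul (s s' : H →L[ℂ] H) (r r' : K →L[ℂ] K) : RT s r * RT s' r' = RT (s * s') (r * r') := by
  refine HT_ext_tmul fun x y => ?_
  rw [ContinuousLinearMap.mul_apply]
  simp only [RT_tmul, ContinuousLinearMap.mul_apply]

lemma RT_star (s : H →L[ℂ] H) (r : K →L[ℂ] K) : star (RT s r) = RT (star s) (star r) := by
  rw [ContinuousLinearMap.star_eq_adjoint]
  symm
  rw [ContinuousLinearMap.eq_adjoint_iff]
  intro x y
  refine hti_dense.induction_on x (isClosed_eq (by fun_prop) (by fun_prop)) fun x => ?_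
  refine hti_dense.induction_on y (isClosed_eq (by fun_prop) (by fun_prop)) fun y => ?_
  · simp only [RT_coe, LinearIsometry.inner_map_map]
    induction x with
    | zero => simp
    | add x y hx hy => simp only [map_add, inner_add_left, hx, hy]
    | tmul x x' =>
      induction y with
      | zero => simp
      | add x y hx hy => simp only [map_add, inner_add_right, hx, hy]
      | tmul y y' =>
        simp only [TensorProduct.mapL_tmul, TensorProduct.inner_tmul, ContinuousLinearMap.star_eq_adjoint,
          ContinuousLinearMap.adjoint_inner_left]

lemma RT_norm_le (s : H →L[ℂ] H) (r : K →L[ℂ] K) : ‖RT s r‖ ≤ ‖s‖ * ‖r‖ := by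
  refine ContinuousLinearMap.opNorm_le_bound _ (by positivity) fun x => ?_
  refine hti_dense.induction_on x (isClosed_le (by fun_prop) (by fun_prop)) fun x => ?_
  · skip
    rw [RT_coe, LinearIsometry.norm_map, LinearIsometry.norm_map]
    exact (ContinuousLinearMap.le_opNorm _ _).trans (mul_le_mul_of_nonneg_right (TensorProduct.norm_mapL_le _ _) (norm_nonneg _))

lemma RT_norm (s : H →L[ℂ] H) (r : K →L[ℂ] K) : ‖RT s r‖ = ‖s‖ * ‖r‖ := by
  refine le_antisymm (RT_norm_le s r) ?_
  have key : ∀ (x : H) (y : K), ‖s x‖ * ‖r y‖ ≤ ‖RT s r‖ * ‖x‖ * ‖y‖ := by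
    intro x y
    have := (RT s r).le_opNorm (hti H K (x ⊗ₜ[ℂ] y))
    rw [RT_tmul, LinearIsometry.norm_map, LinearIsometry.norm_map, TensorProduct.norm_tmul,
      TensorProduct.norm_tmul] at this
    linarith
  have key2 : ∀ x : H, ‖s x‖ * ‖r‖ ≤ ‖RT s r‖ * ‖x‖ := by
    intro x
    have : ‖(‖s x‖ : ℂ) • r‖ ≤ ‖RT s r‖ * ‖x‖ := by
      refine ContinuousLinearMap.opNorm_le_bound _ (by positivity) fun y => ?_
      have := key x y
      simpa [norm_smul] using this
    simpa [norm_smul] using this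
  have : ‖(‖r‖ : ℂ) • s‖ ≤ ‖RT s r‖ := by
      refine ContinuousLinearMap.opNorm_le_bound _ (by positivity) fun y => ?_
      have := key2 y
      rw [mul_comm] at this
      simpa [norm_smul] using this
  simpa [norm_smul, mul_comm] using this

/-- spatial representation -/
def rho (π : A →⋆ₙₐ[ℂ] (H →L[ℂ] H)) (σ : B →⋆ₙₐ[ℂ] (K →L[ℂ] K)) : A ⊗[ℂ] B →ₗ[ℂ] (HT H K →L[ℂ] HT H K) :=
  TensorProduct.lift (LinearMap.mk₂ ℂ (fun a b => RT (π a) (σ b))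
   (by intros; refine HT_ext_tmul fun x y => ?_; rw [ContinuousLinearMap.add_apply]; simp only [RT_tmul, map_add, ContinuousLinearMap.add_apply, TensorProduct.add_tmul, map_add])
   (by intros; refine HT_ext_tmul fun x y => ?_; rw [ContinuousLinearMap.smul_apply]; simp only [RT_tmul, map_smul, ContinuousLinearMap.smul_apply, ← TensorProduct.smul_tmul', map_smul])
   (by intros; refine HT_ext_tmul fun x y => ?_; rw [ContinuousLinearMap.add_apply]; simp only [RT_tmul, map_add, ContinuousLinearMap.add_apply, TensorProduct.tmul_add, map_add])
   (by intros; refine HT_ext_tmul fun x y => ?_; rw [ContinuousLinearMap.smul_apply]; simp only [RT_tmul, map_smul, ContinuousLinearMap.smul_apply, TensorProduct.tmul_smul, map_smul]))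

@[simp] lemma rho_tmul (π : A →⋆ₙₐ[ℂ] (H →L[ℂ] H)) (σ : B →⋆ₙₐ[ℂ] (K →L[ℂ] K)) (a : A) (b : B) :
    rho π σ (a ⊗ₜ b) = RT (π a) (σ b) := by simp [rho]

lemma rho_mul (π : A →⋆ₙₐ[ℂ] (H →L[ℂ] H)) (σ : B →⋆ₙₐ[ℂ] (K →L[ℂ] K)) (x y : A ⊗[ℂ] B) :
    rho π σ (x * y) = rho π σ x * rho π σ y := by
  induction x with
  | zero => simp
  | add x x' h h' => rw [add_mul, map_add, h, h', map_add, add_mul]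
  | tmul a b =>
    induction y with
    | zero => simp
    | add x x' h h' => rw [mul_add, map_add, h, h', map_add, mul_add]
    | tmul a' b' => simp [RT_mul]

lemma rho_star (π : A →⋆ₙₐ[ℂ] (H →L[ℂ] H)) (σ : B →⋆ₙₐ[ℂ] (K →L[ℂ] K)) (x : A ⊗[ℂ] B) :
    rho π σ (star x) = star (rho π σ x) := by
  induction x with
  | zero => rw [star_zero, map_zero]; exact (star_zero _).symm
  | add x x' h h' => rw [star_add, map_add, map_add, h, h']; exact (star_add _ _).symm
  | tmul a b => simp [RT_star, map_star]

/-- vector functional on the tensor product -/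
def vft (π : A →⋆ₙₐ[ℂ] (H →L[ℂ] H)) (σ : B →⋆ₙₐ[ℂ] (K →L[ℂ] K)) (x : HT H K) : A ⊗[ℂ] B →ₗ[ℂ] ℂ where
  toFun z := ⟪x, rho π σ z x⟫_ℂ
  map_add' := by intros; simp [inner_add_right]
  map_smul' := by intros; simp [inner_smul_right]

lemma vft_star_mul (π : A →⋆ₙₐ[ℂ] (H →L[ℂ] H)) (σ : B →⋆ₙₐ[ℂ] (K →L[ℂ] K)) (x : HT H K) (z : A ⊗[ℂ] B) :
    vft π σ x (star z * z) = ((‖rho π σ z x‖ ^ 2 : ℝ) : ℂ) := by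
  change ⟪x, rho π σ (star z * z) x⟫_ℂ = _
  rw [rho_mul, rho_star, ContinuousLinearMap.mul_apply, ContinuousLinearMap.star_eq_adjoint, ContinuousLinearMap.adjoint_inner_right,
    inner_self_eq_norm_sq_to_K]
  push_cast; rfl

lemma vft_sum (π : A →⋆ₙₐ[ℂ] (H →L[ℂ] H)) (σ : B →⋆ₙₐ[ℂ] (K →L[ℂ] K)) (s : Finset (H × K)) :
    vft π σ (hti H K (∑ p ∈ s, p.1 ⊗ₜ[ℂ] p.2))
      = ∑ p ∈ s, ∑ q ∈ s, tf (vf π p.1 q.1) (vf σ p.2 q.2) := by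
  ext a b
  simp only [TensorProduct.AlgebraTensorModule.curry_apply, LinearMap.restrictScalars_self, TensorProduct.curry_apply,
    LinearMap.sum_apply, tf_tmul, vf_apply]
  change ⟪_, rho π σ (a ⊗ₜ b) _⟫_ℂ = _
  rw [rho_tmul, RT_coe, LinearIsometry.inner_map_map]
  simp only [map_sum, sum_inner, inner_sum, TensorProduct.mapL_tmul, TensorProduct.inner_tmul]
  exact Finset.sum_comm

lemma vft_TBdd (d : TensorData A B T) (π : A →⋆ₙₐ[ℂ] (H →L[ℂ] H)) (σ : B →⋆ₙₐ[ℂ] (K →L[ℂ] K)) (x : H ⊗[ℂ] K) :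
    TBdd d (vft π σ (hti H K x)) := by
  obtain ⟨s, rfl⟩ := TensorProduct.exists_finset x
  rw [vft_sum]
  exact TBdd.sum _ _ fun p _ => TBdd.sum _ _ fun q _ => tf_bounded d (vf_mem_SQ _ _ _) (vf_mem_SQ _ _ _)

theorem rho_le (d : TensorData A B T) (π : A →⋆ₙₐ[ℂ] (H →L[ℂ] H)) (σ : B →⋆ₙₐ[ℂ] (K →L[ℂ] K)) (z : A ⊗[ℂ] B) :
    ‖rho π σ z‖ ≤ ‖TJ d z‖ := by
  refine ContinuousLinearMap.opNorm_le_bound _ (by positivity) fun x => ?_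
  refine hti_dense.induction_on x (isClosed_le (by fun_prop) (by fun_prop)) fun x => ?_
  · skip
    obtain ⟨Φ, hΦ⟩ := (vft_TBdd d π σ x).ext
    have hpos : IsPos (Φ : T →ₗ[ℂ] ℂ) := by
      refine isPos_of_dense d Φ fun z => ?_
      rw [hΦ, vft_star_mul]
      exact_mod_cast sq_nonneg (‖rho π σ z (hti H K x)‖ : ℝ)
    have hn : ‖Φ‖ ≤ ‖hti H K x‖ ^ 2 := by
      refine norm_of_approx d Φ hpos _ fun a b ha hb => ?_
      have h1 : d.tmul (star a * a) (star b * b) = TJ d (star (a ⊗ₜ b) * (a ⊗ₜ b)) := by simp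
      rw [h1, hΦ, vft_star_mul, Complex.ofReal_re, rho_tmul]
      have h2 : ‖RT (π a) (σ b)‖ ≤ 1 := by
        refine (RT_norm_le _ _).trans ?_
        have := (nush_norm_le π a).trans ha
        have := (nush_norm_le σ b).trans hb
        exact mul_le_one₀ ‹_› (norm_nonneg _) ‹_›
      have h3 := (RT (π a) (σ b)).le_opNorm (hti H K x)
      gcongr
      exact h3.trans (mul_le_of_le_one_left (norm_nonneg _) h2)
    have h4 := hΦ (star z * z)
    rw [vft_star_mul, TJ_mul, TJ_star] at h4
    have h5 : ‖rho π σ z (hti H K x)‖ ^ 2 ≤ ‖hti H K x‖ ^ 2 * ‖TJ d z‖ ^ 2 := by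
      have h6 := Φ.le_opNorm (star (TJ d z) * TJ d z)
      rw [h4, CStarRing.norm_star_mul_self, Complex.norm_real, Real.norm_of_nonneg (sq_nonneg _)] at h6
      refine h6.trans ?_
      rw [sq ‖TJ d z‖]; gcongr
    refine abs_le_of_sq_le_sq' ?_ (by positivity) |>.2
    rw [mul_pow]; linarith
end rho

section hom
variable {A B T E : Type} [NonUnitalCStarAlgebra A] [NonUnitalCStarAlgebra B] [NonUnitalCStarAlgebra T] [NonUnitalCStarAlgebra E]

lemma hom_ext (d : TensorData A B T) (σ : A ⊗[ℂ] B →ₗ[ℂ] E) (hm : ∀ x y, σ (x * y) = σ x * σ y)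
    (hs : ∀ x, σ (star x) = star (σ x)) (hn : ∀ z, ‖σ z‖ ≤ ‖TJ d z‖) :
    ∃ h : T →⋆ₙₐ[ℂ] E, ∀ z, h (TJ d z) = σ z := by
  let f : T →L[ℂ] E := σ.extendOfNorm (TJ d)
  have hf : ∀ z, f (TJ d z) = σ z := fun z =>
    LinearMap.extendOfNorm_eq (TJ_dense d) ⟨1, fun z => by simpa using hn z⟩ z
  refine ⟨{ toFun := f, map_smul' := fun c x => by simp, map_zero' := by simp, map_add' := by simp, map_mul' := ?_, map_star' := ?_ }, hf⟩
  · intro x y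
    refine (TJ_dense d).induction_on (p := fun x => f (x * y) = f x * f y) x
      (isClosed_eq (by fun_prop) (by fun_prop)) fun x => ?_
    refine (TJ_dense d).induction_on (p := fun y => f (TJ d x * y) = f (TJ d x) * f y) y
      (isClosed_eq (by fun_prop) (by fun_prop)) fun y => ?_
    rw [← TJ_mul, hf, hf, hf, hm]
  · intro x
    refine (TJ_dense d).induction_on (p := fun x => f (star x) = star (f x)) x
      (isClosed_eq (by fun_prop) (by fun_prop)) fun x => ?_
    rw [← TJ_star, hf, hf, hs]
end hom
end FM

namespace FM
set_option linter.all false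
set_option linter.style.haveILetI false
set_option linter.unnecessarySimpa false
open scoped ComplexOrder InnerProductSpace ComplexStarModule
open scoped TensorProduct Topology
open Filter

section tm
variable {A B T : Type} [NonUnitalCStarAlgebra A] [NonUnitalCStarAlgebra B] [NonUnitalCStarAlgebra T]
variable {H K : Type} [NormedAddCommGroup H] [InnerProductSpace ℂ H] [CompleteSpace H]
 [NormedAddCommGroup K] [InnerProductSpace ℂ K] [CompleteSpace K]

/-- `rho` as a hom -/
def rhoH (π : A →⋆ₙₐ[ℂ] (H →L[ℂ] H)) (σ : B →⋆ₙₐ[ℂ] (K →L[ℂ] K)) : A ⊗[ℂ] B →⋆ₙₐ[ℂ] (HT H K →L[ℂ] HT H K) where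
  toFun := rho π σ
  map_smul' := by simp
  map_zero' := by simp
  map_add' := by simp
  map_mul' := rho_mul π σ
  map_star' := rho_star π σ

theorem exists_min (π : A →⋆ₙₐ[ℂ] (H →L[ℂ] H)) (σ : B →⋆ₙₐ[ℂ] (K →L[ℂ] K)) (hπ : Injective π) (hσ : Injective σ) :
    ∃ (T : Type) (_ : NonUnitalCStarAlgebra T) (d : MinTensorData A B T),
      ∀ z, ‖TJ d.toTensorData z‖ = ‖rho π σ z‖ := by
  let S := (NonUnitalStarAlgHom.range (rhoH π σ)).topologicalClosure
  haveI : IsClosed (S : Set (HT H K →L[ℂ] HT H K)) := NonUnitalStarSubalgebra.isClosed_topologicalClosure _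
  have hmem : ∀ z, rho π σ z ∈ S := fun z =>
    NonUnitalStarSubalgebra.le_topologicalClosure _ ⟨z, rfl⟩
  let r : A ⊗[ℂ] B →ₗ[ℂ] S := LinearMap.codRestrict S.toNonUnitalSubalgebra.toSubmodule (rho π σ) hmem
  have hr : ∀ z, (r z : HT H K →L[ℂ] HT H K) = rho π σ z := fun z => rfl
  let d : TensorData A B S :=
    { tmul := fun a b => r (a ⊗ₜ b)
      add_left := fun a a' b => by rw [TensorProduct.add_tmul, map_add]
      add_right := fun a b b' => by rw [TensorProduct.tmul_add, map_add]
      smul_left := fun c a b => by rw [← TensorProduct.smul_tmul', map_smul]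
      smul_right := fun c a b => by rw [TensorProduct.tmul_smul, map_smul]
      mul_tmul := fun a a' b b' => by
        apply Subtype.ext
        rw [hr, ← Algebra.TensorProduct.tmul_mul_tmul, rho_mul]; rfl
      star_tmul := fun a b => by
        apply Subtype.ext
        rw [hr, ← TensorProduct.star_tmul, rho_star]; rfl
      norm_tmul := fun a b => by
        change ‖rho π σ (a ⊗ₜ b)‖ = _
        rw [rho_tmul, RT_norm, NonUnitalStarAlgHom.norm_map π hπ, NonUnitalStarAlgHom.norm_map σ hσ]
      dense := by
        rw [← Submodule.dense_iff_topologicalClosure_eq_top]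
        have h1 : DenseRange r := by
          intro x
          rw [closure_subtype]
          have h2 := x.2
          refine closure_mono ?_ h2
          rintro _ ⟨z, rfl⟩
          exact ⟨r z, ⟨z, rfl⟩, rfl⟩
        refine h1.mono ?_
        rintro _ ⟨z, rfl⟩
        induction z with
        | zero => simp
        | add x y hx hy => rw [map_add]; exact Submodule.add_mem _ hx hy
        | tmul a b => exact Submodule.subset_span ⟨(a, b), rfl⟩ }
  have hTJ : ∀ z, TJ d z = r z := by
    intro z
    induction z with
    | zero => simp
    | add x y hx hy => rw [map_add, map_add, hx, hy]
    | tmul a b => rw [TJ_tmul]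
  refine ⟨S, inferInstance, ⟨d, ?_⟩, fun z => by rw [hTJ]; rfl⟩
  intro T' _ d'
  obtain ⟨h, hh⟩ := hom_ext d' r
    (fun x y => by apply Subtype.ext; rw [hr, rho_mul]; rfl)
    (fun x => by apply Subtype.ext; rw [hr, rho_star]; rfl)
    (fun z => rho_le d' π σ z)
  refine ⟨h, fun a b => ?_⟩
  rw [← TJ_tmul, hh]

theorem min_norm (d : MinTensorData A B T) (π : A →⋆ₙₐ[ℂ] (H →L[ℂ] H)) (σ : B →⋆ₙₐ[ℂ] (K →L[ℂ] K)) (hπ : Injective π) (hσ : Injective σ)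
    (z : A ⊗[ℂ] B) : ‖TJ d.toTensorData z‖ = ‖rho π σ z‖ := by
  refine le_antisymm ?_ (rho_le _ _ _ _)
  obtain ⟨T', _, d', h'⟩ := exists_min π σ hπ hσ
  obtain ⟨θ, hθ⟩ := d.minimal T' d'.toTensorData
  have : ∀ z, θ (TJ d'.toTensorData z) = TJ d.toTensorData z := by
    intro z
    induction z with
    | zero => simp
    | add x y hx hy => rw [map_add, map_add, map_add, hx, hy]
    | tmul a b => rw [TJ_tmul, TJ_tmul, hθ]
  rw [← this, ← h']
  exact nush_norm_le θ _

theorem exists_spatial (d : MinTensorData A B T) (π : A →⋆ₙₐ[ℂ] (H →L[ℂ] H)) (σ : B →⋆ₙₐ[ℂ] (K →L[ℂ] K)) (hπ : Injective π) (hσ : Injective σ) :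
    ∃ j : T →⋆ₙₐ[ℂ] (HT H K →L[ℂ] HT H K), Injective j ∧ ∀ z, j (TJ d.toTensorData z) = rho π σ z := by
  obtain ⟨j, hj⟩ := hom_ext d.toTensorData (rho π σ) (rho_mul π σ) (rho_star π σ) (rho_le _ _ _)
  refine ⟨j, ?_, hj⟩
  have hn : ∀ t, ‖j t‖ = ‖t‖ := by
    intro t
    have hc := nush_cont j
    refine (TJ_dense d.toTensorData).induction_on (p := fun t => ‖j t‖ = ‖t‖) t (isClosed_eq (by fun_prop) (by fun_prop)) fun z => ?_
    rw [hj, min_norm d π σ hπ hσ]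
  exact (injective_iff_map_eq_zero j).2 fun t ht => by rw [← norm_eq_zero, ← hn, ht, norm_zero]

theorem exists_min' (A B : Type) [NonUnitalCStarAlgebra A] [NonUnitalCStarAlgebra B] :
    ∃ (T : Type) (_ : NonUnitalCStarAlgebra T), Nonempty (MinTensorData A B T) := by
  obtain ⟨H, _, _, _, π, hπ⟩ := exists_faithful_rep A
  obtain ⟨K, _, _, _, σ, hσ⟩ := exists_faithful_rep B
  obtain ⟨T, i, d, -⟩ := exists_min π σ hπ hσ
  exact ⟨T, i, ⟨d⟩⟩

theorem min_functor {C D T' : Type} [NonUnitalCStarAlgebra C] [NonUnitalCStarAlgebra D] [NonUnitalCStarAlgebra T']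
    (d' : TensorData C D T') (d : MinTensorData A B T) (α : C →⋆ₙₐ[ℂ] A) (β : D →⋆ₙₐ[ℂ] B) :
    ∃ h : T' →⋆ₙₐ[ℂ] T, ∀ x y, h (d'.tmul x y) = d.tmul (α x) (β y) := by
  obtain ⟨H, _, _, _, π, hπ⟩ := exists_faithful_rep A
  obtain ⟨K, _, _, _, σ, hσ⟩ := exists_faithful_rep B
  let m : C ⊗[ℂ] D →ₗ[ℂ] A ⊗[ℂ] B := TensorProduct.map (α : C →ₗ[ℂ] A) (β : D →ₗ[ℂ] B)
  have hm : ∀ x y, m (x ⊗ₜ y) = α x ⊗ₜ β y := fun x y => by simp [m]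
  have h1 : ∀ z, rho (π.comp α) (σ.comp β) z = rho π σ (m z) := by
    intro z
    induction z with
    | zero => simp
    | add x y hx hy => rw [map_add, map_add, map_add, hx, hy]
    | tmul a b => rw [hm, rho_tmul, rho_tmul]; rfl
  suffices hs : ∃ h : T' →⋆ₙₐ[ℂ] T, ∀ z, h (TJ d' z) = (TJ d.toTensorData ∘ₗ m) z by
    obtain ⟨h, hh⟩ := hs
    refine ⟨h, fun x y => ?_⟩
    rw [← TJ_tmul, hh, LinearMap.comp_apply, hm, TJ_tmul]
  apply hom_ext
  · intro x y
    rw [LinearMap.comp_apply, LinearMap.comp_apply, LinearMap.comp_apply, ← TJ_mul]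
    congr 1
    induction x with
    | zero => simp
    | add x x' h h' => rw [add_mul, map_add, h, h', map_add, add_mul]
    | tmul a b =>
      induction y with
      | zero => simp
      | add x x' h h' => rw [mul_add, map_add, h, h', map_add, mul_add]
      | tmul a' b' => simp [hm]
  · intro x
    rw [LinearMap.comp_apply, LinearMap.comp_apply, ← TJ_star]
    congr 1
    induction x with
    | zero => simp
    | add x x' h h' => rw [star_add, map_add, h, h', map_add, star_add]
    | tmul a b => simp [hm, map_star]
  · intro z
    rw [LinearMap.comp_apply, min_norm d π σ hπ hσ, ← h1]
    exact rho_le _ _ _ _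
end tm
end FM

namespace FM
set_option linter.all false
set_option linter.style.haveILetI false
set_option linter.unnecessarySimpa false
open scoped ComplexOrder InnerProductSpace ComplexStarModule
open scoped TensorProduct Topology
open Filter

section dens
variable {H K : Type} [NormedAddCommGroup H] [InnerProductSpace ℂ H] [CompleteSpace H]
 [NormedAddCommGroup K] [InnerProductSpace ℂ K] [CompleteSpace K] {ι : Type}

lemma hb_dense (e : HilbertBasis ι ℂ K) (P : HT H K → Prop) (hP : IsClosed {x | P x})
    (h : ∀ (S : Finset ι) (ξ : ι → H), P (hti H K (∑ i ∈ S, ξ i ⊗ₜ[ℂ] e i))) (x : HT H K) : P x := by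
  classical
  let L : (ι →₀ H) →ₗ[ℂ] HT H K := (hti H K).toLinearMap ∘ₗ
    Finsupp.lsum ℂ (fun i => (TensorProduct.mk ℂ H K).flip (e i))
  have hL : ∀ ξ, L ξ = hti H K (∑ i ∈ ξ.support, ξ i ⊗ₜ[ℂ] e i) := by
    intro ξ
    simp [L, Finsupp.sum]
  let V := (LinearMap.range L).topologicalClosure
  have hc : ∀ (x : H) , Continuous fun y : K => hti H K (x ⊗ₜ[ℂ] y) := fun x => by
    have := TensorProduct.continuous_tmul (𝕜 := ℂ) (E := H) (F := K)
    exact (hti H K).continuous.comp (this.comp (by fun_prop : Continuous fun y : K => (x, y)))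
  have h1 : ∀ (x : H) (y : K), hti H K (x ⊗ₜ[ℂ] y) ∈ V := by
    intro x y
    have hy : y ∈ closure ((Submodule.span ℂ (Set.range e) : Submodule ℂ K) : Set K) := by
      have := e.dense_span
      have h2 : y ∈ (Submodule.span ℂ (Set.range e)).topologicalClosure := by rw [this]; trivial
      exact h2
    refine map_mem_closure (f := fun y : K => hti H K (x ⊗ₜ[ℂ] y)) (hc x) hy ?_
    intro y hy
    change hti H K (x ⊗ₜ[ℂ] y) ∈ LinearMap.range L
    induction hy using Submodule.span_induction with
    | mem y hy =>
      obtain ⟨i, rfl⟩ := hy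
      refine ⟨Finsupp.single i x, ?_⟩
      simp [L]
    | zero => simp
    | add a b _ _ ha hb => rw [TensorProduct.tmul_add, map_add]; exact Submodule.add_mem _ ha hb
    | smul c a _ ha => rw [TensorProduct.tmul_smul, map_smul]; exact Submodule.smul_mem _ _ ha
  have h2 : ∀ z, hti H K z ∈ V := by
    intro z
    induction z with
    | zero => simp
    | add x y hx hy => rw [map_add]; exact Submodule.add_mem _ hx hy
    | tmul x y => exact h1 x y
  have h3 : ∀ x ∈ V, P x := by
    intro x hx
    refine closure_minimal ?_ hP hx
    rintro _ ⟨ξ, rfl⟩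
    change P _
    rw [hL]; exact h _ _
  exact hti_dense.induction_on x hP fun z => h3 _ (h2 z)

lemma hb_norm (e : HilbertBasis ι ℂ K) (S : Finset ι) (ξ : ι → H) :
    ‖hti H K (∑ i ∈ S, ξ i ⊗ₜ[ℂ] e i)‖ ^ 2 = ∑ i ∈ S, ‖ξ i‖ ^ 2 := by
  classical
  have h1 : ((‖hti H K (∑ i ∈ S, ξ i ⊗ₜ[ℂ] e i)‖ ^ 2 : ℝ) : ℂ) = ((∑ i ∈ S, ‖ξ i‖ ^ 2 : ℝ) : ℂ) := by
    have := inner_self_eq_norm_sq_to_K (𝕜 := ℂ) (hti H K (∑ i ∈ S, ξ i ⊗ₜ[ℂ] e i))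
    push_cast
    have h2 : ((‖hti H K (∑ i ∈ S, ξ i ⊗ₜ[ℂ] e i)‖ : ℂ) ^ 2) = _ := this.symm
    rw [h2, LinearIsometry.inner_map_map]
    simp only [sum_inner, inner_sum, TensorProduct.inner_tmul]
    have ho := orthonormal_iff_ite.1 e.orthonormal
    simp only [ho, mul_ite, mul_one, mul_zero]
    refine Finset.sum_congr rfl fun i hi => ?_
    rw [Finset.sum_ite_eq']
    simp only [hi, if_true]
    exact inner_self_eq_norm_sq_to_K _
  exact_mod_cast h1

lemma op_le (y : H →L[ℂ] H) (hy : IsSelfAdjoint y) (h : ∀ x, (⟪x, y x⟫_ℂ).re ≤ ‖x‖ ^ 2) :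
    ∀ t ∈ quasispectrum ℝ y, t ≤ 1 := by
  have h1 : y ≤ algebraMap ℝ (H →L[ℂ] H) 1 := by
    rw [map_one, ContinuousLinearMap.le_def, ContinuousLinearMap.isPositive_iff_complex]
    intro x
    have hs : IsSelfAdjoint (1 - y) := (IsSelfAdjoint.one _).sub hy
    have h2 : (⟪(1 - y) x, x⟫_ℂ).im = 0 := by
      have := (ContinuousLinearMap.isSelfAdjoint_iff_isSymmetric.1 hs)
      have h3 := this.conj_inner_sym x x
      exact Complex.conj_eq_iff_im.1 h3
    have h4 : (⟪y x, x⟫_ℂ).re = (⟪x, y x⟫_ℂ).re := by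
      rw [← inner_conj_symm, Complex.conj_re]
    have h5 := h x
    constructor
    · apply Complex.ext
      · simp
      · exact (Complex.ofReal_im _).trans h2.symm
    · simp only [ContinuousLinearMap.sub_apply, ContinuousLinearMap.one_apply, inner_sub_left, map_sub]
      have h6 : RCLike.re ⟪x, x⟫_ℂ = ‖x‖ ^ 2 := inner_self_eq_norm_sq x
      have h7 : RCLike.re ⟪y x, x⟫_ℂ = (⟪x, y x⟫_ℂ).re := h4
      rw [h6, h7]; linarith
  have h2 := (le_algebraMap_iff_spectrum_le (ha := hy)).1 h1
  intro t ht
  rw [quasispectrum_eq_spectrum_union_zero] at ht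
  rcases ht with ht | ht
  · exact h2 t ht
  · rw [Set.mem_singleton_iff.1 ht]; norm_num
end dens

section cut
variable {A B : Type} [NonUnitalCStarAlgebra A] [NonUnitalCStarAlgebra B]

/-- cutting function -/
def cutf (t : ℝ) : ℝ := max (t - 1) 0

lemma cutf_cont : Continuous cutf := by unfold cutf; fun_prop
lemma cutf_zero : cutf 0 = 0 := by simp [cutf]

lemma cut_le (Y : A) (hY : IsSelfAdjoint Y) (F : A →ₗ[ℂ] ℂ) (hF : QState F) : (F Y).re ≤ ‖cfcₙ cutf Y‖ + 1 := by
  have hc := cutf_cont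
  have h0 := cutf_zero
  have h1 : Y = cfcₙ cutf Y + cfcₙ (fun t => t - cutf t) Y := by
    conv_lhs => rw [← cfcₙ_id' ℝ Y]
    rw [← cfcₙ_add cutf (fun t => t - cutf t) Y hc.continuousOn h0 (by fun_prop) (by simp [h0])]
    congr 1; ext t; ring
  have h2 : ‖(cfcₙ (fun t => t - cutf t) Y)⁺‖ ≤ 1 := by
    rw [norm_posPart_le_iff _ (IsSelfAdjoint.cfcₙ) _ zero_le_one]
    intro t ht
    rw [cfcₙ_map_quasispectrum (fun t => t - cutf t) Y (by fun_prop) (by simp [h0])] at ht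
    obtain ⟨s, -, rfl⟩ := ht
    have : s - 1 ≤ cutf s := le_max_left _ _
    change s - cutf s ≤ 1
    linarith
  have h3 := hF.le_pp _ (IsSelfAdjoint.cfcₙ (f := fun t => t - cutf t) (a := Y))
  have h4 : (F (cfcₙ cutf Y)).re ≤ ‖cfcₙ cutf Y‖ := (Complex.re_le_norm _).trans (hF.le _)
  conv_lhs => rw [h1]
  rw [map_add, Complex.add_re]
  linarith

lemma map_cut (π : A →⋆ₙₐ[ℂ] B) (Y : A) (hY : IsSelfAdjoint Y) : π (cfcₙ cutf Y) = cfcₙ cutf (π Y) :=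
  NonUnitalStarAlgHom.map_cfcₙ π cutf Y cutf_cont.continuousOn cutf_zero (nush_cont π) hY (hY.map π)

lemma cut_eq_zero (Y : A) (hY : IsSelfAdjoint Y) (h : ∀ t ∈ quasispectrum ℝ Y, t ≤ 1) : cfcₙ cutf Y = 0 := by
  rw [← cfcₙ_const_zero ℝ Y]
  refine cfcₙ_congr fun t ht => ?_
  have := h t ht
  simp [cutf, this]

lemma sum_sq {M L : Type} [Fintype L] [NonUnitalCStarAlgebra M] (Z : L → M) :
    ∃ X : M, ∑ l, star (Z l) * Z l = star X * X := by
  letI := CStarAlgebra.spectralOrder M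
  haveI := CStarAlgebra.spectralOrderedRing M
  have h0 : 0 ≤ ∑ l, star (Z l) * Z l := Finset.sum_nonneg fun l _ => star_mul_self_nonneg _
  exact CStarAlgebra.nonneg_iff_eq_star_mul_self.1 h0

lemma sqrt_block {n L A : Type} [Fintype n] [Fintype L] [CStarAlgebra A] (r : L → n → A) :
    ∃ X : n → n → A, ∀ i k, ∑ l, star (r l i) * r l k = ∑ l, star (X l i) * X l k := by
  classical
  by_cases hn : Nonempty n
  swap
  · exact ⟨fun i k => 0, fun i => (hn ⟨i⟩).elim⟩
  letI := CStarAlgebra.spectralOrder A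
  haveI := CStarAlgebra.spectralOrderedRing A
  let i0 : n := Classical.arbitrary n
  let Z : L → CStarMatrix n n A := fun l => CStarMatrix.ofMatrix (Matrix.of fun i k => if i = i0 then r l k else 0)
  obtain ⟨X, hX⟩ := sum_sq Z
  refine ⟨fun i k => X i k, fun i k => ?_⟩
  have h1 := congrFun (congrFun hX i) k
  rw [CStarMatrix.mul_apply] at h1
  simp only [CStarMatrix.star_apply] at h1
  rw [← h1]
  have h2 : (∑ l, star (Z l) * Z l : CStarMatrix n n A) i k = ∑ l, (star (Z l) * Z l : CStarMatrix n n A) i k := by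
    exact Matrix.sum_apply i k Finset.univ (fun l => (star (Z l) * Z l : CStarMatrix n n A))
  rw [h2]
  refine Finset.sum_congr rfl fun l _ => ?_
  rw [CStarMatrix.mul_apply]
  simp only [CStarMatrix.star_apply, Z, CStarMatrix.ofMatrix_apply]
  rw [Finset.sum_eq_single i0]
  · simp
  · intro j _ hj; simp [hj]
  · simp

lemma norm_le_of_sum {n A : Type} [Fintype n] [NonUnitalCStarAlgebra A] (x : n → A) (l : n) :
    ‖x l‖ ^ 2 ≤ ‖∑ l, star (x l) * x l‖ := by
  letI := CStarAlgebra.spectralOrder A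
  haveI := CStarAlgebra.spectralOrderedRing A
  rw [sq, ← CStarRing.norm_star_mul_self]
  refine CStarAlgebra.norm_le_norm_of_nonneg_of_le (star_mul_self_nonneg _) ?_
  exact Finset.single_le_sum (f := fun l => star (x l) * x l) (fun i _ => star_mul_self_nonneg _) (Finset.mem_univ l)
end cut
end FM

namespace FM
set_option linter.all false
set_option linter.style.haveILetI false
set_option linter.unnecessarySimpa false
open scoped ComplexOrder InnerProductSpace ComplexStarModule
open scoped TensorProduct Topology
open Filter

section ultra
variable {Λ : Type} (l : Filter Λ) (A : Λ → Type) [∀ i, NonUnitalCStarAlgebra (A i)]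

/-- null sequences -/
def nullI : NonUnitalStarSubalgebra ℂ (lp A ⊤) where
  carrier := {x | Tendsto (fun i => ‖x i‖) l (𝓝 0)}
  zero_mem' := by
    simp only [Set.mem_setOf_eq, lp.coeFn_zero, Pi.zero_apply, norm_zero]
    exact tendsto_const_nhds
  add_mem' := by
    intro a b ha hb
    have := Tendsto.add ha hb
    rw [add_zero] at this
    exact squeeze_zero (fun i => norm_nonneg _) (fun i => norm_add_le (a i) (b i)) this
  mul_mem' := by
    intro a b ha hb
    have := Tendsto.const_mul ‖a‖ hb
    rw [mul_zero] at this
    refine squeeze_zero (fun i => norm_nonneg _) (fun i => ?_) this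
    rw [lp.infty_coeFn_mul]
    exact (norm_mul_le _ _).trans (mul_le_mul_of_nonneg_right (lp.norm_apply_le_norm (by simp) a i) (norm_nonneg _))
  smul_mem' := by
    intro c a ha
    have := Tendsto.const_mul ‖c‖ ha
    rw [mul_zero] at this
    refine squeeze_zero (fun i => norm_nonneg _) (fun i => ?_) this
    exact (norm_smul_le c (a i))
  star_mem' := by
    intro a ha
    refine ha.congr fun i => ?_
    rw [lp.star_apply, norm_star]

lemma nullI_closed : IsClosed (nullI l A : Set (lp A ⊤)) := by
  refine isClosed_of_closure_subset fun x hx => ?_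
  change Tendsto (fun i => ‖x i‖) l (𝓝 0)
  rw [Metric.tendsto_nhds]
  intro ε hε
  obtain ⟨y, hy, hxy⟩ := Metric.mem_closure_iff.1 hx (ε/2) (by positivity)
  have hy' : Tendsto (fun i => ‖y i‖) l (𝓝 0) := hy
  filter_upwards [(Metric.tendsto_nhds.1 hy') (ε/2) (by positivity)] with i hi
  rw [dist_zero_right, norm_norm] at *
  have h1 : ‖(x - y) i‖ ≤ ‖x - y‖ := lp.norm_apply_le_norm (by simp) (x - y) i
  have h2 : x i = (x - y) i + y i := by simp
  rw [h2]
  rw [dist_eq_norm] at hxy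
  linarith [norm_add_le ((x - y) i) (y i)]

lemma nullI_ideal : IsCIdeal (nullI l A).toNonUnitalSubalgebra.toSubmodule where
  closed := nullI_closed l A
  mul_left := by
    intro a b hb
    have := Tendsto.const_mul ‖a‖ (show Tendsto (fun i => ‖b i‖) l (𝓝 0) from hb)
    rw [mul_zero] at this
    refine squeeze_zero (fun i => norm_nonneg _) (fun i => ?_) this
    rw [lp.infty_coeFn_mul]
    exact (norm_mul_le _ _).trans (mul_le_mul_of_nonneg_right (lp.norm_apply_le_norm (by simp) a i) (norm_nonneg _))
  mul_right := by
    intro b a hb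
    have := Tendsto.const_mul ‖a‖ (show Tendsto (fun i => ‖b i‖) l (𝓝 0) from hb)
    rw [mul_zero] at this
    refine squeeze_zero (fun i => norm_nonneg _) (fun i => ?_) this
    rw [lp.infty_coeFn_mul, mul_comm]
    exact (norm_mul_le _ _).trans (mul_le_mul_of_nonneg_left (lp.norm_apply_le_norm (by simp) a i) (norm_nonneg _))
  star_mem := fun k hk => (nullI l A).star_mem' hk

def evC (i : Λ) : lp A ⊤ →⋆ₙₐ[ℂ] A i where
  toFun x := x i
  map_zero' := rfl
  map_add' x y := rfl
  map_smul' c x := rfl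
  map_mul' x y := by rw [lp.infty_coeFn_mul]; rfl
  map_star' x := lp.star_apply x i

@[simp] lemma evC_apply (i : Λ) (x : lp A ⊤) : evC A i x = x i := rfl
end ultra
end FM

namespace FM
set_option linter.all false
set_option linter.style.haveILetI false
set_option linter.unnecessarySimpa false
open scoped ComplexOrder InnerProductSpace ComplexStarModule
open scoped TensorProduct Topology
open Filter

section eu
variable {K : Type} [NormedAddCommGroup K] [InnerProductSpace ℂ K] [CompleteSpace K] {ι : Type}

lemma tmul_sum_sa {A B T J : Type} [Fintype J] [NonUnitalCStarAlgebra A] [NonUnitalCStarAlgebra B] [NonUnitalCStarAlgebra T]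
   (d : TensorData A B T) (a : J → A) (b : J → B) (ha : ∀ j, IsSelfAdjoint (a j)) (hb : ∀ j, IsSelfAdjoint (b j)) :
   IsSelfAdjoint (∑ j, d.tmul (a j) (b j)) := by
  rw [IsSelfAdjoint, star_sum]
  refine Finset.sum_congr rfl fun j _ => ?_
  rw [d.star_tmul, (ha j).star_eq, (hb j).star_eq]

lemma form_le {H A B J : Type} [NormedAddCommGroup H] [InnerProductSpace ℂ H] [CompleteSpace H] [Fintype J]
    [NonUnitalCStarAlgebra A] [NonUnitalCStarAlgebra B]
    (σ : B →⋆ₙₐ[ℂ] (K →L[ℂ] K)) (e : HilbertBasis ι ℂ K) [DecidableEq ι]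
    (π : A →⋆ₙₐ[ℂ] (H →L[ℂ] H)) (c : J → A) (b : J → B) (u : A) (hu : ‖u‖ ≤ 1)
    (hX : ∀ S : Finset ι, ∃ X : S → S → A, ∀ i k : S,
      π ((if i = k then u else 0) - ∑ j, ⟪e i, σ (b j) (e k)⟫_ℂ • c j - ∑ l, star (X l i) * X l k) = 0)
    (x : HT H K) : (⟪x, rho π σ (∑ j, c j ⊗ₜ b j) x⟫_ℂ).re ≤ ‖x‖ ^ 2 := by
  refine hb_dense e (fun x => (⟪x, rho π σ (∑ j, c j ⊗ₜ b j) x⟫_ℂ).re ≤ ‖x‖ ^ 2) (isClosed_le (by fun_prop) (by fun_prop)) (fun S ξ => ?_) x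
  rw [hb_norm]
  obtain ⟨X, hX⟩ := hX S
  have h1 : ∀ i k : S, ∑ j, ⟪e i, σ (b j) (e k)⟫_ℂ • π (c j) = (if i = k then π u else 0) - ∑ l, star (π (X l i)) * π (X l k) := by
    intro i k
    have := hX i k
    simp only [map_sub, map_sum, map_smul, map_mul, map_star, sub_eq_zero, sub_sub] at this
    rw [map_add, map_sum, map_sum] at this
    simp only [map_smul, map_mul, map_star] at this
    rw [eq_sub_iff_add_eq, ← this]
    split_ifs <;> simp
  have h2 : ⟪hti H K (∑ i ∈ S, ξ i ⊗ₜ[ℂ] e i), rho π σ (∑ j, c j ⊗ₜ b j) (hti H K (∑ i ∈ S, ξ i ⊗ₜ[ℂ] e i))⟫_ℂ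
     = ∑ i : S, ∑ k : S, ⟪ξ i, (∑ j, ⟪e i, σ (b j) (e k)⟫_ℂ • π (c j)) (ξ k)⟫_ℂ := by
    rw [← Finset.sum_coe_sort S]
    simp only [map_sum, rho_tmul, ContinuousLinearMap.sum_apply, RT_tmul, sum_inner, inner_sum, LinearIsometry.inner_map_map, TensorProduct.inner_tmul, 
      ContinuousLinearMap.smul_apply, inner_smul_right]
    refine (Finset.sum_congr rfl fun k _ => Finset.sum_comm).trans (Finset.sum_comm.trans ?_)
    refine Finset.sum_congr rfl fun i _ => ?_
    refine Finset.sum_congr rfl fun k _ => ?_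
    refine Finset.sum_congr rfl fun j _ => ?_
    ring
  rw [h2]
  simp only [h1, ContinuousLinearMap.sub_apply, inner_sub_right, Finset.sum_sub_distrib, Complex.sub_re]
  have h3 : (∑ i : S, ∑ k : S, ⟪ξ i, (if i = k then π u else 0 : H →L[ℂ] H) (ξ k)⟫_ℂ).re ≤ ∑ i ∈ S, ‖ξ i‖ ^ 2 := by
    have : ∀ i : S, ∑ k : S, ⟪ξ i, (if i = k then π u else 0 : H →L[ℂ] H) (ξ k)⟫_ℂ = ⟪ξ i, π u (ξ i)⟫_ℂ := by
      intro i
      rw [Finset.sum_eq_single i]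
      · simp
      · intro k _ hk; simp [hk.symm]
      · simp
    simp only [this, Complex.re_sum]
    rw [← Finset.sum_coe_sort S]
    refine Finset.sum_le_sum fun i _ => ?_
    have h5 : ‖π u‖ ≤ 1 := by
      exact (nush_norm_le π u).trans hu
    have h6 := norm_inner_le_norm (𝕜 := ℂ) (ξ i) (π u (ξ i))
    have h7 := (π u).le_opNorm (ξ i)
    have h8 := Complex.re_le_norm ⟪ξ i, π u (ξ i)⟫_ℂ
    nlinarith [norm_nonneg (ξ i), mul_le_mul_of_nonneg_right h5 (norm_nonneg (ξ i))]
  have h4 : 0 ≤ (∑ i : S, ∑ k : S, ⟪ξ i, (∑ l, star (π (X l i)) * π (X l k)) (ξ k)⟫_ℂ).re := by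
    have : ∑ i : S, ∑ k : S, ⟪ξ i, (∑ l, star (π (X l i)) * π (X l k)) (ξ k)⟫_ℂ
        = ∑ l, ⟪∑ i : S, π (X l i) (ξ i), ∑ k : S, π (X l k) (ξ k)⟫_ℂ := by
      simp only [ContinuousLinearMap.sum_apply, sum_inner, inner_sum, ContinuousLinearMap.mul_def, ContinuousLinearMap.comp_apply, ContinuousLinearMap.star_eq_adjoint, ContinuousLinearMap.adjoint_inner_right]
      refine (Finset.sum_congr rfl fun k _ => Finset.sum_comm).trans (Finset.sum_comm.trans ?_)
      refine Finset.sum_congr rfl fun i _ => Finset.sum_comm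
    rw [this, Complex.re_sum]
    exact Finset.sum_nonneg fun l _ => inner_self_nonneg (𝕜 := ℂ)
  linarith
end eu
end FM

namespace FM
set_option linter.all false
set_option linter.style.haveILetI false
set_option linter.unnecessarySimpa false
open scoped ComplexOrder InnerProductSpace ComplexStarModule
open scoped TensorProduct Topology
open Filter

section eu
variable {K : Type} [NormedAddCommGroup K] [InnerProductSpace ℂ K] [CompleteSpace K] {ι : Type}

theorem exact_ultra {B : Type} [NonUnitalCStarAlgebra B] (hB : IsExactCStar B)
    (σ : B →⋆ₙₐ[ℂ] (K →L[ℂ] K)) (hσ : Injective σ) (e : HilbertBasis ι ℂ K) [DecidableEq ι]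
    {Λ J : Type} [Fintype J] (l : Filter Λ) (A T : Λ → Type) [∀ i, NonUnitalCStarAlgebra (A i)] [∀ i, NonUnitalCStarAlgebra (T i)]
    (d : ∀ i, MinTensorData (A i) B (T i))
    (c : J → lp A ⊤) (hc : ∀ j, IsSelfAdjoint (c j)) (b : J → B) (hb : ∀ j, IsSelfAdjoint (b j))
    (u : lp A ⊤) (hu : ‖u‖ ≤ 1)
    (hX : ∀ S : Finset ι, ∃ X : S → S → lp A ⊤, ∀ i k : S,
      (if i = k then u else 0) - ∑ j, ⟪e i, σ (b j) (e k)⟫_ℂ • c j - ∑ l, star (X l i) * X l k ∈ nullI l A) :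
    Tendsto (fun i => ‖cfcₙ cutf (∑ j, (d i).tmul (c j i) (b j))‖) l (𝓝 0) := by
  haveI hIc : IsClosed (nullI l A : Set (lp A ⊤)) := nullI_closed l A
  obtain ⟨H, _, _, _, π, hπ⟩ := exists_rep _ (nullI_ideal l A)
  have hπ' : ∀ a, π a = 0 ↔ a ∈ nullI l A := hπ
  haveI hQc : IsClosed (NonUnitalStarAlgHom.range π : Set (H →L[ℂ] H)) := by
    rw [NonUnitalStarAlgHom.coe_range]; exact isClosed_range π
  let Q := NonUnitalStarAlgHom.range π
  let q : lp A ⊤ →⋆ₙₐ[ℂ] Q := NonUnitalStarAlgHom.rangeRestrict π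
  let s : Q →⋆ₙₐ[ℂ] (H →L[ℂ] H) := NonUnitalStarSubalgebraClass.subtype Q
  let i0 : nullI l A →⋆ₙₐ[ℂ] lp A ⊤ := NonUnitalStarSubalgebraClass.subtype (nullI l A)
  have hs : Injective s := Subtype.val_injective
  have hi0 : Injective i0 := Subtype.val_injective
  have hsq : ∀ a, s (q a) = π a := fun a => rfl
  have hq : Surjective q := by
    rintro ⟨y, x, rfl⟩
    exact ⟨x, rfl⟩
  obtain ⟨TI, _, ⟨dI⟩⟩ := exists_min' (nullI l A) B
  obtain ⟨TC, _, ⟨dC⟩⟩ := exists_min' (lp A ⊤) B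
  obtain ⟨TQ, _, ⟨dQ⟩⟩ := exists_min' Q B
  obtain ⟨j, hj, hj'⟩ := exists_spatial dQ s σ hs hσ
  obtain ⟨iT, hiT⟩ := min_functor dI.toTensorData dC i0 (NonUnitalStarAlgHom.id ℂ B)
  obtain ⟨qT, hqT⟩ := min_functor dC.toTensorData dQ q (NonUnitalStarAlgHom.id ℂ B)
  have hker : {a | q a = 0} = Set.range i0 := by
    ext a
    have : q a = 0 ↔ π a = 0 := by
      rw [← hsq]; exact (map_eq_zero_iff s hs).symm
    rw [Set.mem_setOf_eq, this, hπ']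
    exact ⟨fun h => ⟨⟨a, h⟩, rfl⟩, by rintro ⟨y, rfl⟩; exact y.2⟩
  obtain ⟨-, -, hex⟩ := hB _ _ _ i0 q hi0 hq hker TI TC TQ dI dC dQ iT qT hiT hqT
  set Y := ∑ j, dC.tmul (c j) (b j) with hY
  have hYs : IsSelfAdjoint Y := tmul_sum_sa _ _ _ hc hb
  have h1 : j (qT Y) = rho π σ (∑ j, c j ⊗ₜ b j) := by
    have : qT Y = TJ dQ.toTensorData (∑ j, q (c j) ⊗ₜ b j) := by
      rw [hY, map_sum, map_sum]
      refine Finset.sum_congr rfl fun j _ => ?_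
      rw [hqT, TJ_tmul]; rfl
    rw [this, hj', map_sum, map_sum]
    refine Finset.sum_congr rfl fun j _ => ?_
    rw [rho_tmul, rho_tmul, hsq]
  have h2 : ∀ x : HT H K, (⟪x, j (qT Y) x⟫_ℂ).re ≤ ‖x‖ ^ 2 := by
    intro x
    rw [h1]
    refine form_le σ e π c b u hu (fun S => ?_) x
    obtain ⟨X, hX⟩ := hX S
    exact ⟨X, fun i k => (hπ' _).2 (hX i k)⟩
  have h3 := cut_eq_zero (j (qT Y)) ((hYs.map qT).map j) (op_le _ ((hYs.map qT).map j) h2)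
  rw [← map_cut j _ (hYs.map qT), ← map_cut qT _ hYs] at h3
  have h4 : qT (cfcₙ cutf Y) = 0 := hj (by rw [h3, map_zero])
  have h5 : cfcₙ cutf Y ∈ Set.range iT := by rw [← hex]; exact h4
  obtain ⟨w, hw⟩ := h5
  have hev : ∀ i, ∃ h : TC →⋆ₙₐ[ℂ] T i, ∀ x y, h (dC.tmul x y) = (d i).tmul (x i) y := fun i =>
    min_functor dC.toTensorData (d i) (evC A i) (NonUnitalStarAlgHom.id ℂ B)
  choose ev hev using hev
  have h6 : ∀ i, ev i (cfcₙ cutf Y) = cfcₙ cutf (∑ j, (d i).tmul (c j i) (b j)) := by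
    intro i
    rw [map_cut _ _ hYs, hY, map_sum]
    simp only [hev]
  have h7 : Tendsto (fun i => ‖ev i (iT w)‖) l (𝓝 0) := by
    refine (TJ_dense dI.toTensorData).induction_on (p := fun w => Tendsto (fun i => ‖ev i (iT w)‖) l (𝓝 0)) w ?_ ?_
    · refine isClosed_of_closure_subset fun x hx => ?_
      change Tendsto _ l (𝓝 0)
      rw [Metric.tendsto_nhds]
      intro ε hε
      obtain ⟨y, hy, hxy⟩ := Metric.mem_closure_iff.1 hx (ε/2) (by positivity)
      have hy' : Tendsto (fun i => ‖ev i (iT y)‖) l (𝓝 0) := hy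
      filter_upwards [(Metric.tendsto_nhds.1 hy') (ε/2) (by positivity)] with i hi
      rw [dist_zero_right, norm_norm] at *
      have h1 : ‖ev i (iT (x - y))‖ ≤ ‖x - y‖ := (nush_norm_le (ev i) _).trans (nush_norm_le iT _)
      have h2 : ev i (iT x) = ev i (iT (x - y)) + ev i (iT y) := by rw [← map_add, ← map_add, sub_add_cancel]
      rw [h2]
      rw [dist_eq_norm] at hxy
      linarith [norm_add_le (ev i (iT (x - y))) (ev i (iT y))]
    · intro z
      induction z with
      | zero => simp only [map_zero, norm_zero]; exact tendsto_const_nhds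
      | add x y hx hy =>
        have := hx.add hy
        rw [add_zero] at this
        refine squeeze_zero (fun i => norm_nonneg _) (fun i => ?_) this
        rw [map_add, map_add, map_add]; exact norm_add_le _ _
      | tmul x y =>
        have hx : Tendsto (fun i => ‖(x : lp A ⊤) i‖) l (𝓝 0) := x.2
        have := hx.mul_const ‖y‖
        rw [zero_mul] at this
        refine this.congr fun i => ?_
        rw [TJ_tmul, hiT, hev, (d i).norm_tmul]; rfl
  rw [hw] at h7
  simpa only [h6] using h7
end eu
end FM

namespace FM
set_option linter.all false
set_option linter.style.haveILetI false
set_option linter.unnecessarySimpa false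
open scoped ComplexOrder InnerProductSpace ComplexStarModule
open scoped TensorProduct Topology
open Filter

section eu
variable {K : Type} [NormedAddCommGroup K] [InnerProductSpace ℂ K] [CompleteSpace K] {ι : Type}

lemma norm_one_le' {A : Type} [CStarAlgebra A] : ‖(1:A)‖ ≤ 1 := by
  rcases subsingleton_or_nontrivial A with h | h
  · rw [Subsingleton.elim (1:A) 0, norm_zero]; exact zero_le_one
  · exact CStarRing.norm_one.le

theorem E_lemma {B : Type} [NonUnitalCStarAlgebra B] (hB : IsExactCStar B)
    (σ : B →⋆ₙₐ[ℂ] (K →L[ℂ] K)) (hσ : Injective σ) (e : HilbertBasis ι ℂ K) [DecidableEq ι]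
    {J : Type} [Fintype J] (b : J → B) (hb : ∀ j, IsSelfAdjoint (b j)) (R κ : ℝ) (hκ : 0 < κ) :
    ∃ S : Finset ι, ∀ (A' : Type) (_ : CStarAlgebra A') (T' : Type) (_ : NonUnitalCStarAlgebra T')
      (d : MinTensorData A' B T') (a : J → A') (_ : ∀ j, IsSelfAdjoint (a j)) (_ : ∀ j, ‖a j‖ ≤ R)
      (r : S → S → A') (_ : ∀ i k : S, (if i = k then 1 else 0) - ∑ j, ⟪e i, σ (b j) (e k)⟫_ℂ • a j = ∑ l, star (r l i) * r l k)
      (F : T' →ₗ[ℂ] ℂ) (_ : QState F), (F (∑ j, d.tmul (a j) (b j))).re ≤ 1 + κ := by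
  by_contra hcon
  push Not at hcon
  choose A iA T iT d a ha hR r hr F hF hlt using hcon
  have hmem : ∀ (x : ∀ S, A S) (C : ℝ), (∀ S, ‖x S‖ ≤ C) → Memℓp x ⊤ := fun x C h => 
    memℓp_infty ⟨C, by rintro _ ⟨S, rfl⟩; exact h S⟩
  let c : J → lp A ⊤ := fun j => ⟨fun S => a S j, hmem _ R fun S => hR S j⟩
  let u : lp A ⊤ := ⟨fun S => 1, hmem _ 1 fun S => norm_one_le'⟩
  have hu : ‖u‖ ≤ 1 := lp.norm_le_of_forall_le zero_le_one fun S => norm_one_le'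
  have hc : ∀ j, IsSelfAdjoint (c j) := fun j => by
    apply lp.ext
    funext S
    exact (ha S j).star_eq
  have key : ∀ S0 S : Finset ι, ∃ X : S0 → S0 → A S, (∀ l k, ‖X l k‖ ≤ 1 + ∑ i ∈ S0, ∑ j, ‖⟪e i, σ (b j) (e i)⟫_ℂ‖ * |R|) ∧
      (S0 ≤ S → ∀ i k : S0, (if i = k then 1 else 0) - ∑ j, ⟪e i, σ (b j) (e k)⟫_ℂ • a S j = ∑ l, star (X l i) * X l k) := by
    intro S0 S
    have hC : 0 ≤ ∑ i ∈ S0, ∑ j, ‖⟪e i, σ (b j) (e i)⟫_ℂ‖ * |R| := by positivity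
    by_cases hS : S0 ≤ S
    swap
    · exact ⟨fun _ _ => 0, fun l k => by rw [norm_zero]; linarith, fun h => (hS h).elim⟩
    obtain ⟨X, hX⟩ := sqrt_block (fun (l : S) (i : S0) => r S l ⟨i, hS i.2⟩)
    have hX' : ∀ i k : S0, (if i = k then 1 else 0) - ∑ j, ⟪e i, σ (b j) (e k)⟫_ℂ • a S j = ∑ l, star (X l i) * X l k := by
      intro i k
      rw [← hX, ← hr]
      simp only [Subtype.mk.injEq, Subtype.ext_iff]
    refine ⟨X, fun l k => ?_, fun _ => hX'⟩
    have h1 := norm_le_of_sum (fun l => X l k) l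
    rw [← hX' k k, if_pos rfl] at h1
    have h2 : ‖∑ j, ⟪e k, σ (b j) (e k)⟫_ℂ • a S j‖ ≤ ∑ i ∈ S0, ∑ j, ‖⟪e i, σ (b j) (e i)⟫_ℂ‖ * |R| := by
      refine le_trans ?_ (Finset.single_le_sum (f := fun i => ∑ j, ‖⟪e i, σ (b j) (e i)⟫_ℂ‖ * |R|) (fun i _ => by positivity) k.2)
      refine (norm_sum_le _ _).trans (Finset.sum_le_sum fun j _ => ?_)
      rw [norm_smul]
      exact mul_le_mul_of_nonneg_left ((hR S j).trans (le_abs_self R)) (norm_nonneg _)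
    have h3 := norm_sub_le (1 : A S) (∑ j, ⟪e k, σ (b j) (e k)⟫_ℂ • a S j)
    have h4 := norm_one_le' (A := A S)
    nlinarith [norm_nonneg (X l k)]
  choose X hX1 hX2 using key
  have h1 := exact_ultra hB σ hσ e (atTop : Filter (Finset ι)) A T d c hc b hb u hu (by
    intro S0
    refine ⟨fun l k => ⟨fun S => X S0 S l k, hmem _ _ fun S => hX1 S0 S l k⟩, fun i k => ?_⟩
    refine Tendsto.congr' (f₁ := fun _ => (0:ℝ)) ?_ tendsto_const_nhds
    filter_upwards [eventually_ge_atTop S0] with S hS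
    symm
    rw [norm_eq_zero]
    have h2 := hX2 S0 S hS i k
    have h3 : ∀ f : S0 → lp A ⊤, (∑ l, f l : lp A ⊤) S = ∑ l, f l S := fun f => map_sum (evC A S) f _
    have h3' : ∀ f : J → lp A ⊤, (∑ l, f l : lp A ⊤) S = ∑ l, f l S := fun f => map_sum (evC A S) f _
    rw [lp.coeFn_sub, Pi.sub_apply, lp.coeFn_sub, Pi.sub_apply, h3, h3', sub_eq_zero]
    have h4 : ((if i = k then u else 0 : lp A ⊤) S) = (if i = k then 1 else 0) := by
      split_ifs <;> rfl
    rw [h4]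
    refine Eq.trans ?_ (h2.trans ?_)
    · rfl
    · refine Finset.sum_congr rfl fun l _ => ?_
      rw [lp.infty_coeFn_mul]
      rfl)
  obtain ⟨S, hS⟩ := ((tendsto_order.1 h1).2 κ hκ).exists
  have h2 := cut_le _ (tmul_sum_sa (d S).toTensorData (a S) b (ha S) hb) (F S) (hF S)
  have h3 := hlt S
  change ‖cfcₙ cutf (∑ j, (d S).tmul (a S j) (b j))‖ < κ at hS
  linarith
end eu
end FM

namespace FM
set_option linter.all false
set_option linter.style.haveILetI false
set_option linter.unnecessarySimpa false
open scoped ComplexOrder InnerProductSpace ComplexStarModule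
open scoped TensorProduct Topology Kronecker Matrix
open Filter

section dual

lemma riesz_param {P E : Type*} [AddCommGroup P] [Module ℝ P] [AddCommGroup E] [Module ℝ E]
    (C : PointedCone ℝ E) (L : P →ₗ[ℝ] E) (f : P →ₗ[ℝ] ℝ) (hf : ∀ p, L p ∈ C → 0 ≤ f p)
    (hd : ∀ y, ∃ p, L p + y ∈ C) : ∃ g : E →ₗ[ℝ] ℝ, (∀ p, g (L p) = f p) ∧ ∀ x ∈ C, 0 ≤ g x := by
  have hk : ∀ p, L p = 0 → f p = 0 := by
    intro p hp
    have h1 := hf p (by rw [hp]; exact C.zero_mem)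
    have h2 := hf (-p) (by rw [map_neg, hp, neg_zero]; exact C.zero_mem)
    rw [map_neg] at h2
    linarith
  obtain ⟨s, hs⟩ := L.rangeRestrict.exists_rightInverse_of_surjective (LinearMap.range_rangeRestrict L)
  have hs' : ∀ y : LinearMap.range L, L (s y) = y := fun y => by
    have := congrArg Subtype.val (LinearMap.congr_fun hs y)
    exact this
  have hfs : ∀ p, f (s ⟨L p, p, rfl⟩) = f p := by
    intro p
    rw [← sub_eq_zero, ← map_sub]
    apply hk
    rw [map_sub, hs', sub_self]
  obtain ⟨g, hg1, hg2⟩ := riesz_extension C (⟨LinearMap.range L, f ∘ₗ s⟩ : E →ₗ.[ℝ] ℝ) (by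
    rintro ⟨_, p, rfl⟩ hp
    change 0 ≤ f (s _)
    rw [hfs]
    exact hf p hp) (by
    intro y
    obtain ⟨p, hp⟩ := hd y
    exact ⟨⟨L p, p, rfl⟩, hp⟩)
  exact ⟨g, fun p => (hg1 ⟨L p, p, rfl⟩).trans (hfs p), hg2⟩

variable {P Q J : Type} [Fintype P] [Fintype Q] [DecidableEq P] [DecidableEq Q] [Fintype J]

/-- accretive matrices -/
def accr (n : Type) [Fintype n] : PointedCone ℝ (Matrix n n ℂ) where
  carrier := {M | ∀ v : n → ℂ, 0 ≤ (star v ⬝ᵥ M *ᵥ v).re}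
  zero_mem' := by intro v; simp
  add_mem' := by
    intro a b ha hb v
    rw [Matrix.add_mulVec, dotProduct_add, Complex.add_re]
    exact add_nonneg (ha v) (hb v)
  smul_mem' := by
    intro c a ha v
    have : c • a = ((c : ℝ) : ℂ) • a := by ext; simp [NNReal.smul_def]; rfl
    rw [this, Matrix.smul_mulVec, dotProduct_smul, smul_eq_mul, Complex.re_ofReal_mul]
    exact mul_nonneg c.2 (ha v)

lemma accr_big {n : Type} [Fintype n] [DecidableEq n] (y : Matrix n n ℂ) :
    ∃ C : ℝ, (C : ℂ) • (1 : Matrix n n ℂ) + y ∈ accr n := by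
  refine ⟨∑ i, ∑ j, ‖y i j‖, fun v => ?_⟩
  have h1 : (star v ⬝ᵥ y *ᵥ v) = ∑ i, ∑ j, star (v i) * y i j * v j := by
    simp [dotProduct, Matrix.mulVec, Finset.mul_sum, mul_assoc]
  have h2 : (star v ⬝ᵥ v) = ((∑ i, ‖v i‖ ^ 2 : ℝ) : ℂ) := by
    push_cast
    refine Finset.sum_congr rfl fun i _ => ?_
    rw [Pi.star_apply, Complex.star_def, Complex.conj_mul']
  have h3 : ‖star v ⬝ᵥ y *ᵥ v‖ ≤ (∑ i, ∑ j, ‖y i j‖) * ∑ i, ‖v i‖ ^ 2 := by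
    rw [h1, Finset.sum_mul]
    refine (norm_sum_le _ _).trans (Finset.sum_le_sum fun i _ => ?_)
    rw [Finset.sum_mul]
    refine (norm_sum_le _ _).trans (Finset.sum_le_sum fun j _ => ?_)
    rw [norm_mul, norm_mul, norm_star]
    have a1 := Finset.single_le_sum (f := fun i => ‖v i‖ ^ 2) (fun i _ => by positivity) (Finset.mem_univ i)
    have a2 := Finset.single_le_sum (f := fun i => ‖v i‖ ^ 2) (fun i _ => by positivity) (Finset.mem_univ j)
    have a3 : ‖v i‖ * ‖v j‖ ≤ ∑ i, ‖v i‖ ^ 2 := by nlinarith [sq_nonneg (‖v i‖ - ‖v j‖)]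
    calc _ = ‖y i j‖ * (‖v i‖ * ‖v j‖) := by ring
      _ ≤ _ := mul_le_mul_of_nonneg_left a3 (norm_nonneg _)
  rw [Matrix.add_mulVec, dotProduct_add, Matrix.smul_mulVec, dotProduct_smul, Matrix.one_mulVec, h2, Complex.add_re, smul_eq_mul,
    Complex.re_ofReal_mul, Complex.ofReal_re]
  have := Complex.abs_re_le_norm (star v ⬝ᵥ y *ᵥ v)
  rw [abs_le] at this
  linarith

lemma dot_conj {n : Type} [Fintype n] (M : Matrix n n ℂ) (v : n → ℂ) : (star v ⬝ᵥ Mᴴ *ᵥ v) = star (star v ⬝ᵥ M *ᵥ v) := by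
  rw [Matrix.star_dotProduct, Matrix.star_mulVec, ← Matrix.dotProduct_mulVec, Matrix.conjTranspose_conjTranspose]

lemma accr_herm {n : Type} [Fintype n] (M : Matrix n n ℂ) (hM : M ∈ accr n) : ((1/2 : ℂ) • (M + Mᴴ)).PosSemidef := by
  refine Matrix.PosSemidef.of_dotProduct_mulVec_nonneg ?_ ?_
  · rw [Matrix.IsHermitian, Matrix.conjTranspose_smul, Matrix.conjTranspose_add, Matrix.conjTranspose_conjTranspose, add_comm]
    simp
  · intro v
    rw [Matrix.smul_mulVec, dotProduct_smul, Matrix.add_mulVec, dotProduct_add, dot_conj, Complex.star_def, Complex.add_conj, smul_eq_mul]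
    have := hM v
    rw [show (1/2:ℂ) * ((2 * (star v ⬝ᵥ M *ᵥ v).re : ℝ) : ℂ) = (((star v ⬝ᵥ M *ᵥ v).re : ℝ) : ℂ) by push_cast; ring]
    exact_mod_cast this
end dual
end FM

namespace FM
set_option linter.all false
set_option linter.style.haveILetI false
set_option linter.unnecessarySimpa false
open scoped ComplexOrder InnerProductSpace ComplexStarModule
open scoped TensorProduct Topology Kronecker Matrix
open Filter

section dual
open scoped MatrixOrder in
lemma psd_factor {n : Type} [Fintype n] [DecidableEq n] {M : Matrix n n ℂ} (h : M.PosSemidef) : ∃ L : Matrix n n ℂ, M = Lᴴ * L :=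
  CStarAlgebra.nonneg_iff_eq_star_mul_self.mp h.nonneg

lemma mem_accr_of_posSemidef {n : Type} [Fintype n] {M : Matrix n n ℂ} (h : M.PosSemidef) : M ∈ accr n :=
  fun v => (Complex.le_def.1 (h.dotProduct_mulVec_nonneg v)).1

lemma skew_accr {n : Type} [Fintype n] {M : Matrix n n ℂ} (h : Mᴴ = -M) : M ∈ accr n := by
  intro v
  have := congrArg Complex.re (dot_conj M v)
  rw [h, Matrix.neg_mulVec, dotProduct_neg, Complex.neg_re, Complex.star_def, Complex.conj_re] at this
  linarith

/-- A positive functional on accretive matrices gives a Choi factorisation. -/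
lemma choi {n : Type} [Fintype n] [DecidableEq n] (g : Matrix n n ℂ →ₗ[ℝ] ℝ) (hg : ∀ x ∈ accr n, 0 ≤ g x) :
    ∃ L : Matrix n n ℂ, ∀ M : Matrix n n ℂ, (g M : ℂ) - Complex.I * (g (Complex.I • M) : ℂ) = ∑ t, ∑ x, ∑ y, L t x * M x y * star (L t y) := by
  let G : Matrix n n ℂ →ₗ[ℂ] ℂ := Module.Dual.extendRCLike (𝕜 := ℂ) g
  have hG : ∀ M, G M = (g M : ℂ) - Complex.I * (g (Complex.I • M) : ℂ) := fun M => rfl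
  have hsk : ∀ M : Matrix n n ℂ, Mᴴ = -M → g M = 0 := by
    intro M hM
    have h1 := hg M (skew_accr hM)
    have h2 := hg (-M) (skew_accr (by rw [Matrix.conjTranspose_neg, hM]))
    rw [map_neg] at h2
    linarith
  let D : Matrix n n ℂ := Matrix.of fun y x => G (Matrix.single x y 1)
  have hGD : ∀ M, G M = ∑ x, ∑ y, M x y * D y x := by
    intro M
    conv_lhs => rw [Matrix.matrix_eq_sum_single M]
    rw [map_sum]
    refine Finset.sum_congr rfl fun x _ => ?_
    rw [map_sum]
    refine Finset.sum_congr rfl fun y _ => ?_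
    rw [show Matrix.single x y (M x y) = M x y • Matrix.single x y (1:ℂ) by rw [Matrix.smul_single, smul_eq_mul, mul_one], map_smul, smul_eq_mul]
    rfl
  have hq : ∀ w : n → ℂ, (star w ⬝ᵥ D *ᵥ w) = G (Matrix.vecMulVec w (star w)) := by
    intro w
    rw [hGD]
    simp only [dotProduct, Matrix.mulVec, Finset.mul_sum, Matrix.vecMulVec_apply]
    rw [Finset.sum_comm]
    refine Finset.sum_congr rfl fun x _ => Finset.sum_congr rfl fun y _ => ?_
    ring
  have hpos : ∀ w : n → ℂ, 0 ≤ (star w ⬝ᵥ D *ᵥ w) := by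
    intro w
    have hp := Matrix.posSemidef_vecMulVec_self_star w
    rw [hq, hG, hsk (Complex.I • _)]
    · have := hg _ (mem_accr_of_posSemidef hp)
      simpa using this
    · rw [Matrix.conjTranspose_smul, hp.1.eq, Complex.star_def, Complex.conj_I, neg_smul]
  have hD : D.PosSemidef := by
    refine Matrix.PosSemidef.of_dotProduct_mulVec_nonneg ?_ hpos
    rw [Matrix.isHermitian_iff_isSymmetric, LinearMap.isSymmetric_iff_inner_map_self_real]
    intro v
    have h1 := hpos (WithLp.ofLp v)
    have h2 : ⟪Matrix.toEuclideanLin D v, v⟫_ℂ = star (star (WithLp.ofLp v) ⬝ᵥ D *ᵥ (WithLp.ofLp v)) := by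
      rw [EuclideanSpace.inner_eq_star_dotProduct, Matrix.ofLp_toEuclideanLin_apply]
      simp [Matrix.star_dotProduct, dotProduct_comm]
    rw [h2]
    have h3 := Complex.le_def.1 h1
    apply Complex.ext
    · simp
    · have h4 : (star (WithLp.ofLp v) ⬝ᵥ D *ᵥ (WithLp.ofLp v)).im = 0 := by simpa using h3.2.symm
      simp [h4]
  obtain ⟨L, hL⟩ := psd_factor hD
  refine ⟨L, fun M => ?_⟩
  rw [← hG, hGD, hL]
  simp only [Matrix.mul_apply, Matrix.conjTranspose_apply, Finset.mul_sum]
  refine Eq.trans ?_ Finset.sum_comm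
  refine Finset.sum_congr rfl fun x _ => ?_
  rw [Finset.sum_comm]
  refine Finset.sum_congr rfl fun y _ => Finset.sum_congr rfl fun t _ => ?_
  ring

variable {P Q J : Type} [Fintype P] [Fintype Q] [DecidableEq P] [DecidableEq Q] [Fintype J]

theorem kraus_dual (X : J → Matrix Q Q ℂ) (hX : ∀ j, (X j).IsHermitian) (Z : J → Matrix P P ℂ) (hZ : ∀ j, (Z j).IsHermitian) (c : ℝ)
    (H : ∀ (h : Matrix P P ℂ) (m : J → Matrix P P ℂ), h.IsHermitian → (∀ j, (m j).IsHermitian) →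
      (h ⊗ₖ (1 : Matrix Q Q ℂ) - ∑ j, m j ⊗ₖ X j).PosSemidef → (∑ j, ∑ k, ∑ l, m j k l * Z j k l).re ≤ c * h.trace.re) :
    ∃ K : (P × Q) → Matrix Q P ℂ, ∑ t, (K t)ᴴ * K t = (c : ℂ) • 1 ∧ ∀ j, ∑ t, (K t)ᴴ * X j * K t = Z j := by
  classical
  let Lc : (Matrix P P ℂ × (J → Matrix P P ℂ)) →ₗ[ℂ] Matrix (P × Q) (P × Q) ℂ := 
    { toFun := fun p => p.1 ⊗ₖ (1 : Matrix Q Q ℂ) - ∑ j, p.2 j ⊗ₖ X j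
      map_add' := fun p q => by
        simp only [Prod.fst_add, Prod.snd_add, Pi.add_apply, Matrix.add_kronecker, Finset.sum_add_distrib]; abel
      map_smul' := fun a p => by
        simp only [Prod.smul_fst, Prod.smul_snd, Pi.smul_apply, Matrix.smul_kronecker, smul_sub, Finset.smul_sum, RingHom.id_apply] }
  have hLc : ∀ p, Lc p = p.1 ⊗ₖ (1 : Matrix Q Q ℂ) - ∑ j, p.2 j ⊗ₖ X j := fun p => rfl
  let fc : (Matrix P P ℂ × (J → Matrix P P ℂ)) →ₗ[ℂ] ℂ := 
    { toFun := fun p => c * p.1.trace - ∑ j, ∑ k, ∑ l, p.2 j k l * Z j k l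
      map_add' := fun p q => by
        simp only [Prod.fst_add, Prod.snd_add, Pi.add_apply, Matrix.add_apply, Matrix.trace_add, Finset.sum_add_distrib, add_mul]; ring
      map_smul' := fun a p => by
        simp only [Prod.smul_fst, Prod.smul_snd, Pi.smul_apply, Matrix.smul_apply, smul_eq_mul, Matrix.trace_smul, mul_sub, Finset.mul_sum, RingHom.id_apply]
        congr 1
        · ring
        · simp only [mul_assoc] }
  have hfc : ∀ p, fc p = c * p.1.trace - ∑ j, ∑ k, ∑ l, p.2 j k l * Z j k l := fun p => rfl
  have hLs : ∀ p : (Matrix P P ℂ × (J → Matrix P P ℂ)), (Lc p)ᴴ = Lc (p.1ᴴ, fun j => (p.2 j)ᴴ) := by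
    intro p
    rw [hLc, hLc, Matrix.conjTranspose_sub, Matrix.conjTranspose_sum, Matrix.conjTranspose_kronecker, Matrix.conjTranspose_one]
    congr 1
    refine Finset.sum_congr rfl fun j _ => ?_
    rw [Matrix.conjTranspose_kronecker, (hX j).eq]
  have hfs : ∀ p : (Matrix P P ℂ × (J → Matrix P P ℂ)), star (fc p) = fc (p.1ᴴ, fun j => (p.2 j)ᴴ) := by
    intro p
    rw [hfc, hfc, star_sub, star_mul', Matrix.trace_conjTranspose, star_sum]
    congr 1
    · simp
    refine Finset.sum_congr rfl fun j _ => ?_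
    rw [star_sum, Finset.sum_comm]
    refine Finset.sum_congr rfl fun k _ => ?_
    rw [star_sum]
    refine Finset.sum_congr rfl fun l _ => ?_
    have hz : star (Z j k l) = Z j l k := by rw [← Matrix.conjTranspose_apply, (hZ j).eq]
    rw [star_mul', hz]; rfl
  obtain ⟨g, hg1, hg2⟩ := riesz_param (accr (P × Q)) (Lc.restrictScalars ℝ) (Complex.reLm ∘ₗ fc.restrictScalars ℝ) (by
    intro p hp
    have h1 := accr_herm _ hp
    let p' : (Matrix P P ℂ × (J → Matrix P P ℂ)) := (1/2 : ℂ) • (p + (p.1ᴴ, fun j => (p.2 j)ᴴ))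
    have h2 : (1/2 : ℂ) • (Lc p + (Lc p)ᴴ) = Lc p' := by
      rw [hLs, ← map_add, ← map_smul]
    change ((1/2 : ℂ) • (Lc p + (Lc p)ᴴ)).PosSemidef at h1
    rw [h2] at h1
    have hh : ∀ M : Matrix P P ℂ, ((1/2:ℂ) • (M + Mᴴ)).IsHermitian := by
      intro M
      rw [Matrix.IsHermitian, Matrix.conjTranspose_smul, Matrix.conjTranspose_add, Matrix.conjTranspose_conjTranspose, add_comm]
      simp
    have h3 := H p'.1 p'.2 (hh _) (fun j => hh _) h1
    have h4 : fc p' = (((fc p).re : ℝ) : ℂ) := by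
      rw [map_smul, map_add, ← hfs, Complex.star_def, Complex.add_conj, smul_eq_mul]
      push_cast; ring
    have h5 : (fc p').re = (fc p).re := by rw [h4, Complex.ofReal_re]
    change 0 ≤ (fc p).re
    rw [← h5, hfc, Complex.sub_re, Complex.re_ofReal_mul]
    linarith) (by
    intro y
    obtain ⟨C, hC⟩ := accr_big y
    refine ⟨((C : ℂ) • 1, 0), ?_⟩
    convert hC using 2
    change Lc _ = _
    rw [hLc]
    simp [Matrix.smul_kronecker])
  obtain ⟨L, hL⟩ := choi g hg2
  have key : ∀ p, fc p = ∑ t, ∑ x, ∑ y, L t x * Lc p x y * star (L t y) := by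
    intro p
    rw [← hL]
    have h1 : g (Lc p) = (fc p).re := hg1 p
    have h2 : g (Complex.I • Lc p) = (fc (Complex.I • p)).re := by rw [← map_smul]; exact hg1 _
    rw [h1, h2, map_smul]
    apply Complex.ext <;> simp
  let K : (P × Q) → Matrix Q P ℂ := fun t => Matrix.of fun q l => star (L t (l, q))
  have hK : ∀ (Y : Matrix Q Q ℂ) (k l : P), (∑ t, (K t)ᴴ * Y * K t) k l = ∑ t, ∑ x, ∑ y, L t x * (Matrix.single k l (1:ℂ) ⊗ₖ Y) x y * star (L t y) := by
    intro Y k l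
    rw [Matrix.sum_apply]
    refine Finset.sum_congr rfl fun t _ => ?_
    simp only [Fintype.sum_prod_type, Matrix.kroneckerMap_apply]
    rw [Finset.sum_eq_single k]
    · simp only [Matrix.mul_apply, Finset.sum_mul, Matrix.conjTranspose_apply]
      rw [Finset.sum_comm]
      refine Finset.sum_congr rfl fun p _ => ?_
      rw [Finset.sum_eq_single l]
      · refine Finset.sum_congr rfl fun q _ => ?_
        simp [K]
      · intro b _ hb
        simp [Matrix.single_apply, hb.symm]
      · simp
    · intro b _ hb
      simp [Matrix.single_apply, hb.symm]
    · simp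
  refine ⟨K, ?_, fun j => ?_⟩
  · ext k l
    have h1 := hK 1 k l
    simp only [Matrix.mul_one] at h1
    rw [h1]
    have h2 := key (Matrix.single k l 1, 0)
    simp only [hLc, hfc, Pi.zero_apply, Matrix.zero_kronecker, Finset.sum_const_zero, sub_zero, Matrix.zero_apply, zero_mul] at h2
    rw [← h2]
    by_cases hkl : k = l
    · subst hkl; simp
    · simp [hkl, Matrix.trace_single_eq_of_ne]
  · ext k l
    rw [hK]
    have h2 := key (0, Pi.single j (Matrix.single k l 1))
    have h3 : Lc (0, Pi.single j (Matrix.single k l 1)) = - (Matrix.single k l (1:ℂ) ⊗ₖ X j) := by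
      rw [hLc, Finset.sum_eq_single j]
      · simp
      · intro b _ hb; simp [hb]
      · simp
    have h4 : fc (0, Pi.single j (Matrix.single k l 1)) = - Z j k l := by
      rw [hfc, Finset.sum_eq_single j, Finset.sum_eq_single k, Finset.sum_eq_single l]
      · simp
      · intro b _ hb; simp [Matrix.single_apply, hb.symm]
      · simp
      · intro b _ hb; simp [Matrix.single_apply, hb.symm]
      · simp
      · intro b _ hb; simp [hb]
      · simp
    rw [h3, h4] at h2
    simp only [Matrix.neg_apply, mul_neg, neg_mul, Finset.sum_neg_distrib, neg_inj] at h2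
    exact h2.symm
end dual
end FM

namespace FM
set_option linter.all false
set_option linter.style.haveILetI false
set_option linter.unnecessarySimpa false
open scoped ComplexOrder InnerProductSpace ComplexStarModule
open scoped TensorProduct Topology Kronecker Matrix
open Filter

section cpf
variable {A B T : Type} [NonUnitalCStarAlgebra A] [NonUnitalCStarAlgebra B] [NonUnitalCStarAlgebra T]
variable {n m : Type} [Fintype n] [Fintype m]

/-- completely positive matrix of functionals -/
def CPf (D : n → n → A →ₗ[ℂ] ℂ) : Prop := ∀ c : n → A, 0 ≤ ∑ i, ∑ j, D i j (star (c i) * c j)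

lemma psd_of_form {k : Type} [Fintype k] [DecidableEq k] (M : Matrix k k ℂ) (h : ∀ w : k → ℂ, 0 ≤ ∑ x, ∑ y, star (w x) * w y * M x y) :
    M.PosSemidef := by
  have hq : ∀ w : k → ℂ, (star w ⬝ᵥ M *ᵥ w) = ∑ x, ∑ y, star (w x) * w y * M x y := by
    intro w
    simp only [dotProduct, Matrix.mulVec, Finset.mul_sum]
    refine Finset.sum_congr rfl fun x _ => Finset.sum_congr rfl fun y _ => ?_
    simp only [Pi.star_apply]
    ring
  have hpos : ∀ w : k → ℂ, 0 ≤ (star w ⬝ᵥ M *ᵥ w) := fun w => by rw [hq]; exact h w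
  refine Matrix.PosSemidef.of_dotProduct_mulVec_nonneg ?_ hpos
  rw [Matrix.isHermitian_iff_isSymmetric, LinearMap.isSymmetric_iff_inner_map_self_real]
  intro v
  have h1 := hpos (WithLp.ofLp v)
  have h2 : ⟪Matrix.toEuclideanLin M v, v⟫_ℂ = star (star (WithLp.ofLp v) ⬝ᵥ M *ᵥ (WithLp.ofLp v)) := by
    rw [EuclideanSpace.inner_eq_star_dotProduct, Matrix.ofLp_toEuclideanLin_apply]
    simp [dotProduct, mul_comm]
  rw [h2]
  have h3 := Complex.le_def.1 h1
  apply Complex.ext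
  · simp
  · have h4 : (star (WithLp.ofLp v) ⬝ᵥ M *ᵥ (WithLp.ofLp v)).im = 0 := by simpa using h3.2.symm
    simp [h4]

lemma form_of_psd {k : Type} [Fintype k] {M : Matrix k k ℂ} (hM : M.PosSemidef) (w : k → ℂ) : 0 ≤ ∑ x, ∑ y, star (w x) * w y * M x y := by
  have hq : (star w ⬝ᵥ M *ᵥ w) = ∑ x, ∑ y, star (w x) * w y * M x y := by
    simp only [dotProduct, Matrix.mulVec, Finset.mul_sum]
    refine Finset.sum_congr rfl fun x _ => Finset.sum_congr rfl fun y _ => ?_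
    simp only [Pi.star_apply]
    ring
  rw [← hq]
  exact hM.dotProduct_mulVec_nonneg w

lemma CPf.psd {D : n → n → A →ₗ[ℂ] ℂ} (hD : CPf D) (a : m → A) :
    (Matrix.of fun (p q : m × n) => D p.2 q.2 (star (a p.1) * a q.1)).PosSemidef := by
  classical
  refine psd_of_form _ fun w => ?_
  convert hD (fun i => ∑ r, w (r, i) • a r) using 1
  simp only [Fintype.sum_prod_type, Matrix.of_apply]
  rw [Finset.sum_comm]
  refine Finset.sum_congr rfl fun i _ => ?_
  simp only [star_sum, star_smul, Finset.sum_mul, Finset.mul_sum, map_sum, smul_mul_smul_comm, map_smul, smul_eq_mul]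
  conv_lhs => enter [2, r]; rw [Finset.sum_comm]
  rw [Finset.sum_comm]
  refine Finset.sum_congr rfl fun j _ => ?_
  rw [Finset.sum_comm]

lemma CPf.prod_pos {D : n → n → A →ₗ[ℂ] ℂ} (hD : CPf D) {Ψ : n → n → B →ₗ[ℂ] ℂ} (hΨ : CPf Ψ) (a : m → A) (b : m → B) :
    0 ≤ ∑ r, ∑ s, ∑ i, ∑ j, D i j (star (a r) * a s) * Ψ i j (star (b r) * b s) := by
  classical
  have h := form_of_psd ((hD.psd a).hadamard (hΨ.psd b)) (fun _ => 1)
  simp only [Fintype.sum_prod_type, Matrix.hadamard_apply, Matrix.of_apply, star_one, one_mul] at h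
  convert h using 3 with r _ 
  rw [Finset.sum_comm]

lemma CPf.pos_comb {D : n → n → A →ₗ[ℂ] ℂ} (hD : CPf D) (μ : n → ℂ) : IsPos (∑ i, ∑ j, (star (μ i) * μ j) • D i j) := by
  intro a
  convert hD (fun i => μ i • a) using 1
  simp only [LinearMap.sum_apply, LinearMap.smul_apply, star_smul, smul_mul_smul_comm, map_smul, smul_eq_mul]

lemma CPf.pos_diag {D : n → n → A →ₗ[ℂ] ℂ} (hD : CPf D) (i : n) : IsPos (D i i) := by
  classical
  have := hD.pos_comb (Pi.single i 1)
  convert this using 1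
  ext a
  simp [Pi.single_apply, ite_mul]

lemma CPf.pos2 {D : n → n → A →ₗ[ℂ] ℂ} (hD : CPf D) (i j : n) (c : ℂ) :
    IsPos (D i i + c • D i j + star c • D j i + (star c * c) • D j j) := by
  classical
  have := hD.pos_comb (Pi.single i 1 + Pi.single j c)
  convert this using 1
  ext a
  simp only [LinearMap.sum_apply, LinearMap.add_apply, LinearMap.smul_apply, Pi.add_apply, smul_eq_mul, star_add, add_mul, mul_add, Finset.sum_add_distrib]
  simp [Pi.single_apply, ite_mul, apply_ite]
  ring

lemma CPf.mem_SQ {D : n → n → A →ₗ[ℂ] ℂ} (hD : CPf D) (i j : n) : D i j ∈ SQ A := by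
  have h := fun c => (hD.pos2 i j c).mem_SQ
  have e : D i j = (1/4 : ℂ) • ((D i i + (1:ℂ) • D i j + star (1:ℂ) • D j i + (star (1:ℂ) * 1) • D j j) 
     - (D i i + (-1:ℂ) • D i j + star (-1:ℂ) • D j i + (star (-1:ℂ) * (-1)) • D j j)
     - Complex.I • (D i i + Complex.I • D i j + star Complex.I • D j i + (star Complex.I * Complex.I) • D j j)
     + Complex.I • (D i i + (-Complex.I) • D i j + star (-Complex.I) • D j i + (star (-Complex.I) * (-Complex.I)) • D j j)) := by
    ext a
    simp only [LinearMap.smul_apply, LinearMap.add_apply, LinearMap.sub_apply, Complex.star_def, Complex.conj_I, smul_eq_mul, map_one, map_neg]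
    ring_nf
    simp only [Complex.I_sq, show Complex.I ^ 3 = - Complex.I from Complex.I_pow_three]
    ring
  rw [e]
  exact Submodule.smul_mem _ _ (Submodule.add_mem _ (Submodule.sub_mem _ (Submodule.sub_mem _ (h _) (h _))
    (Submodule.smul_mem _ _ (h _))) (Submodule.smul_mem _ _ (h _)))

/-- product functional -/
def prodF (D : n → n → A →ₗ[ℂ] ℂ) (Ψ : n → n → B →ₗ[ℂ] ℂ) : A ⊗[ℂ] B →ₗ[ℂ] ℂ := ∑ i, ∑ j, tf (D i j) (Ψ i j)

lemma prodF_tmul (D : n → n → A →ₗ[ℂ] ℂ) (Ψ : n → n → B →ₗ[ℂ] ℂ) (a : A) (b : B) :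
    prodF D Ψ (a ⊗ₜ b) = ∑ i, ∑ j, D i j a * Ψ i j b := by
  simp [prodF, LinearMap.sum_apply]

lemma CPf.prodF_pos {D : n → n → A →ₗ[ℂ] ℂ} (hD : CPf D) {Ψ : n → n → B →ₗ[ℂ] ℂ} (hΨ : CPf Ψ) (z : A ⊗[ℂ] B) :
    0 ≤ prodF D Ψ (star z * z) := by
  classical
  obtain ⟨s, rfl⟩ := TensorProduct.exists_finset z
  convert hD.prod_pos hΨ (m := s) (fun p => p.1.1) (fun p => p.1.2) using 1
  rw [star_sum, Finset.sum_mul_sum, map_sum, ← Finset.sum_coe_sort s]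
  refine Finset.sum_congr rfl fun p _ => ?_
  rw [map_sum, ← Finset.sum_coe_sort s]
  refine Finset.sum_congr rfl fun q _ => ?_
  rw [TensorProduct.star_tmul, Algebra.TensorProduct.tmul_mul_tmul, prodF_tmul]

lemma CPf.prod_TBdd (d : TensorData A B T) {D : n → n → A →ₗ[ℂ] ℂ} (hD : CPf D) {Ψ : n → n → B →ₗ[ℂ] ℂ} (hΨ : CPf Ψ) :
    TBdd d (prodF D Ψ) :=
  TBdd.sum _ _ fun i _ => TBdd.sum _ _ fun j _ => tf_bounded d (hD.mem_SQ i j) (hΨ.mem_SQ i j)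
end cpf

section unital
variable {A B T : Type} [CStarAlgebra A] [NonUnitalCStarAlgebra B] [NonUnitalCStarAlgebra T]
variable {n m : Type} [Fintype n] [Fintype m]

lemma one_sub_sq (a : A) (ha : ‖a‖ ≤ 1) : ∃ c : A, 1 - star a * a = star c * c := by
  letI := CStarAlgebra.spectralOrder A
  haveI := CStarAlgebra.spectralOrderedRing A
  have h : star a * a ≤ 1 := by
    refine (CStarAlgebra.norm_le_one_iff_of_nonneg _ (star_mul_self_nonneg a)).1 ?_
    rw [CStarRing.norm_star_mul_self]
    nlinarith [norm_nonneg a]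
  exact CStarAlgebra.nonneg_iff_eq_star_mul_self.1 (sub_nonneg.2 h)

theorem CPf.prod_ext (d : TensorData A B T) {D : n → n → A →ₗ[ℂ] ℂ} (hD : CPf D) {Ψ : n → n → B →ₗ[ℂ] ℂ} (hΨ : CPf Ψ)
    (M : ℝ) (hM : ∀ b, ‖b‖ ≤ 1 → (∑ i, ∑ j, D i j 1 * Ψ i j (star b * b)).re ≤ M) :
    ∃ Φ : T →L[ℂ] ℂ, (∀ z, Φ (TJ d z) = prodF D Ψ z) ∧ IsPos (Φ : T →ₗ[ℂ] ℂ) ∧ ‖Φ‖ ≤ M := by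
  obtain ⟨Φ, hΦ⟩ := (hD.prod_TBdd d hΨ).ext
  have hpos : IsPos (Φ : T →ₗ[ℂ] ℂ) := isPos_of_dense d Φ fun z => by rw [hΦ]; exact hD.prodF_pos hΨ z
  refine ⟨Φ, hΦ, hpos, norm_of_approx d Φ hpos M fun a b ha hb => ?_⟩
  refine le_trans ?_ (hM b hb)
  rw [← TJ_tmul, hΦ, prodF_tmul]
  obtain ⟨c, hc⟩ := one_sub_sq a ha
  have h := hD.prod_pos hΨ (m := Unit) (fun _ => c) (fun _ => b)
  simp only [Finset.univ_unique, Finset.sum_singleton, ← hc, map_sub, sub_mul, Finset.sum_sub_distrib] at h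
  have := (Complex.le_def.1 h).1
  simp only [Complex.sub_re, Complex.zero_re] at this
  linarith

lemma CPf.bound {D : n → n → A →ₗ[ℂ] ℂ} (hD : CPf D) (hm : (∑ i, D i i 1).re ≤ 1) (i j : n) (a : A) : ‖D i j a‖ ≤ 1 + ‖a‖ ^ 2 := by
  classical
  have h1 : ∀ i, 0 ≤ (D i i 1).re := fun i => by
    have := (Complex.le_def.1 (hD.pos_diag i 1)).1
    simpa using this
  have h2 : ∀ i, (D i i 1).re ≤ 1 := fun i => by
    refine le_trans ?_ hm
    rw [Complex.re_sum]
    exact Finset.single_le_sum (f := fun i => (D i i 1).re) (fun i _ => h1 i) (Finset.mem_univ i)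
  have h3 : (D j j (star a * a)).re ≤ ‖a‖ ^ 2 := by
    have := (hD.pos_diag j).norm_conj_le (1 : A) (star a * a)
    simp only [star_one, one_mul, mul_one] at this
    refine (Complex.re_le_norm _).trans (this.trans ?_)
    rw [CStarRing.norm_star_mul_self]
    nlinarith [h2 j, norm_nonneg a, mul_self_nonneg ‖a‖]
  obtain ⟨u, hu, hu2⟩ : ∃ u : ℂ, ‖u‖ = 1 ∧ u * D i j a = - (‖D i j a‖ : ℂ) := by
    by_cases h0 : D i j a = 0
    · exact ⟨1, by simp, by simp [h0]⟩
    · refine ⟨- (‖D i j a‖ : ℂ) / D i j a, ?_, by field_simp⟩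
      have : ‖D i j a‖ ≠ 0 := norm_ne_zero_iff.2 h0
      simp [this]
  let sg : n → A → n → A := fun p x k => if k = p then x else 0
  have h4 := hD (fun k => sg i 1 k + sg j (u • a) k)
  have h5 : (∑ k, ∑ l, D k l (star (sg i 1 k + sg j (u • a) k ) * (sg i 1 l + sg j (u • a) l )))
     = D i i 1 + D i j (u • a) + D j i (star (u • a)) + D j j (star (u • a) * (u • a)) := by
    simp only [star_add, add_mul, mul_add, map_add, Finset.sum_add_distrib]
    have e1 : ∀ (p q : n) (x y ), (∑ k, ∑ l, D k l (star (sg p x k ) * (sg q y l ))) = D p q (star x * y) := by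
      intro p q x y
      rw [Finset.sum_eq_single p, Finset.sum_eq_single q]
      · simp [sg]
      · intro b _ hb; simp [sg, hb]
      · simp
      · intro b _ hb; simp [sg, hb]
      · simp
    rw [e1, e1, e1, e1]
    simp; ring
  have h6 : D j i (star (u • a)) = star (D i j (u • a)) := by
    have hp := hD.psd (fun r : Bool => if r then u • a else 1)
    have := hp.1.apply (true, j) (false, i)
    simp only [Matrix.of_apply, if_true, star_one, one_mul, mul_one] at this
    simpa using this.symm
  have h7 : (D j j (star (u • a) * (u • a))).re = (D j j (star a * a)).re := by
    rw [star_smul, smul_mul_smul_comm, Complex.star_def, Complex.conj_mul', hu]; simp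
  have h8 : (D i j (u • a)).re = - ‖D i j a‖ := by rw [map_smul, smul_eq_mul, hu2]; simp
  rw [h5, h6] at h4
  have h9 := (Complex.le_def.1 h4).1
  simp only [Complex.add_re, Complex.star_def, Complex.conj_re, h7, h8, Complex.zero_re] at h9
  have := h2 i
  nlinarith [norm_nonneg (D i j a), sq_nonneg ‖a‖]
end unital
end FM

namespace FM
set_option linter.all false
set_option linter.style.haveILetI false
set_option linter.unnecessarySimpa false
open scoped ComplexOrder InnerProductSpace ComplexStarModule
open scoped TensorProduct Topology Kronecker Matrix
open Filter

section ph
variable {B : Type} [NonUnitalCStarAlgebra B]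
variable {K : Type} [NormedAddCommGroup K] [InnerProductSpace ℂ K] [CompleteSpace K] {ι : Type}

/-- compression to a finite set of basis vectors -/
def ph (σ : B →⋆ₙₐ[ℂ] (K →L[ℂ] K)) (e : HilbertBasis ι ℂ K) (S : Finset ι) : B →ₗ[ℂ] Matrix S S ℂ where
  toFun b := Matrix.of fun i k : S => ⟪e i, σ b (e k)⟫_ℂ
  map_add' b c := by ext i k; simp [inner_add_right]
  map_smul' b c := by ext i k; simp [inner_smul_right]

variable (σ : B →⋆ₙₐ[ℂ] (K →L[ℂ] K)) (e : HilbertBasis ι ℂ K) (S : Finset ι)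

lemma ph_apply (b : B) (i k : S) : ph σ e S b i k = ⟪e i, σ b (e k)⟫_ℂ := rfl

lemma ph_star (b : B) : ph σ e S (star b) = (ph σ e S b)ᴴ := by
  ext i k
  rw [Matrix.conjTranspose_apply, ph_apply, ph_apply, map_star, ContinuousLinearMap.star_eq_adjoint, ContinuousLinearMap.adjoint_inner_right,
    ← inner_conj_symm]
  rfl

lemma ph_herm (b : B) (hb : IsSelfAdjoint b) : (ph σ e S b).IsHermitian := by
  rw [Matrix.IsHermitian, ← ph_star, hb.star_eq]

lemma ph_form (b : B) (w : S → ℂ) : ∑ x, ∑ y, star (w x) * w y * ph σ e S b x y = ⟪∑ x, w x • e x, σ b (∑ x, w x • e x)⟫_ℂ := by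
  simp only [map_sum, map_smul, sum_inner, inner_sum, inner_smul_left, inner_smul_right, ph_apply]
  rw [Finset.sum_comm]
  refine Finset.sum_congr rfl fun x _ => ?_
  rw [Finset.mul_sum]
  refine Finset.sum_congr rfl fun y _ => ?_
  simp only [Complex.star_def]; ring

lemma ph_vec (w : S → ℂ) : ((‖∑ x, w x • e (x : ι)‖ ^ 2 : ℝ) : ℂ) = ∑ x, star (w x) * w x := by
  classical
  have h1 := e.orthonormal.comp (fun x : S => (x : ι)) Subtype.val_injective
  have h2 := inner_self_eq_norm_sq_to_K (𝕜 := ℂ) (∑ x, w x • e (x : ι))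
  have h3 := h1.inner_sum w w Finset.univ
  simp only [Function.comp] at h3
  rw [h3] at h2
  simp only [Complex.star_def]
  rw [h2]; simp

lemma ph_sub_psd [DecidableEq ι] (b : B) (hb : IsSelfAdjoint b) (r : ℝ) (hr : ‖b‖ ≤ r) : ((r : ℂ) • 1 - ph σ e S b).PosSemidef := by
  refine psd_of_form _ fun w => ?_
  have h0 : ∑ x, ∑ y, star (w x) * w y * ((r : ℂ) • 1 - ph σ e S b) x y 
     = (r : ℂ) * ∑ x, star (w x) * w x - ⟪∑ x, w x • e (x : ι), σ b (∑ x, w x • e (x:ι))⟫_ℂ := by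
    rw [← ph_form, Finset.mul_sum, ← Finset.sum_sub_distrib]
    refine Finset.sum_congr rfl fun x _ => ?_
    simp only [Matrix.sub_apply, Matrix.smul_apply, mul_sub, Finset.sum_sub_distrib, Matrix.one_apply, smul_eq_mul]
    simp; ring
  rw [h0, ← ph_vec e S w]
  set ξ := ∑ x, w x • e (x : ι)
  have h1 : (⟪ξ, σ b ξ⟫_ℂ).im = 0 := by
    have : star (⟪ξ, σ b ξ⟫_ℂ) = ⟪ξ, σ b ξ⟫_ℂ := by
      rw [Complex.star_def, inner_conj_symm]
      have h : ContinuousLinearMap.adjoint (σ b) = σ b := by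
        rw [← ContinuousLinearMap.star_eq_adjoint, ← map_star, hb.star_eq]
      conv_lhs => rw [← h]
      exact ContinuousLinearMap.adjoint_inner_left (σ b) ξ ξ
    rwa [Complex.star_def, Complex.conj_eq_iff_im] at this
  have h2 : (⟪ξ, σ b ξ⟫_ℂ).re ≤ r * ‖ξ‖ ^ 2 := by
    calc _ ≤ ‖⟪ξ, σ b ξ⟫_ℂ‖ := Complex.re_le_norm _
      _ ≤ ‖ξ‖ * ‖σ b ξ‖ := norm_inner_le_norm _ _
      _ ≤ ‖ξ‖ * (‖σ b‖ * ‖ξ‖) := by gcongr; exact (σ b).le_opNorm ξ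
      _ ≤ ‖ξ‖ * (r * ‖ξ‖) := by gcongr; exact (nush_norm_le σ b).trans hr
      _ = _ := by ring
  rw [Complex.le_def]
  constructor
  · rw [Complex.sub_re, ← Complex.ofReal_mul, Complex.ofReal_re]; simpa using h2
  · rw [Complex.sub_im, ← Complex.ofReal_mul, Complex.ofReal_im, h1]; simp

lemma ph_schwarz [DecidableEq ι] (b : B) : (ph σ e S (star b * b) - (ph σ e S b)ᴴ * ph σ e S b).PosSemidef := by
  refine psd_of_form _ fun w => ?_
  set ξ := ∑ x, w x • e (x : ι) with hξ
  have h1 : ∑ x, ∑ y, star (w x) * w y * ((ph σ e S b)ᴴ * ph σ e S b) x y = ∑ i : S, ((‖⟪e (i:ι), σ b ξ⟫_ℂ‖ ^ 2 : ℝ) : ℂ) := by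
    have h2 : ∀ i : S, ⟪e (i:ι), σ b ξ⟫_ℂ = ∑ y, w y * ph σ e S b i y := by
      intro i
      simp only [hξ, map_sum, map_smul, inner_sum, inner_smul_right, ph_apply]
    have h3 : ∀ i : S, ((‖⟪e (i:ι), σ b ξ⟫_ℂ‖ ^ 2 : ℝ) : ℂ) = ∑ x, ∑ y, star (w x) * w y * (star (ph σ e S b i x) * ph σ e S b i y) := by
      intro i
      rw [Complex.ofReal_pow, ← Complex.conj_mul', h2, map_sum, Finset.sum_mul_sum]
      refine Finset.sum_congr rfl fun x _ => Finset.sum_congr rfl fun y _ => ?_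
      simp only [map_mul, Complex.star_def]; ring
    simp only [h3, Matrix.mul_apply, Matrix.conjTranspose_apply, Finset.mul_sum]
    conv_lhs => enter [2, x]; rw [Finset.sum_comm]
    rw [Finset.sum_comm]
  have h4 : ∑ x, ∑ y, star (w x) * w y * ph σ e S (star b * b) x y = ((‖σ b ξ‖ ^ 2 : ℝ) : ℂ) := by
    rw [ph_form, map_mul, map_star]
    change ⟪ξ, star (σ b) (σ b ξ)⟫_ℂ = _
    rw [ContinuousLinearMap.star_eq_adjoint, ContinuousLinearMap.adjoint_inner_right, inner_self_eq_norm_sq_to_K]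
    simp
  simp only [Matrix.sub_apply, mul_sub, Finset.sum_sub_distrib]
  rw [h1, h4, ← Complex.ofReal_sum, ← Complex.ofReal_sub]
  have h5 := (e.orthonormal.comp (fun x : S => (x : ι)) Subtype.val_injective).sum_inner_products_le (s := Finset.univ) (σ b ξ)
  simp only [Function.comp] at h5
  exact_mod_cast sub_nonneg.2 h5

lemma ph_cpf : CPf (fun k l : S => vf σ (e k) (e l)) := by
  intro c
  have h : ∑ i : S, ∑ j : S, vf σ (e i) (e j) (star (c i) * c j) = ((‖∑ j : S, σ (c j) (e j)‖ ^ 2 : ℝ) : ℂ) := by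
    have := inner_self_eq_norm_sq_to_K (𝕜 := ℂ) (∑ j : S, σ (c j) (e (j:ι)))
    rw [Complex.ofReal_pow]
    refine Eq.trans ?_ this
    rw [sum_inner]
    refine Finset.sum_congr rfl fun i _ => ?_
    rw [inner_sum]
    refine Finset.sum_congr rfl fun j _ => ?_
    rw [vf_apply, map_mul, map_star]
    change ⟪e (i:ι), star (σ (c i)) (σ (c j) _)⟫_ℂ = _
    rw [ContinuousLinearMap.star_eq_adjoint, ContinuousLinearMap.adjoint_inner_right]
  rw [h]
  exact_mod_cast sq_nonneg (‖∑ j : S, σ (c j) (e j)‖ : ℝ)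

lemma vf_ph (b : B) (k l : S) : vf σ (e k) (e l) b = ph σ e S b k l := rfl

/-- Schur product positivity for sums -/
lemma hadamard_sum {n : Type} [Fintype n] [DecidableEq n] {M N : Matrix n n ℂ} (hM : M.PosSemidef) (hN : N.PosSemidef) :
    0 ≤ ∑ i, ∑ j, M i j * N i j := by
  have h := form_of_psd (hM.hadamard hN) (fun _ => 1)
  simpa using h
end ph
end FM

namespace FM
set_option linter.all false
set_option linter.style.haveILetI false
set_option linter.unnecessarySimpa false
open scoped ComplexOrder InnerProductSpace ComplexStarModule
open scoped TensorProduct Topology Kronecker Matrix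
open Filter

section kr
lemma qsp_le {A : Type} [CStarAlgebra A] (a : A) (ha : IsSelfAdjoint a) (r : ℝ) (hr : 0 ≤ r) (x : A)
    (hx : (r : ℂ) • 1 - a = star x * x) : ∀ t ∈ quasispectrum ℝ a, t ≤ r := by
  letI := CStarAlgebra.spectralOrder A
  haveI := CStarAlgebra.spectralOrderedRing A
  have h1 : a ≤ algebraMap ℝ A r := by
    rw [← sub_nonneg, Algebra.algebraMap_eq_smul_one]
    have : (r : ℝ) • (1:A) = (r:ℂ) • 1 := (Complex.coe_smul r (1:A)).symm
    rw [this, hx]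
    exact star_mul_self_nonneg x
  rw [le_algebraMap_iff_spectrum_le] at h1
  intro t ht
  rw [quasispectrum_eq_spectrum_union_zero] at ht
  rcases ht with ht | ht
  · exact h1 t ht
  · rw [Set.mem_singleton_iff.1 ht]; exact hr

lemma norm_le_of_sq {A : Type} [CStarAlgebra A] (a : A) (ha : IsSelfAdjoint a) (r : ℝ) (hr : 0 ≤ r) (x y : A)
    (hx : (r : ℂ) • 1 - a = star x * x) (hy : (r : ℂ) • 1 + a = star y * y) : ‖a‖ ≤ r := by
  refine norm_le_of_pp a ha r hr ?_ ?_
  · exact (norm_posPart_le_iff a ha r hr).2 (qsp_le a ha r hr x hx)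
  · exact (norm_posPart_le_iff (-a) ha.neg r hr).2 (qsp_le (-a) ha.neg r hr y (by rw [sub_neg_eq_add, hy]))

open scoped Matrix.Norms.L2Operator in
lemma matrix_norm_le {n : Type} [Fintype n] [DecidableEq n] (a : Matrix n n ℂ) (ha : a.IsHermitian) (r : ℝ) (hr : 0 ≤ r)
    (h1 : ((r:ℂ) • 1 - a).PosSemidef) (h2 : ((r:ℂ) • 1 + a).PosSemidef) : ‖a‖ ≤ r := by
  obtain ⟨x, hx⟩ := psd_factor h1
  obtain ⟨y, hy⟩ := psd_factor h2
  exact norm_le_of_sq a ha r hr x y hx hy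

variable {B : Type} [NonUnitalCStarAlgebra B]
variable {K : Type} [NormedAddCommGroup K] [InnerProductSpace ℂ K] [CompleteSpace K] {ι : Type}

/-- functional a ↦ (Lᴴ a L)_kl -/
def Lf {n : Type} [Fintype n] (L : Matrix n n ℂ) (k l : n) : Matrix n n ℂ →ₗ[ℂ] ℂ where
  toFun a := (Lᴴ * a * L) k l
  map_add' a b := by simp [Matrix.mul_add, Matrix.add_mul]
  map_smul' c b := by simp

open scoped Matrix.Norms.L2Operator in
lemma Lf_cpf {n : Type} [Fintype n] [DecidableEq n] (L : Matrix n n ℂ) : CPf (fun k l => Lf L k l) := by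
  intro c
  have h : ∑ i, ∑ j, Lf L i j (star (c i) * c j) = ∑ p, ((‖∑ k, (c k * L) p k‖ ^ 2 : ℝ) : ℂ) := by
    have h1 : ∀ i j, Lf L i j (star (c i) * c j) = ∑ p, star ((c i * L) p i) * (c j * L) p j := by
      intro i j
      change (Lᴴ * ((c i)ᴴ * c j) * L) i j = _
      rw [show Lᴴ * ((c i)ᴴ * c j) * L = (c i * L)ᴴ * (c j * L) by rw [Matrix.conjTranspose_mul]; simp only [Matrix.mul_assoc],
        Matrix.mul_apply]
      rfl
    simp only [h1]
    conv_lhs => enter [2, i]; rw [Finset.sum_comm]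
    rw [Finset.sum_comm]
    refine Finset.sum_congr rfl fun p _ => ?_
    rw [Complex.ofReal_pow, ← Complex.conj_mul', map_sum, Finset.sum_mul_sum]
    rfl
  rw [h]
  exact Finset.sum_nonneg fun p _ => by exact_mod_cast sq_nonneg (‖∑ k, (c k * L) p k‖ : ℝ)

open scoped Matrix.Norms.L2Operator in
lemma kraus_H [DecidableEq ι] 
    (σ : B →⋆ₙₐ[ℂ] (K →L[ℂ] K)) (e : HilbertBasis ι ℂ K) 
    {J : Type} [Fintype J] (b : J → B) (R κ : ℝ) (hR : 0 ≤ R) (S : Finset ι)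
    (hS : ∀ (A' : Type) (_ : CStarAlgebra A') (T' : Type) (_ : NonUnitalCStarAlgebra T')
      (d : MinTensorData A' B T') (a : J → A') (_ : ∀ j, IsSelfAdjoint (a j)) (_ : ∀ j, ‖a j‖ ≤ R)
      (r : S → S → A') (_ : ∀ i k : S, (if i = k then 1 else 0) - ∑ j, ⟪e i, σ (b j) (e k)⟫_ℂ • a j = ∑ l, star (r l i) * r l k)
      (F : T' →ₗ[ℂ] ℂ) (_ : QState F), (F (∑ j, d.tmul (a j) (b j))).re ≤ 1 + κ)
    (S' : Finset ι) (hne : Nonempty S') (h : Matrix S' S' ℂ) (m : J → Matrix S' S' ℂ) (hm : ∀ j, (m j).IsHermitian)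
    (hpd : h.PosDef)
    (hpm : ∀ j, ((R:ℂ) • h - m j).PosSemidef ∧ ((R:ℂ) • h + m j).PosSemidef)
    (hb : (h ⊗ₖ (1 : Matrix S S ℂ) - ∑ j, m j ⊗ₖ ph σ e S (b j)).PosSemidef) :
    (∑ j, ∑ k, ∑ l, m j k l * ph σ e S' (b j) k l).re ≤ (1 + κ) * h.trace.re := by
  obtain ⟨L, hL⟩ := psd_factor hpd.posSemidef
  have hLu : IsUnit L := by
    have h1 := hpd.isUnit
    rw [hL, Matrix.isUnit_iff_isUnit_det, Matrix.det_mul] at h1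
    rw [Matrix.isUnit_iff_isUnit_det]
    exact isUnit_of_mul_isUnit_right h1
  have hdet := (Matrix.isUnit_iff_isUnit_det _).1 hLu
  have i1 : L * L⁻¹ = 1 := Matrix.mul_nonsing_inv _ hdet
  have i2 : L⁻¹ * L = 1 := Matrix.nonsing_inv_mul _ hdet
  set V := L⁻¹ with hV
  have i3 : Vᴴ * Lᴴ = 1 := by rw [← Matrix.conjTranspose_mul, i1, Matrix.conjTranspose_one]
  have i4 : Lᴴ * Vᴴ = 1 := by rw [← Matrix.conjTranspose_mul, i2, Matrix.conjTranspose_one]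
  have hh1 : Vᴴ * h * V = 1 := by
    rw [hL, ← Matrix.mul_assoc, i3, Matrix.one_mul, i1]
  let a : J → Matrix S' S' ℂ := fun j => Vᴴ * m j * V
  have ha : ∀ j, (a j).IsHermitian := fun j => Matrix.isHermitian_conjTranspose_mul_mul _ (hm j)
  have hLa : ∀ j, Lᴴ * a j * L = m j := by
    intro j
    change Lᴴ * (Vᴴ * m j * V) * L = _
    rw [show Lᴴ * (Vᴴ * m j * V) * L = (Lᴴ * Vᴴ) * m j * (V * L) by simp only [Matrix.mul_assoc], i4, i2, Matrix.one_mul, Matrix.mul_one]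
  have hn : ∀ j, ‖a j‖ ≤ R := by
    intro j
    refine matrix_norm_le (a j) (ha j) R hR ?_ ?_
    · have := (hpm j).1.conjTranspose_mul_mul_same V
      rwa [Matrix.mul_sub, Matrix.sub_mul, Matrix.mul_smul, Matrix.smul_mul, hh1] at this
    · have := (hpm j).2.conjTranspose_mul_mul_same V
      rwa [Matrix.mul_add, Matrix.add_mul, Matrix.mul_smul, Matrix.smul_mul, hh1] at this
  obtain ⟨M, hM⟩ := psd_factor hb
  let r : S → S → Matrix S' S' ℂ := fun l i => (Matrix.of fun p q => M (p, l) (q, i)) * V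
  have hr : ∀ i k : S, (if i = k then 1 else 0) - ∑ j, ⟪e i, σ (b j) (e k)⟫_ℂ • a j = ∑ l, star (r l i) * r l k := by
    intro i k
    have h1 : (if i = k then h else 0) - ∑ j, ph σ e S (b j) i k • m j = ∑ l, (Matrix.of fun p q => M (p, l) (q, i))ᴴ * (Matrix.of fun p q => M (p, l) (q, k)) := by
      ext p q
      have h2 := congrFun (congrFun hM (p, i)) (q, k)
      rw [Matrix.mul_apply, Fintype.sum_prod_type, Finset.sum_comm] at h2
      rw [Matrix.sum_apply]
      simp only [Matrix.mul_apply, Matrix.conjTranspose_apply, Matrix.of_apply] at h2 ⊢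
      rw [← h2]
      simp only [Matrix.sub_apply, Matrix.sum_apply, Matrix.kroneckerMap_apply, Matrix.smul_apply, smul_eq_mul]
      congr 1
      · by_cases hik : i = k
        · subst hik; simp [Matrix.one_apply]
        · simp [hik, Matrix.one_apply]
      · exact Finset.sum_congr rfl fun j _ => mul_comm _ _
    have h3 := congrArg (fun N => Vᴴ * N * V) h1
    simp only [Matrix.mul_sub, Matrix.sub_mul, Matrix.mul_sum, Matrix.sum_mul] at h3
    convert h3 using 1
    · congr 1
      · by_cases hik : i = k <;> simp [hik, hh1]
      · refine Finset.sum_congr rfl fun j _ => ?_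
        rw [Matrix.mul_smul, Matrix.smul_mul]; rfl
    · refine Finset.sum_congr rfl fun l _ => ?_
      change (_ * _)ᴴ * (_ * _) = _
      rw [Matrix.conjTranspose_mul]
      simp only [Matrix.mul_assoc]
  obtain ⟨T', iT, ⟨d⟩⟩ := exists_min' (Matrix S' S' ℂ) B
  have htr : h.trace = ((h.trace.re : ℝ) : ℂ) := by
    have := hpd.trace_pos
    apply Complex.ext
    · simp
    · simpa using (Complex.lt_def.1 this).2.symm
  have htp : 0 < h.trace.re := (Complex.lt_def.1 hpd.trace_pos).1
  obtain ⟨Φ, hΦ, hpos, hnorm⟩ := (Lf_cpf L).prod_ext d.toTensorData (ph_cpf σ e S') h.trace.re (by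
    intro c hc
    have hp := hadamard_sum hpd.posSemidef (ph_sub_psd σ e S' (star c * c) (IsSelfAdjoint.star_mul_self c) 1 (by
      rw [CStarRing.norm_star_mul_self]; nlinarith [norm_nonneg c]))
    have h1 : ∑ i, ∑ j, h i j * (((1:ℝ):ℂ) • (1 : Matrix S' S' ℂ) - ph σ e S' (star c * c)) i j = h.trace - ∑ i, ∑ j, Lf L i j 1 * vf σ (e i) (e j) (star c * c) := by
      rw [Matrix.trace, ← Finset.sum_sub_distrib]
      refine Finset.sum_congr rfl fun i _ => ?_
      simp only [Matrix.sub_apply, mul_sub, Finset.sum_sub_distrib]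
      congr 1
      · simp [Matrix.one_apply]
      · refine Finset.sum_congr rfl fun j _ => ?_
        rw [vf_ph]
        congr 1
        change _ = (Lᴴ * (1 : Matrix S' S' ℂ) * L) i j
        rw [Matrix.mul_one, ← hL]
    rw [h1] at hp
    have := (Complex.le_def.1 hp).1
    simpa using this)
  have hF := hS _ Matrix.instCStarAlgebra T' iT d a ha hn r hr (((h.trace.re : ℂ))⁻¹ • (Φ : T' →ₗ[ℂ] ℂ)) ⟨fun x => by
      have h1 := hpos x
      have h2 : (0:ℂ) ≤ ((h.trace.re : ℂ))⁻¹ := by rw [← Complex.ofReal_inv]; exact_mod_cast (inv_pos.2 htp).le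
      exact mul_nonneg h2 h1, fun x => by
      have h1 := Φ.le_opNorm x
      change ‖((h.trace.re : ℂ))⁻¹ * Φ x‖ ≤ _
      rw [norm_mul, norm_inv, Complex.norm_real, Real.norm_of_nonneg htp.le, inv_mul_le_iff₀ htp]
      exact h1.trans (by gcongr)⟩
  have hv : Φ (∑ j, d.tmul (a j) (b j)) = ∑ j, ∑ k, ∑ l, m j k l * ph σ e S' (b j) k l := by
    rw [map_sum]
    refine Finset.sum_congr rfl fun j _ => ?_
    rw [← TJ_tmul, hΦ, prodF_tmul]
    refine Finset.sum_congr rfl fun k _ => Finset.sum_congr rfl fun l _ => ?_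
    rw [vf_ph]
    congr 1
    change (Lᴴ * a j * L) k l = _
    rw [hLa]
  change (((h.trace.re : ℂ))⁻¹ * Φ (∑ j, d.tmul (a j) (b j))).re ≤ _ at hF
  rw [hv, ← Complex.ofReal_inv, Complex.re_ofReal_mul, inv_mul_le_iff₀ htp] at hF
  linarith
end kr
end FM

namespace FM
set_option linter.all false
set_option linter.style.haveILetI false
set_option linter.unnecessarySimpa false
open scoped ComplexOrder InnerProductSpace ComplexStarModule
open scoped TensorProduct Topology Kronecker Matrix
open Filter

section ka
/-- Kraus map -/
def kr {τ m n : Type} [Fintype τ] [Fintype m] (K : τ → Matrix m n ℂ) : Matrix m m ℂ →ₗ[ℂ] Matrix n n ℂ where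
  toFun x := ∑ t, (K t)ᴴ * x * K t
  map_add' x y := by simp only [Matrix.mul_add, Matrix.add_mul, Finset.sum_add_distrib]
  map_smul' c x := by simp only [Matrix.mul_smul, Matrix.smul_mul, Finset.smul_sum, RingHom.id_apply]

lemma kr_apply {τ m n : Type} [Fintype τ] [Fintype m] (K : τ → Matrix m n ℂ) (x) : kr K x = ∑ t, (K t)ᴴ * x * K t := rfl

lemma psd_sum {n s : Type} [Fintype n] [DecidableEq n] (S : Finset s) (M : s → Matrix n n ℂ) (h : ∀ i ∈ S, (M i).PosSemidef) :
    (∑ i ∈ S, M i).PosSemidef := Matrix.posSemidef_sum S h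

lemma kr_psd {τ m n : Type} [Fintype τ] [Fintype m] [Fintype n] [DecidableEq n] [DecidableEq m] (K : τ → Matrix m n ℂ) (x) (hx : x.PosSemidef) : (kr K x).PosSemidef :=
  psd_sum _ _ fun t _ => hx.conjTranspose_mul_mul_same (K t)

variable {B : Type} [NonUnitalCStarAlgebra B]
variable {K : Type} [NormedAddCommGroup K] [InnerProductSpace ℂ K] [CompleteSpace K] {ι : Type}

open scoped Matrix.Norms.L2Operator in
lemma ph_norm_sa [DecidableEq ι] (σ : B →⋆ₙₐ[ℂ] (K →L[ℂ] K)) (e : HilbertBasis ι ℂ K) (S : Finset ι) (b : B) (hb : IsSelfAdjoint b) :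
    ‖ph σ e S b‖ ≤ ‖b‖ := by
  refine matrix_norm_le _ (ph_herm σ e S b hb) _ (norm_nonneg b) (ph_sub_psd σ e S b hb _ le_rfl) ?_
  have := ph_sub_psd σ e S (-b) hb.neg ‖b‖ (by rw [norm_neg])
  rwa [map_neg, sub_neg_eq_add] at this

lemma blk_psd {P Q J : Type} [Fintype P] [Fintype Q] [DecidableEq P] [DecidableEq Q] [Fintype J] [DecidableEq J] (η : ℝ)
    (x : J → Matrix Q Q ℂ) (h : Matrix P P ℂ) (m : J → Matrix P P ℂ)
    (H : (h ⊗ₖ (1 : Matrix (Q ⊕ J × Bool) (Q ⊕ J × Bool) ℂ) - ∑ j, m j ⊗ₖ (Matrix.fromBlocks (x j) 0 0 (Matrix.diagonal fun i : J × Bool => if i.1 = j then (if i.2 then (η:ℂ) else -η) else 0))).PosSemidef) :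
    (h ⊗ₖ (1 : Matrix Q Q ℂ) - ∑ j, m j ⊗ₖ x j).PosSemidef ∧ ∀ j, (h - (η:ℂ) • m j).PosSemidef ∧ (h + (η:ℂ) • m j).PosSemidef := by
  refine ⟨?_, fun j => ⟨?_, ?_⟩⟩
  · have := H.submatrix (fun p : P × Q => (p.1, (Sum.inl p.2 : Q ⊕ J × Bool)))
    convert this using 1
    ext p q
    simp [Matrix.sub_apply, Matrix.sum_apply, Matrix.kroneckerMap_apply, Matrix.one_apply]
  · have := H.submatrix (fun p : P => (p, (Sum.inr (j, true) : Q ⊕ J × Bool)))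
    convert this using 1
    ext p q
    simp [Matrix.sub_apply, Matrix.sum_apply, Matrix.kroneckerMap_apply, Matrix.one_apply, mul_comm]
  · have := H.submatrix (fun p : P => (p, (Sum.inr (j, false) : Q ⊕ J × Bool)))
    convert this using 1
    ext p q
    simp [Matrix.sub_apply, Matrix.sum_apply, Matrix.kroneckerMap_apply, Matrix.one_apply, mul_comm]

open scoped Matrix.Norms.L2Operator in
theorem kraus_approx (hB : IsExactCStar B) [DecidableEq ι]
    (σ : B →⋆ₙₐ[ℂ] (K →L[ℂ] K)) (hσ : Injective σ) (e : HilbertBasis ι ℂ K) 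
    {J : Type} [Fintype J] [DecidableEq J] [Nonempty J] (b : J → B) (hb : ∀ j, IsSelfAdjoint (b j)) (ε : ℝ) (hε : 0 < ε) :
    ∃ S : Finset ι, ∀ S' : Finset ι, ∃ (τ : Type) (_ : Fintype τ) (V : τ → Matrix S S' ℂ),
      (1 - kr V 1).PosSemidef ∧ ∀ j, ‖kr V (ph σ e S (b j)) - ph σ e S' (b j)‖ ≤ ε := by
  set M := 1 + ∑ j, ‖b j‖ with hM
  have hM1 : 1 ≤ M := by
    have : 0 ≤ ∑ j, ‖b j‖ := Finset.sum_nonneg fun j _ => norm_nonneg _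
    linarith
  have hMb : ∀ j, ‖b j‖ ≤ M := fun j => by
    have := Finset.single_le_sum (f := fun j => ‖b j‖) (fun j _ => norm_nonneg _) (Finset.mem_univ j)
    linarith
  set η := ε / 2 with hη
  have hη0 : 0 < η := by positivity
  set κ := ε / (2 * M) with hκ
  have hκ0 : 0 < κ := by positivity
  obtain ⟨S, hS⟩ := E_lemma hB σ hσ e b hb (1 / η) κ hκ0
  refine ⟨S, fun S' => ?_⟩
  have hY : ∀ j, (Matrix.diagonal fun i : J × Bool => if i.1 = j then (if i.2 then (η:ℂ) else -η) else 0).IsHermitian := by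
    intro j
    refine Matrix.isHermitian_diagonal_iff.2 fun i => ?_
    rw [IsSelfAdjoint]
    split_ifs <;> simp
  obtain ⟨V, hV1, hV2⟩ := kraus_dual (P := S') (Q := S ⊕ J × Bool) (fun j => Matrix.fromBlocks (ph σ e S (b j)) 0 0 (Matrix.diagonal fun i : J × Bool => if i.1 = j then (if i.2 then (η:ℂ) else -η) else 0))
    (fun j => Matrix.IsHermitian.fromBlocks (ph_herm σ e S _ (hb j)) (by simp) (hY j)) (fun j => ph σ e S' (b j)) (fun j => ph_herm σ e S' _ (hb j)) (1 + κ) (by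
      intro h m hh hm hpsd
      obtain ⟨h1, h2⟩ := blk_psd η _ h m hpsd
      by_cases hne : Nonempty S'
      · have h3 : h.PosSemidef := by
          obtain ⟨j⟩ := ‹Nonempty J›
          have := ((h2 j).1.add (h2 j).2).smul (show (0:ℝ) ≤ 1/2 by norm_num)
          convert this using 1
          ext p q
          simp; ring
        have h4 : ∀ t : ℝ, 0 < t → (∑ j, ∑ k, ∑ l, m j k l * ph σ e S' (b j) k l).re ≤ (1 + κ) * h.trace.re + t * ((1 + κ) * Fintype.card S') := by
          intro t ht
          have ht1 : ((t:ℝ) • (1 : Matrix S' S' ℂ)).PosDef := Matrix.PosDef.one.smul ht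
          have h5 := kraus_H σ e b (1 / η) κ (by positivity) S hS S' hne (h + (t:ℝ) • 1) m hm (Matrix.PosDef.posSemidef_add h3 ht1)
            (fun j => ?_) ?_
          · refine h5.trans (le_of_eq ?_)
            simp [Matrix.trace_add, Matrix.trace_smul]; ring
          · have e1 : ∀ x : Matrix S' S' ℂ, (((1/η:ℝ):ℂ)) • (h + (t:ℝ) • 1 + (η:ℂ) • x) = (((1/η:ℝ):ℂ)) • (h + (t:ℝ) • 1) + x := by
              intro x
              rw [smul_add _ (_ + _), smul_smul, ← Complex.ofReal_mul, one_div_mul_cancel hη0.ne']; simp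
            have e2 : ∀ x : Matrix S' S' ℂ, (h + (η:ℂ) • x).PosSemidef → ((((1/η:ℝ):ℂ)) • (h + (t:ℝ) • 1) + x).PosSemidef := by
              intro x hx
              rw [← e1]
              have := (hx.add ht1.posSemidef).smul (show (0:ℝ) ≤ 1/η by positivity)
              convert this using 1
              ext p q
              simp only [Matrix.smul_apply, Matrix.add_apply, smul_eq_mul, Complex.real_smul]; ring
            constructor
            · rw [sub_eq_add_neg]
              exact e2 _ (by rw [smul_neg, ← sub_eq_add_neg]; exact (h2 j).1)
            · exact e2 _ (h2 j).2
          · rw [Matrix.add_kronecker, add_sub_right_comm]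
            refine h1.add (ht1.posSemidef.kronecker Matrix.PosSemidef.one)
        refine le_of_forall_pos_le_add fun δ hδ => ?_
        have hc : 0 < (1 + κ) * Fintype.card S' := by
          have : 0 < Fintype.card S' := Fintype.card_pos
          positivity
        have := h4 (δ / ((1 + κ) * Fintype.card S')) (by positivity)
        rwa [div_mul_cancel₀ _ hc.ne'] at this
      · haveI : IsEmpty S' := not_nonempty_iff.1 hne
        simp [Matrix.trace])
  have hc0 : (0:ℝ) < 1 + κ := by positivity
  set s : ℝ := Real.sqrt (1 / (1 + κ)) with hs
  have hss : ((s:ℂ) * s) = ((1 / (1 + κ) : ℝ) : ℂ) := by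
    rw [← Complex.ofReal_mul, Real.mul_self_sqrt (by positivity)]
  let V1 : S' × (S ⊕ J × Bool) → Matrix S S' ℂ := fun t => (V t).submatrix Sum.inl id
  let V2 : S' × (S ⊕ J × Bool) → Matrix (J × Bool) S' ℂ := fun t => (V t).submatrix Sum.inr id
  have hsplit : ∀ (x : Matrix S S ℂ) (y : Matrix (J × Bool) (J × Bool) ℂ), ∑ t, (V t)ᴴ * Matrix.fromBlocks x 0 0 y * V t = kr V1 x + kr V2 y := by
    intro x y
    rw [kr_apply, kr_apply, ← Finset.sum_add_distrib]
    refine Finset.sum_congr rfl fun t _ => ?_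
    ext p q
    simp [Matrix.mul_apply, Matrix.add_apply, Fintype.sum_sum_type, V1, V2]
  have h1 : kr V1 1 + kr V2 1 = ((1 + κ : ℝ) : ℂ) • 1 := by
    rw [← hsplit, Matrix.fromBlocks_one, ← hV1]; simp
  have hk : ∀ x, kr (fun t => (s:ℂ) • V1 t) x = ((1 / (1 + κ) : ℝ) : ℂ) • kr V1 x := by
    intro x
    rw [kr_apply, kr_apply, Finset.smul_sum]
    refine Finset.sum_congr rfl fun t _ => ?_
    rw [Matrix.conjTranspose_smul, Matrix.smul_mul, Matrix.smul_mul, Matrix.mul_smul, smul_smul]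
    rw [← hss]; simp
  refine ⟨_, inferInstance, fun t => (s:ℂ) • V1 t, ?_, fun j => ?_⟩
  · rw [hk]
    have := (kr_psd V2 1 Matrix.PosSemidef.one).smul (show (0:ℝ) ≤ 1 / (1+κ) by positivity)
    convert this using 1
    rw [show kr V2 1 = ((1 + κ : ℝ) : ℂ) • 1 - kr V1 1 by rw [← h1]; abel, smul_sub, ← Complex.coe_smul, smul_smul, ← Complex.ofReal_mul,
      one_div_mul_cancel hc0.ne']
    simp
    ext p q
    simp
  · have h2 := hV2 j
    rw [hsplit] at h2
    rw [hk, ← h2]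
    set Y : Matrix (J × Bool) (J × Bool) ℂ := (Matrix.diagonal fun i : J × Bool => if i.1 = j then (if i.2 then (η:ℂ) else -η) else 0) with hYd
    have hb1 : ((η:ℂ) • 1 - Y).PosSemidef := by
      rw [hYd, ← Matrix.diagonal_one, ← Matrix.diagonal_smul, Matrix.diagonal_sub]
      refine Matrix.PosSemidef.diagonal fun i => ?_
      have : (0:ℂ) ≤ η := by exact_mod_cast hη0.le
      simp only [Pi.zero_apply, Pi.smul_apply, smul_eq_mul, mul_one]
      split_ifs
      · simp
      · rw [sub_neg_eq_add]; positivity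
      · simpa
    have hb2 : ((η:ℂ) • 1 + Y).PosSemidef := by
      rw [hYd, ← Matrix.diagonal_one, ← Matrix.diagonal_smul, Matrix.diagonal_add]
      refine Matrix.PosSemidef.diagonal fun i => ?_
      have : (0:ℂ) ≤ η := by exact_mod_cast hη0.le
      simp only [Pi.zero_apply, Pi.smul_apply, smul_eq_mul, mul_one]
      split_ifs
      · positivity
      · simp
      · simpa
    have hle : ((η * (1 + κ) : ℝ) : ℂ) • 1 = (η:ℂ) • kr V1 1 + kr V2 ((η:ℂ) • 1) := by
      rw [Complex.ofReal_mul, ← smul_smul, ← h1, map_smul, smul_add]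
    have hk1 : ((η:ℂ) • kr V1 1).PosSemidef := (kr_psd V1 1 Matrix.PosSemidef.one).smul (show (0:ℂ) ≤ η by exact_mod_cast hη0.le)
    have hn : ‖kr V2 Y‖ ≤ η * (1 + κ) := by
      refine matrix_norm_le _ ?_ _ (by positivity) ?_ ?_
      · rw [kr_apply, Matrix.IsHermitian, Matrix.conjTranspose_sum]
        exact Finset.sum_congr rfl fun t _ => Matrix.isHermitian_conjTranspose_mul_mul _ (hY j)
      · have := hk1.add (kr_psd V2 _ hb1)
        rw [map_sub] at this
        rw [hle, add_sub_assoc]; exact this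
      · have := hk1.add (kr_psd V2 _ hb2)
        rw [map_add] at this
        rw [hle, add_assoc]; exact this
    have hZ : ‖kr V1 (ph σ e S (b j)) + kr V2 Y‖ ≤ M := by
      rw [h2]; exact (ph_norm_sa σ e S' _ (hb j)).trans (hMb j)
    set g := kr V1 (ph σ e S (b j)) with hg
    set y := kr V2 Y with hy
    have e1 : ((1 / (1 + κ) : ℝ) : ℂ) • g - (g + y) = -(((κ / (1 + κ) : ℝ) : ℂ) • (g + y)) - ((1 / (1 + κ) : ℝ) : ℂ) • y := by
      have : ((1 / (1 + κ) : ℝ) : ℂ) = 1 - ((κ / (1 + κ) : ℝ) : ℂ) := by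
        rw [← Complex.ofReal_one, ← Complex.ofReal_sub]; congr 1; field_simp; ring
      rw [this]
      module
    rw [e1]
    refine (norm_sub_le _ _).trans ?_
    rw [norm_neg, norm_smul, norm_smul, Complex.norm_real, Complex.norm_real, Real.norm_of_nonneg (by positivity), Real.norm_of_nonneg (by positivity)]
    calc _ ≤ κ / (1 + κ) * M + 1 / (1 + κ) * (η * (1 + κ)) := by gcongr
      _ ≤ κ * M + η := by
        have : 1 / (1 + κ) * (η * (1 + κ)) = η := by field_simp
        rw [this]
        gcongr
        exact div_le_self hκ0.le (by linarith)
      _ = ε := by rw [hκ, hη]; field_simp; ring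
end ka
end FM

namespace FM
set_option linter.all false
set_option linter.style.haveILetI false
set_option linter.unnecessarySimpa false
open scoped ComplexOrder InnerProductSpace ComplexStarModule
open scoped TensorProduct Topology Kronecker Matrix
open Filter

section forms
structure PForm {V : Type} [AddCommGroup V] [Module ℂ V] (q : V → V → ℂ) : Prop where
  add : ∀ x y z, q (x + y) z = q x z + q y z
  smul : ∀ (c : ℂ) x z, q (c • x) z = c * q x z
  symm : ∀ x y, star (q x y) = q y x
  nonneg : ∀ x, 0 ≤ (q x x).re

variable {V : Type} [AddCommGroup V] [Module ℂ V] {q : V → V → ℂ}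

lemma PForm.add_r (h : PForm q) (x y z) : q x (y + z) = q x y + q x z := by
  rw [← h.symm, h.add, star_add, h.symm, h.symm]

lemma PForm.smul_r (h : PForm q) (c : ℂ) (x y) : q x (c • y) = star c * q x y := by
  rw [← h.symm, h.smul, star_mul', h.symm]

lemma PForm.cs (h : PForm q) (x y) : ‖q x y‖ ^ 2 ≤ (q x x).re * (q y y).re := by
  let c : PreInnerProductSpace.Core ℂ V := 
    { inner := fun x y => q y x
      conj_inner_symm := fun x y => h.symm x y
      re_inner_nonneg := fun x => h.nonneg x
      add_left := fun x y z => h.add_r z x y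
      smul_left := fun x y r => h.smul_r r y x }
  have := @InnerProductSpace.Core.inner_mul_inner_self_le ℂ V _ _ _ c x y
  have e1 : ‖q y x‖ = ‖q x y‖ := by rw [← h.symm x y, norm_star]
  change ‖q y x‖ * ‖q x y‖ ≤ (q x x).re * (q y y).re at this
  rw [e1] at this
  rw [sq]; exact this

/-- the iteration argument -/
lemma PForm.iter (h : PForm q) (T : V → V) (hT : ∀ u v, q (T u) v = q u (T v)) (x : V) (C : ℝ)
    (hC : ∀ k, ‖q (T^[k] x) x‖ ≤ C) : ‖q (T x) x‖ ≤ (q x x).re := by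
  have hit : ∀ k u v, q (T^[k] u) v = q u (T^[k] v) := by
    intro k
    induction k with
    | zero => intro u v; rfl
    | succ k ih => intro u v; rw [iterate_succ_apply, ih, hT, ← iterate_succ_apply' T k v]
  set s : ℕ → ℝ := fun k => (q (T^[k] x) (T^[k] x)).re with hs
  have hs0 : ∀ k, 0 ≤ s k := fun k => h.nonneg _
  have hs1 : ∀ k, s k = (q (T^[k+k] x) x).re := fun k => by
    change (q (T^[k] x) (T^[k] x)).re = _
    rw [← hit, ← iterate_add_apply]
  have hs2 : ∀ k, s k ^ 2 ≤ s (k + k) * s 0 := fun k => by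
    have := h.cs (T^[k+k] x) x
    have h2 : s k ^ 2 ≤ ‖q (T^[k+k] x) x‖ ^ 2 := by
      gcongr
      · exact hs0 k
      · rw [hs1]; exact Complex.re_le_norm _
    exact h2.trans this
  have hsC : ∀ k, s k ≤ C := fun k => by rw [hs1]; exact (Complex.re_le_norm _).trans (hC _)
  have key : s 1 ≤ s 0 := by
    rcases (hs0 0).eq_or_lt with h0 | h0
    · have := hs2 1
      rw [← h0, mul_zero] at this
      rw [← h0]
      nlinarith
    by_contra hlt
    push Not at hlt
    set r := s 1 / s 0 with hr
    have hr1 : 1 < r := (one_lt_div h0).2 hlt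
    have hp : ∀ k, s 0 * r ^ (2 ^ k) ≤ s (2 ^ k) := by
      intro k
      induction k with
      | zero => rw [hr]; simp; rw [mul_div_cancel₀ _ h0.ne']
      | succ k ih =>
        have h3 := hs2 (2 ^ k)
        rw [← two_mul, ← pow_succ'] at h3
        have h4 : (s 0 * r ^ 2 ^ k) ^ 2 ≤ s (2 ^ k) ^ 2 := by
          have : 0 < r := by linarith
          gcongr
        have h5 : (s 0 * r ^ 2 ^ (k+1)) * s 0 ≤ s (2 ^ (k+1)) * s 0 := by
          refine le_trans (le_of_eq ?_) (h4.trans h3)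
          rw [pow_succ 2 k, pow_mul]; ring
        exact le_of_mul_le_mul_right h5 h0
    have hb : ∀ k : ℕ, r ^ k ≤ C / s 0 := by
      intro k
      rw [le_div_iff₀ h0, mul_comm]
      refine le_trans ?_ ((hp k).trans (hsC _))
      gcongr
      · exact hr1.le
      · exact Nat.lt_two_pow_self.le
    obtain ⟨k, hk⟩ := pow_unbounded_of_one_lt (C / s 0) hr1
    exact absurd (hb k) (not_le.2 hk)
  have h6 := h.cs (T x) x
  have h7 : ‖q (T x) x‖ ^ 2 ≤ s 0 ^ 2 := by
    refine h6.trans ?_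
    change s 1 * s 0 ≤ _
    rw [sq]
    gcongr
    exact hs0 0
  exact abs_le_of_sq_le_sq' h7 (hs0 0) |>.2
end forms

section mats
variable {n : Type} [Fintype n] [DecidableEq n]

/-- the functional x ↦ Tr (x R) -/
def om (R : Matrix n n ℂ) : Matrix n n ℂ →ₗ[ℂ] ℂ where
  toFun x := (x * R).trace
  map_add' x y := by rw [Matrix.add_mul, Matrix.trace_add]
  map_smul' c x := by rw [Matrix.smul_mul, Matrix.trace_smul]; rfl

lemma om_apply (R x : Matrix n n ℂ) : om R x = (x * R).trace := rfl

def Gm (W x y : Matrix n n ℂ) : ℂ := (W * x * W * yᴴ).trace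

open scoped Matrix.Norms.L2Operator in
lemma om_pos {R : Matrix n n ℂ} (hR : R.PosSemidef) : IsPos (om R) := by
  intro x
  obtain ⟨L, hL⟩ := psd_factor hR
  rw [om_apply, hL]
  have : (star x * x * (Lᴴ * L)).trace = ((x * Lᴴ)ᴴ * (x * Lᴴ)).trace := by
    rw [Matrix.conjTranspose_mul, Matrix.conjTranspose_conjTranspose, ← Matrix.mul_assoc, Matrix.trace_mul_comm]
    congr 1
    simp only [Matrix.mul_assoc]; rfl
  rw [this]
  exact (Matrix.posSemidef_conjTranspose_mul_self _).trace_nonneg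

lemma om_psd {R : Matrix n n ℂ} (hR : R.PosSemidef) {x : Matrix n n ℂ} (hx : x.PosSemidef) : 0 ≤ (om R x).re := by
  obtain ⟨L, hL⟩ := psd_factor hx
  have := om_pos hR L
  rw [hL]
  exact (Complex.le_def.1 this).1

open scoped Matrix.Norms.L2Operator in
lemma om_norm {R : Matrix n n ℂ} (hR : R.PosSemidef) (hm : R.trace.re ≤ 1) (x) : ‖om R x‖ ≤ ‖x‖ := by
  have := (om_pos hR).norm_conj_le 1 x
  rw [star_one, one_mul, mul_one, one_mul, om_apply R 1, one_mul] at this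
  refine this.trans ?_
  nlinarith [norm_nonneg x]

open scoped Matrix.Norms.L2Operator in
lemma tr_cs (P Q : Matrix n n ℂ) : ‖(Pᴴ * Q).trace‖ ^ 2 ≤ (Pᴴ * P).trace.re * (Qᴴ * Q).trace.re := by
  have := (om_pos (Matrix.PosSemidef.one (n := n) (R := ℂ))).cs P Q
  simpa [om_apply, Matrix.star_eq_conjTranspose] using this

lemma Gm_cs {W : Matrix n n ℂ} (hW : W.IsHermitian) (x y : Matrix n n ℂ) :
    ‖Gm W x y‖ ^ 2 ≤ (om (W * W) (x * xᴴ)).re * (om (W * W) (yᴴ * y)).re := by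
  have := tr_cs (xᴴ * W) (W * yᴴ)
  have hW' : Wᴴ = W := hW
  simp only [Matrix.conjTranspose_mul, Matrix.conjTranspose_conjTranspose, hW'] at this
  rw [Gm, om_apply, om_apply]
  convert this using 2
  · simp only [Matrix.mul_assoc]
  · congr 1
    rw [← Matrix.mul_assoc, Matrix.trace_mul_comm]
    simp only [Matrix.mul_assoc]
  · congr 1
    rw [Matrix.mul_assoc, Matrix.trace_mul_comm]
    simp only [Matrix.mul_assoc]

open scoped Matrix.Norms.L2Operator in
lemma Gm_norm {W : Matrix n n ℂ} (hW : W.IsHermitian) (hm : (W * W).trace.re ≤ 1) (x y : Matrix n n ℂ) :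
    ‖Gm W x y‖ ≤ ‖x‖ * ‖y‖ := by
  have hR : (W * W).PosSemidef := by
    have := Matrix.posSemidef_conjTranspose_mul_self W
    rwa [show Wᴴ = W from hW] at this
  have h1 := Gm_cs hW x y
  have h2 : (om (W * W) (x * xᴴ)).re ≤ ‖x‖ ^ 2 := by
    refine (Complex.re_le_norm _).trans ((om_norm hR hm _).trans ?_)
    rw [sq]; exact (CStarRing.norm_self_mul_star (x := x)).le
  have h3 : (om (W * W) (yᴴ * y)).re ≤ ‖y‖ ^ 2 := by
    refine (Complex.re_le_norm _).trans ((om_norm hR hm _).trans ?_)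
    rw [sq]; exact (CStarRing.norm_star_mul_self (x := y)).le
  have h4 : ‖Gm W x y‖ ^ 2 ≤ (‖x‖ * ‖y‖) ^ 2 := by
    rw [mul_pow]
    refine h1.trans ?_
    gcongr
    exact om_psd hR (Matrix.posSemidef_conjTranspose_mul_self _)
  exact abs_le_of_sq_le_sq' h4 (by positivity) |>.2

lemma Gm_form {W : Matrix n n ℂ} (hW : W.PosSemidef) : PForm (Gm W) where
  add x y z := by simp only [Gm, Matrix.mul_add, Matrix.add_mul, Matrix.trace_add]
  smul c x z := by simp only [Gm, Matrix.mul_smul, Matrix.smul_mul, Matrix.trace_smul, smul_eq_mul]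
  symm x y := by
    have hW' : Wᴴ = W := hW.1
    simp only [Gm]
    rw [← Matrix.trace_conjTranspose]
    simp only [Matrix.conjTranspose_mul, hW', Matrix.conjTranspose_conjTranspose]
    rw [Matrix.trace_mul_comm]
    simp only [Matrix.mul_assoc]
    rw [Matrix.trace_mul_comm]
    simp only [Matrix.mul_assoc]
    rw [Matrix.trace_mul_comm]
    simp only [Matrix.mul_assoc]
  nonneg x := by
    obtain ⟨L, hL⟩ := psd_factor hW
    have : Gm W x x = ((L * x * Lᴴ)ᴴ * (L * x * Lᴴ)).trace := by
      rw [Gm, hL]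
      simp only [Matrix.conjTranspose_mul, Matrix.conjTranspose_conjTranspose]
      rw [Matrix.trace_mul_comm, show Lᴴ * L * x * (Lᴴ * L) = (Lᴴ * L * x * Lᴴ) * L by simp only [Matrix.mul_assoc], ← Matrix.mul_assoc,
        Matrix.trace_mul_comm]
      simp only [Matrix.mul_assoc]
    rw [this]
    exact (Complex.le_def.1 (Matrix.posSemidef_conjTranspose_mul_self _).trace_nonneg).1

/-- Pusz–Woronowicz maximality -/
lemma Gm_max {W : Matrix n n ℂ} (hW : W.PosDef) {q : Matrix n n ℂ → Matrix n n ℂ → ℂ} (hq : PForm q)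
    (hb : ∀ x y, ‖q x y‖ ^ 2 ≤ (om (W * W) (x * xᴴ)).re * (om (W * W) (yᴴ * y)).re) (x : Matrix n n ℂ) :
    (q x x).re ≤ (Gm W x x).re := by
  have hW' : Wᴴ = W := hW.1
  have hdet := (Matrix.isUnit_iff_isUnit_det _).1 hW.isUnit
  have i1 : W * W⁻¹ = 1 := Matrix.mul_nonsing_inv _ hdet
  have i2 : W⁻¹ * W = 1 := Matrix.nonsing_inv_mul _ hdet
  set Z := W⁻¹ with hZ
  have hZ' : Zᴴ = Z := by rw [hZ, Matrix.conjTranspose_nonsing_inv, hW']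
  have j1 : ∀ X : Matrix n n ℂ, W * (Z * X) = X := fun X => by rw [← Matrix.mul_assoc, i1, one_mul]
  have j2 : ∀ X : Matrix n n ℂ, Z * (W * X) = X := fun X => by rw [← Matrix.mul_assoc, i2, one_mul]
  have hG := Gm_form hW.posSemidef
  let M : Matrix n n ℂ → Matrix n n ℂ := fun x => Matrix.of fun k l => q x (Matrix.single k l 1)
  have hM : ∀ x y, (M x * yᴴ).trace = q x y := by
    intro x y
    have hy := Matrix.matrix_eq_sum_single y
    have hsum : ∀ (s : Finset n) (f : n → Matrix n n ℂ), q x (∑ i ∈ s, f i) = ∑ i ∈ s, q x (f i) := by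
      intro s f
      exact map_sum (AddMonoidHom.mk' (fun z => q x z) (fun a b => hq.add_r x a b)) f s
    conv_rhs => rw [hy, hsum]
    rw [Matrix.trace]
    refine Finset.sum_congr rfl fun k _ => ?_
    rw [hsum, Matrix.diag_apply, Matrix.mul_apply]
    refine Finset.sum_congr rfl fun l _ => ?_
    rw [show Matrix.single k l (y k l) = y k l • Matrix.single k l (1:ℂ) by simp, hq.smul_r, mul_comm]
    rfl
  let T : Matrix n n ℂ → Matrix n n ℂ := fun x => Z * M x * Z
  have hGT : ∀ u v, Gm W (T u) v = q u v := by
    intro u v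
    rw [← hM, Gm]
    congr 2
    change W * (Z * M u * Z) * W = _
    simp only [Matrix.mul_assoc, j1, i2, mul_one]
  have hT : ∀ u v, Gm W (T u) v = Gm W u (T v) := by
    intro u v
    rw [hGT, ← hG.symm, hGT, hq.symm]
  set α : Matrix n n ℂ → ℝ := fun x => (om (W * W) (x * xᴴ)).re with hα
  have hR : (W * W).PosSemidef := by
    have := Matrix.posSemidef_conjTranspose_mul_self W
    rwa [hW'] at this
  have hα0 : ∀ x, 0 ≤ α x := fun x => om_psd hR (Matrix.posSemidef_self_mul_conjTranspose x)
  have hαT : ∀ x, α (T x) ≤ α x := by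
    intro x
    set u := T x with hu
    have h1 := hb x (W * u * Z)
    have h2 : q x (W * u * Z) = om (W * W) (u * uᴴ) := by
      rw [← hGT, ← hu, Gm, om_apply, Matrix.conjTranspose_mul, Matrix.conjTranspose_mul, hW', hZ']
      simp only [Matrix.mul_assoc, j1]
      rw [Matrix.trace_mul_comm]
      simp only [Matrix.mul_assoc]
    have h3 : om (W * W) ((W * u * Z)ᴴ * (W * u * Z)) = om (W * W) (u * uᴴ) := by
      rw [om_apply, om_apply, Matrix.conjTranspose_mul, Matrix.conjTranspose_mul, hW', hZ']
      simp only [Matrix.mul_assoc, j2]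
      rw [Matrix.trace_mul_comm]
      simp only [Matrix.mul_assoc, i1, mul_one]
      rw [Matrix.trace_mul_comm]
      simp only [Matrix.mul_assoc]
      rw [Matrix.trace_mul_comm]
      simp only [Matrix.mul_assoc]
      rw [Matrix.trace_mul_comm]
      simp only [Matrix.mul_assoc]
    rw [h2, h3] at h1
    have h4 : α u ^ 2 ≤ ‖om (W * W) (u * uᴴ)‖ ^ 2 := by
      gcongr
      · exact hα0 u
      · exact Complex.re_le_norm _
    have h5 : α u ^ 2 ≤ α x * α u := h4.trans h1
    rcases (hα0 u).eq_or_lt with h | h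
    · rw [← h]; exact hα0 x
    · rw [sq] at h5; exact le_of_mul_le_mul_right h5 h
  have hαk : ∀ k, α (T^[k] x) ≤ α x := by
    intro k
    induction k with
    | zero => exact le_rfl
    | succ k ih => rw [iterate_succ_apply']; exact (hαT _).trans ih
  have := hG.iter T hT x (Real.sqrt (α x * (om (W * W) (xᴴ * x)).re)) fun k => by
    refine Real.le_sqrt_of_sq_le ((Gm_cs hW.1 _ _).trans ?_)
    gcongr
    · exact om_psd hR (Matrix.posSemidef_conjTranspose_mul_self _)
    · exact hαk k
  rw [hGT] at this
  exact (Complex.re_le_norm _).trans this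
end mats
end FM

namespace FM
set_option linter.all false
set_option linter.style.haveILetI false
set_option linter.unnecessarySimpa false
open scoped ComplexOrder InnerProductSpace ComplexStarModule
open scoped TensorProduct Topology Kronecker Matrix
open Filter

section krl
variable {τ m n : Type} [Fintype τ] [Fintype m] [Fintype n] [DecidableEq n] [DecidableEq m]

lemma kr_star (V : τ → Matrix m n ℂ) (x) : kr V xᴴ = (kr V x)ᴴ := by
  rw [kr_apply, kr_apply, Matrix.conjTranspose_sum]
  refine Finset.sum_congr rfl fun t _ => ?_
  simp only [Matrix.conjTranspose_mul, Matrix.conjTranspose_conjTranspose, Matrix.mul_assoc]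

lemma kr_schwarz (V : τ → Matrix m n ℂ) (hV : (1 - kr V 1).PosSemidef) (x) : (kr V (xᴴ * x) - (kr V x)ᴴ * kr V x).PosSemidef := by
  set g := kr V x with hg
  have h1 : kr V (xᴴ * x) - gᴴ * g = ∑ t, (x * V t - V t * g)ᴴ * (x * V t - V t * g) + gᴴ * (1 - kr V 1) * g := by
    have e1 : ∀ t, (x * V t - V t * g)ᴴ * (x * V t - V t * g) = (V t)ᴴ * (xᴴ * x) * V t - ((V t)ᴴ * xᴴ * V t) * g - gᴴ * ((V t)ᴴ * x * V t) + gᴴ * ((V t)ᴴ * (1 : Matrix m m ℂ) * V t) * g := by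
      intro t
      simp only [Matrix.conjTranspose_sub, Matrix.conjTranspose_mul, Matrix.sub_mul, Matrix.mul_sub, Matrix.mul_assoc, Matrix.one_mul]
      abel
    simp only [e1, Finset.sum_add_distrib, Finset.sum_sub_distrib, ← Matrix.sum_mul, ← Matrix.mul_sum]
    rw [← kr_apply, ← kr_apply, ← kr_apply, ← kr_apply, kr_star, ← hg, Matrix.mul_sub, Matrix.sub_mul, Matrix.mul_one]
    abel
  rw [h1]
  exact (psd_sum _ _ fun t _ => Matrix.posSemidef_conjTranspose_mul_self _).add (hV.conjTranspose_mul_mul_same g)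

open scoped Matrix.Norms.L2Operator in
lemma psd_of_norm (x : Matrix n n ℂ) (hx : x.IsHermitian) (r : ℝ) (hr : ‖x‖ ≤ r) : ((r:ℂ) • 1 - x).PosSemidef := by
  letI := CStarAlgebra.spectralOrder (Matrix n n ℂ)
  haveI := CStarAlgebra.spectralOrderedRing (Matrix n n ℂ)
  have h1 : x ≤ algebraMap ℝ _ ‖x‖ := IsSelfAdjoint.le_algebraMap_norm_self (show IsSelfAdjoint x from hx)
  have h2 : algebraMap ℝ (Matrix n n ℂ) ‖x‖ ≤ algebraMap ℝ _ r := algebraMap_mono _ hr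
  have h3 := sub_nonneg.2 (h1.trans h2)
  rw [CStarAlgebra.nonneg_iff_eq_star_mul_self] at h3
  obtain ⟨y, hy⟩ := h3
  have : (r:ℂ) • (1 : Matrix n n ℂ) - x = yᴴ * y := by
    rw [← Matrix.star_eq_conjTranspose, ← hy, Algebra.algebraMap_eq_smul_one, Complex.coe_smul]
  rw [this]
  exact Matrix.posSemidef_conjTranspose_mul_self y

open scoped Matrix.Norms.L2Operator in
lemma kr_norm (V : τ → Matrix m n ℂ) (hV : (1 - kr V 1).PosSemidef) (x) : ‖kr V x‖ ≤ ‖x‖ := by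
  have h1 : ‖(kr V x)ᴴ * kr V x‖ ≤ ‖x‖ ^ 2 := by
    refine matrix_norm_le _ (Matrix.isHermitian_conjTranspose_mul_self _) _ (by positivity) ?_ ?_
    · have h2 := kr_psd V _ (psd_of_norm (xᴴ * x) (Matrix.isHermitian_conjTranspose_mul_self _) (‖x‖ ^ 2) (by
        rw [sq]; exact (CStarRing.norm_star_mul_self (x := x)).le))
      have h3 := hV.smul (show (0:ℂ) ≤ ((‖x‖ ^ 2 : ℝ) : ℂ) by exact_mod_cast sq_nonneg ‖x‖)
      have h4 := (h2.add h3).add (kr_schwarz V hV x)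
      convert h4 using 1
      rw [map_sub, map_smul, smul_sub]; abel
    · exact (Matrix.PosSemidef.one.smul (show (0:ℂ) ≤ ((‖x‖ ^ 2 : ℝ) : ℂ) by exact_mod_cast sq_nonneg ‖x‖)).add (Matrix.posSemidef_conjTranspose_mul_self _)
  have h5 : ‖(kr V x)ᴴ * kr V x‖ = ‖kr V x‖ * ‖kr V x‖ := CStarRing.norm_star_mul_self (x := kr V x)
  rw [h5, ← sq] at h1
  exact abs_le_of_sq_le_sq' h1 (norm_nonneg _) |>.2

lemma herm_of_sub {R N : Matrix n n ℂ} (hR : R.PosSemidef) (h : (R - N).PosSemidef) : N.IsHermitian := by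
  have := hR.1.sub h.1
  simpa using this

variable {B : Type} [NonUnitalCStarAlgebra B]
variable {K : Type} [NormedAddCommGroup K] [InnerProductSpace ℂ K] [CompleteSpace K] {ι : Type}

open scoped Matrix.Norms.L2Operator in
lemma ph_norm [DecidableEq ι] (σ : B →⋆ₙₐ[ℂ] (K →L[ℂ] K)) (e : HilbertBasis ι ℂ K) (S : Finset ι) (b : B) :
    ‖ph σ e S b‖ ≤ ‖b‖ := by
  have h1 : ‖(ph σ e S b)ᴴ * ph σ e S b‖ ≤ ‖b‖ ^ 2 := by
    refine matrix_norm_le _ (Matrix.isHermitian_conjTranspose_mul_self _) _ (by positivity) ?_ ?_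
    · have h2 := (ph_sub_psd σ e S (star b * b) (IsSelfAdjoint.star_mul_self b) (‖b‖^2) (by rw [CStarRing.norm_star_mul_self, sq])).add (ph_schwarz σ e S b)
      convert h2 using 1
      abel
    · exact (Matrix.PosSemidef.one.smul (show (0:ℂ) ≤ ((‖b‖ ^ 2 : ℝ) : ℂ) by exact_mod_cast sq_nonneg ‖b‖)).add (Matrix.posSemidef_conjTranspose_mul_self _)
  have h5 : ‖(ph σ e S b)ᴴ * ph σ e S b‖ = ‖ph σ e S b‖ * ‖ph σ e S b‖ := CStarRing.norm_star_mul_self (x := ph σ e S b)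
  rw [h5, ← sq] at h1
  exact abs_le_of_sq_le_sq' h1 (norm_nonneg _) |>.2
end krl

end FM

namespace FM
set_option linter.all false
set_option linter.style.haveILetI false
set_option linter.unnecessarySimpa false
open scoped ComplexOrder InnerProductSpace ComplexStarModule
open scoped TensorProduct Topology Kronecker Matrix
open Filter

section krd
variable {A B : Type} [NonUnitalCStarAlgebra A] [NonUnitalCStarAlgebra B] 
variable {τ m n : Type} [Fintype τ] [Fintype m] [Fintype n] [DecidableEq n] [DecidableEq m]

def krD (D : n → n → A →ₗ[ℂ] ℂ) (Q : τ → Matrix n m ℂ) : m → m → A →ₗ[ℂ] ℂ :=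
  fun i j => ∑ t, ∑ k, ∑ l, (star (Q t k i) * Q t l j) • D k l

lemma krD_apply (D : n → n → A →ₗ[ℂ] ℂ) (Q : τ → Matrix n m ℂ) (i j a) : krD D Q i j a = ∑ t, ∑ k, ∑ l, (star (Q t k i) * Q t l j) * D k l a := by
  simp only [krD, LinearMap.sum_apply, LinearMap.smul_apply, smul_eq_mul]

lemma CPf.krD {D : n → n → A →ₗ[ℂ] ℂ} (hD : CPf D) (Q : τ → Matrix n m ℂ) : CPf (krD D Q) := by
  intro c
  have h : ∑ i, ∑ j, FM.krD D Q i j (star (c i) * c j) = ∑ t, ∑ k, ∑ l, D k l (star (∑ i, Q t k i • c i) * ∑ j, Q t l j • c j) := by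
    simp only [krD_apply, star_sum, star_smul, Finset.sum_mul, Finset.mul_sum, map_sum, smul_mul_smul_comm, map_smul, smul_eq_mul]
    calc _ = ∑ i, ∑ t, ∑ j, ∑ k, ∑ l, star (Q t k i) * Q t l j * D k l (star (c i) * c j) := Finset.sum_congr rfl fun i _ => Finset.sum_comm
      _ = ∑ t, ∑ i, ∑ j, ∑ k, ∑ l, star (Q t k i) * Q t l j * D k l (star (c i) * c j) := Finset.sum_comm
      _ = _ := ?_
    refine Finset.sum_congr rfl fun t _ => ?_
    calc _ = ∑ i, ∑ k, ∑ j, ∑ l, star (Q t k i) * Q t l j * D k l (star (c i) * c j) := Finset.sum_congr rfl fun i _ => Finset.sum_comm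
      _ = ∑ k, ∑ i, ∑ j, ∑ l, star (Q t k i) * Q t l j * D k l (star (c i) * c j) := Finset.sum_comm
      _ = ∑ k, ∑ i, ∑ l, ∑ j, star (Q t k i) * Q t l j * D k l (star (c i) * c j) := Finset.sum_congr rfl fun i _ => Finset.sum_congr rfl fun j _ => Finset.sum_comm
      _ = ∑ k, ∑ l, ∑ i, ∑ j, star (Q t k i) * Q t l j * D k l (star (c i) * c j) := Finset.sum_congr rfl fun i _ => Finset.sum_comm
      _ = _ := ?_
    refine Finset.sum_congr rfl fun k _ => Finset.sum_congr rfl fun l _ => ?_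
    rw [Finset.sum_comm]
  rw [h]
  exact Finset.sum_nonneg fun t _ => hD fun k => ∑ i, Q t k i • c i

def NM (D : n → n → A →ₗ[ℂ] ℂ) : A →ₗ[ℂ] Matrix n n ℂ where
  toFun a := Matrix.of fun i j => D j i a
  map_add' a b := by ext; simp
  map_smul' c a := by ext; simp

lemma NM_apply (D : n → n → A →ₗ[ℂ] ℂ) (a i j) : NM D a i j = D j i a := rfl

lemma om_NM (D : n → n → A →ₗ[ℂ] ℂ) (a x) : om (NM D a) x = ∑ i, ∑ j, x i j * D i j a := by
  rw [om_apply, Matrix.trace]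
  exact Finset.sum_congr rfl fun i _ => by rw [Matrix.diag_apply, Matrix.mul_apply]; rfl

lemma NM_trace (D : n → n → A →ₗ[ℂ] ℂ) (a) : (NM D a).trace = ∑ i, D i i a := rfl

lemma om_krD (D : n → n → A →ₗ[ℂ] ℂ) (V : τ → Matrix m n ℂ) (a x) : om (NM (krD D fun t => (V t)ᵀ) a) x = om (NM D a) (kr V x) := by
  have h1 : NM (krD D fun t => (V t)ᵀ) a = ∑ t, V t * NM D a * (V t)ᴴ := by
    ext q p
    rw [NM_apply, krD_apply, Matrix.sum_apply]
    refine Finset.sum_congr rfl fun t _ => ?_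
    rw [Matrix.mul_apply]
    refine Finset.sum_congr rfl fun k _ => ?_
    rw [Matrix.mul_apply, Finset.sum_mul]
    refine Finset.sum_congr rfl fun l _ => ?_
    rw [NM_apply, Matrix.conjTranspose_apply, Matrix.transpose_apply, Matrix.transpose_apply]
    ring
  rw [h1, om_apply, om_apply, kr_apply, Matrix.mul_sum, Matrix.sum_mul, Matrix.trace_sum, Matrix.trace_sum]
  refine Finset.sum_congr rfl fun t _ => ?_
  rw [← Matrix.mul_assoc, Matrix.trace_mul_comm]
  simp only [Matrix.mul_assoc]

lemma krD_kr {K ι : Type} [NormedAddCommGroup K] [InnerProductSpace ℂ K] [CompleteSpace K] [DecidableEq ι] (σ : B →⋆ₙₐ[ℂ] (K →L[ℂ] K)) (e : HilbertBasis ι ℂ K) (S : Finset ι)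
    (Q : τ → Matrix S m ℂ) (b : B) (i j : m) : krD (fun k l : S => vf σ (e k) (e l)) Q i j b = kr Q (ph σ e S b) i j := by
  rw [krD_apply, kr_apply, Matrix.sum_apply]
  refine Finset.sum_congr rfl fun t _ => ?_
  rw [Matrix.mul_apply, Finset.sum_comm]
  refine Finset.sum_congr rfl fun l _ => ?_
  rw [Matrix.mul_apply, Finset.sum_mul]
  refine Finset.sum_congr rfl fun k _ => ?_
  rw [vf_ph, Matrix.conjTranspose_apply]
  ring

lemma CPf.NM_psd {D : n → n → A →ₗ[ℂ] ℂ} (hD : CPf D) (c : A) : (NM D (star c * c)).PosSemidef := by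
  refine psd_of_form _ fun w => ?_
  have := hD fun i => star (w i) • c
  simp only [star_smul, star_star, smul_mul_smul_comm, map_smul, smul_eq_mul] at this
  rw [Finset.sum_comm]
  convert this using 3
  rw [NM_apply]; ring

end krd

section krd2
variable {A : Type} [CStarAlgebra A]
variable {n : Type} [Fintype n] [DecidableEq n] 

lemma norm_sub_sq (a : A) (ha : IsSelfAdjoint a) : ∃ c : A, (‖a‖ : ℂ) • 1 - a = star c * c := by
  letI := CStarAlgebra.spectralOrder A
  haveI := CStarAlgebra.spectralOrderedRing A
  have h1 : a ≤ algebraMap ℝ _ ‖a‖ := IsSelfAdjoint.le_algebraMap_norm_self ha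
  have h3 := sub_nonneg.2 h1
  rw [CStarAlgebra.nonneg_iff_eq_star_mul_self] at h3
  obtain ⟨y, hy⟩ := h3
  exact ⟨y, by rw [← hy, Algebra.algebraMap_eq_smul_one, Complex.coe_smul]⟩

lemma CPf.NM_one {D : n → n → A →ₗ[ℂ] ℂ} (hD : CPf D) : (NM D 1).PosSemidef := by
  have := hD.NM_psd 1
  rwa [star_one, mul_one] at this

lemma CPf.NM_sub {D : n → n → A →ₗ[ℂ] ℂ} (hD : CPf D) (a : A) (ha : IsSelfAdjoint a) : ((‖a‖ : ℂ) • NM D 1 - NM D a).PosSemidef := by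
  obtain ⟨c, hc⟩ := norm_sub_sq a ha
  have := hD.NM_psd c
  rwa [← hc, map_sub, map_smul] at this

open scoped Matrix.Norms.L2Operator in
lemma om_norm' {R : Matrix n n ℂ} (hR : R.PosSemidef) (x) : ‖om R x‖ ≤ ‖x‖ * R.trace.re := by
  have := (om_pos hR).norm_conj_le 1 x
  rwa [star_one, one_mul, mul_one, one_mul, om_apply R 1, one_mul] at this

open scoped Matrix.Norms.L2Operator in
lemma evD_bound (a : A) : ∃ C : ℝ, 0 ≤ C ∧ ∀ (n : Type) [Fintype n] [DecidableEq n] (D : n → n → A →ₗ[ℂ] ℂ), CPf D → (∑ i, D i i 1).re ≤ 1 →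
    ∀ x, ‖om (NM D a) x‖ ≤ C * ‖x‖ := by
  letI := CStarAlgebra.spectralOrder A
  haveI := CStarAlgebra.spectralOrderedRing A
  have ha : a ∈ Submodule.span ℂ {a : A | 0 ≤ a} := by rw [CStarAlgebra.span_nonneg]; trivial
  induction ha using Submodule.span_induction with
  | mem a h =>
    rw [Set.mem_setOf_eq, CStarAlgebra.nonneg_iff_eq_star_mul_self] at h
    obtain ⟨c, rfl⟩ := h
    refine ⟨‖star c * c‖, norm_nonneg _, fun n _ _ D hD hm x => ?_⟩
    have h1 := om_norm' (hD.NM_psd c) x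
    have h2 : IsPos (∑ i, D i i) := fun y => by
      rw [LinearMap.sum_apply]
      exact Finset.sum_nonneg fun i _ => hD.pos_diag i y
    have h3 := h2.norm_conj_le 1 (star c * c)
    rw [star_one, one_mul, mul_one, one_mul, LinearMap.sum_apply, LinearMap.sum_apply] at h3
    have h4 : (NM D (star c * c)).trace.re ≤ ‖star c * c‖ := by
      rw [NM_trace]
      refine (Complex.re_le_norm _).trans (h3.trans ?_)
      nlinarith [norm_nonneg (star c * c)]
    calc _ ≤ _ := h1
      _ ≤ ‖x‖ * ‖star c * c‖ := by gcongr
      _ = _ := mul_comm _ _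
  | zero => exact ⟨0, le_rfl, fun n _ _ D hD hm x => by simp [om_apply]⟩
  | add a b _ _ h1 h2 =>
    obtain ⟨C1, h1, h1'⟩ := h1
    obtain ⟨C2, h2, h2'⟩ := h2
    refine ⟨C1 + C2, by positivity, fun n _ _ D hD hm x => ?_⟩
    have e : om (NM D (a + b)) x = om (NM D a) x + om (NM D b) x := by
      simp only [om_apply, map_add, Matrix.mul_add, Matrix.trace_add]
    rw [e, add_mul]
    exact (norm_add_le _ _).trans (add_le_add (h1' n D hD hm x) (h2' n D hD hm x))
  | smul c a _ h1 =>
    obtain ⟨C1, h1, h1'⟩ := h1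
    refine ⟨‖c‖ * C1, by positivity, fun n _ _ D hD hm x => ?_⟩
    have e : om (NM D (c • a)) x = c * om (NM D a) x := by
      simp only [om_apply, map_smul, Matrix.mul_smul, Matrix.trace_smul, smul_eq_mul]
    rw [e, norm_mul, mul_assoc]
    gcongr
    exact h1' n D hD hm x

open scoped MatrixOrder Matrix.Norms.L2Operator in
lemma psd_sqrt {R : Matrix n n ℂ} (hR : R.PosSemidef) : ∃ W : Matrix n n ℂ, W.PosSemidef ∧ W * W = R := by
  have h0 : 0 ≤ R := Matrix.nonneg_iff_posSemidef.2 hR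
  exact ⟨CFC.sqrt R, Matrix.nonneg_iff_posSemidef.1 (CFC.sqrt_nonneg R), CFC.sqrt_mul_sqrt_self R h0⟩

lemma psd_sqrt_def {R W : Matrix n n ℂ} (hR : R.PosDef) (hW : W.PosSemidef) (h : W * W = R) : W.PosDef := by
  rw [hW.posDef_iff_isUnit]
  have h1 := hR.isUnit
  rw [← h, Matrix.isUnit_iff_isUnit_det, Matrix.det_mul] at h1
  rw [Matrix.isUnit_iff_isUnit_det]
  exact isUnit_of_mul_isUnit_right h1

/-- points -/
structure PT (A : Type) [CStarAlgebra A] (ι : Type) where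
  S : Finset ι
  D : S → S → A →ₗ[ℂ] ℂ
  cp : CPf D
  mass : (∑ i, D i i 1).re ≤ 1

def PT.W {ι : Type} [DecidableEq ι] (p : PT A ι) : Matrix p.S p.S ℂ := (psd_sqrt p.cp.NM_one).choose
lemma PT.W_psd {ι : Type} [DecidableEq ι] (p : PT A ι) : p.W.PosSemidef := (psd_sqrt p.cp.NM_one).choose_spec.1
lemma PT.W_sq {ι : Type} [DecidableEq ι] (p : PT A ι) : p.W * p.W = NM p.D 1 := (psd_sqrt p.cp.NM_one).choose_spec.2
lemma PT.W_mass {ι : Type} [DecidableEq ι] (p : PT A ι) : (p.W * p.W).trace.re ≤ 1 := by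
  rw [p.W_sq, NM_trace]; exact p.mass
end krd2
end FM

namespace FM
set_option linter.all false
set_option linter.style.haveILetI false
set_option linter.unnecessarySimpa false
open scoped ComplexOrder InnerProductSpace ComplexStarModule
open scoped TensorProduct Topology Kronecker Matrix
open Filter

lemma ulim {I : Type} (U : Ultrafilter I) (f : I → ℂ) (C : ℝ) (h : ∀ i, ‖f i‖ ≤ C) : ∃ c, Tendsto f U (𝓝 c) := by
  have h1 : IsCompact (Metric.closedBall (0:ℂ) C) := isCompact_closedBall _ _
  obtain ⟨c, -, hc⟩ := h1.ultrafilter_le_nhds (U.map f) (by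
    rw [le_principal_iff]
    refine Filter.mem_map.2 (Filter.univ_mem' fun i => ?_)
    simpa using h i)
  exact ⟨c, hc⟩

lemma ulin {I V : Type} [AddCommGroup V] [Module ℂ V] (U : Ultrafilter I) (f : I → V →ₗ[ℂ] ℂ)
    (h : ∀ v, ∃ C : ℝ, ∀ i, ‖f i v‖ ≤ C) : ∃ g : V →ₗ[ℂ] ℂ, ∀ v, Tendsto (fun i => f i v) U (𝓝 (g v)) := by
  choose C hC using h
  choose g hg using fun v => ulim U (fun i => f i v) (C v) (hC v)
  refine ⟨{ toFun := g, map_add' := fun x y => ?_, map_smul' := fun c x => ?_ }, hg⟩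
  · refine tendsto_nhds_unique (hg (x+y)) ?_
    simpa using (hg x).add (hg y)
  · refine tendsto_nhds_unique (hg (c • x)) ?_
    simpa using (hg x).const_mul c

lemma cpf_lim {A : Type} [NonUnitalCStarAlgebra A] {I n : Type} [Fintype n] (U : Ultrafilter I) (f : I → n → n → A →ₗ[ℂ] ℂ)
    (g : n → n → A →ₗ[ℂ] ℂ) (hf : ∀ i, CPf (f i)) (h : ∀ k l a, Tendsto (fun i => f i k l a) U (𝓝 (g k l a))) : CPf g := by
  intro c
  refine ge_of_tendsto' (x := (U : Filter I)) (f := fun i => ∑ k, ∑ l, f i k l (star (c k) * c l)) ?_ fun i => hf i c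
  exact tendsto_finset_sum _ fun k _ => tendsto_finset_sum _ fun l _ => h k l _

open scoped Matrix.Norms.L2Operator in
theorem kraus_approx' {B K ι : Type} [NonUnitalCStarAlgebra B] [NormedAddCommGroup K] [InnerProductSpace ℂ K] [CompleteSpace K]
    (hB : IsExactCStar B) [DecidableEq ι]
    (σ : B →⋆ₙₐ[ℂ] (K →L[ℂ] K)) (hσ : Injective σ) (e : HilbertBasis ι ℂ K) 
    (E : Finset B) (ε : ℝ) (hε : 0 < ε) :
    ∃ S : Finset ι, ∀ S' : Finset ι, ∃ (τ : Type) (_ : Fintype τ) (V : τ → Matrix S S' ℂ),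
      (1 - kr V 1).PosSemidef ∧ ∀ b ∈ E, ‖kr V (ph σ e S b) - ph σ e S' b‖ ≤ ε := by
  classical
  obtain ⟨S, hS⟩ := kraus_approx hB σ hσ e (J := Option (E ⊕ E))
    (fun j => match j with
      | none => 0
      | some (Sum.inl b) => (ℜ (b:B) : B)
      | some (Sum.inr b) => (ℑ (b:B) : B)) (by
        rintro (_ | b | b)
        · exact IsSelfAdjoint.zero _
        · exact (ℜ (b:B)).2
        · exact (ℑ (b:B)).2) (ε/2) (by positivity)
  refine ⟨S, fun S' => ?_⟩
  obtain ⟨τ, i, V, h1, h2⟩ := hS S'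
  refine ⟨τ, i, V, h1, fun b hb => ?_⟩
  have h3 := h2 (some (Sum.inl ⟨b, hb⟩))
  have h4 := h2 (some (Sum.inr ⟨b, hb⟩))
  simp only at h3 h4
  have e1 : kr V (ph σ e S b) - ph σ e S' b = (kr V (ph σ e S (ℜ b)) - ph σ e S' (ℜ b)) + Complex.I • (kr V (ph σ e S (ℑ b)) - ph σ e S' (ℑ b)) := by
    conv_lhs => rw [← realPart_add_I_smul_imaginaryPart b]
    simp only [map_add, map_smul, smul_sub]
    abel
  rw [e1]
  refine (norm_add_le _ _).trans ?_
  rw [norm_smul, Complex.norm_I, one_mul]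
  linarith
end FM

namespace FM
set_option linter.all false
set_option linter.style.haveILetI false
set_option linter.unnecessarySimpa false
open scoped ComplexOrder InnerProductSpace ComplexStarModule
open scoped TensorProduct Topology Kronecker Matrix
open Filter

lemma tr_kr {τ m n : Type} [Fintype τ] [Fintype m] [Fintype n] [DecidableEq n] [DecidableEq m] (V : τ → Matrix m n ℂ)
    {W : Matrix n n ℂ} {Z : Matrix m m ℂ} (hW : W.IsHermitian) (hZ : Z.IsHermitian) (X : Matrix m m ℂ) (φ : Matrix n n ℂ) :
    (X * kr (fun t => W * (V t)ᴴ * Z) φ).trace = Gm W φ (kr V (Z * X * Z)ᴴ) := by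
  have h1 : (kr V (Z * X * Z)ᴴ)ᴴ = kr V (Z * X * Z) := by rw [kr_star, Matrix.conjTranspose_conjTranspose]
  simp only [Gm]
  rw [h1, kr_apply, kr_apply, Matrix.mul_sum, Matrix.mul_sum, Matrix.trace_sum, Matrix.trace_sum]
  refine Finset.sum_congr rfl fun t _ => ?_
  rw [Matrix.conjTranspose_mul, Matrix.conjTranspose_mul, Matrix.conjTranspose_conjTranspose, hW.eq, hZ.eq]
  calc _ = ((X * Z * V t) * (W * φ * W * (V t)ᴴ * Z)).trace := by simp only [Matrix.mul_assoc]
    _ = ((W * φ * W * (V t)ᴴ * Z) * (X * Z * V t)).trace := Matrix.trace_mul_comm _ _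
    _ = _ := by simp only [Matrix.mul_assoc]

lemma om_mono {n : Type} [Fintype n] [DecidableEq n] {R : Matrix n n ℂ} (hR : R.PosSemidef) {x y : Matrix n n ℂ} (h : (y - x).PosSemidef) :
    (om R x).re ≤ (om R y).re := by
  have := om_psd hR h
  rw [map_sub, Complex.sub_re] at this
  linarith

section kk
variable {A B C T TF : Type} [CStarAlgebra A] [NonUnitalCStarAlgebra B] [NonUnitalCStarAlgebra C] [NonUnitalCStarAlgebra T] [NonUnitalCStarAlgebra TF]
variable {K : Type} [NormedAddCommGroup K] [InnerProductSpace ℂ K] [CompleteSpace K] {ι : Type} [DecidableEq ι]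

open scoped Matrix.Norms.L2Operator in
lemma PT.ps_bd (p : PT A ι) (σ : B →⋆ₙₐ[ℂ] (K →L[ℂ] K)) (e : HilbertBasis ι ℂ K) (b : B) (y : Matrix p.S p.S ℂ) :
    ‖Gm p.W (ph σ e p.S b) y‖ ^ 2 ≤ (om (NM p.D 1) (ph σ e p.S (b * star b))).re * ‖y‖ ^ 2 := by
  have h1 := Gm_cs p.W_psd.1 (ph σ e p.S b) y
  have hR := p.cp.NM_one
  rw [p.W_sq] at h1
  have h2 : (om (NM p.D 1) (ph σ e p.S b * (ph σ e p.S b)ᴴ)).re ≤ (om (NM p.D 1) (ph σ e p.S (b * star b))).re := by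
    apply om_mono hR
    have := ph_schwarz σ e p.S (star b)
    rwa [star_star, ph_star, Matrix.conjTranspose_conjTranspose] at this
  have h3 : (om (NM p.D 1) (yᴴ * y)).re ≤ ‖y‖ ^ 2 := by
    refine (Complex.re_le_norm _).trans ((om_norm hR (by rw [NM_trace]; exact p.mass) _).trans ?_)
    rw [← Matrix.star_eq_conjTranspose, CStarRing.norm_star_mul_self, sq]
  have h4 : 0 ≤ (om (NM p.D 1) (ph σ e p.S b * (ph σ e p.S b)ᴴ)).re := om_psd hR (Matrix.posSemidef_self_mul_conjTranspose _)
  refine h1.trans (mul_le_mul h2 h3 (om_psd hR (Matrix.posSemidef_conjTranspose_mul_self _)) (h4.trans h2))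

lemma tendsto_sq {I : Type} {U : Filter I} {f : I → ℂ} {g : I → ℝ} (h : ∀ i, ‖f i‖ ^ 2 ≤ g i) (hg : Tendsto g U (𝓝 0)) : Tendsto f U (𝓝 0) := by
  rw [tendsto_zero_iff_norm_tendsto_zero]
  have h1 : Tendsto (fun i => Real.sqrt (g i)) U (𝓝 0) := by
    have := (Real.continuous_sqrt.tendsto 0).comp hg
    rw [Real.sqrt_zero] at this
    exact this
  exact squeeze_zero (fun i => norm_nonneg _) (fun i => Real.le_sqrt_of_sq_le (h i)) h1

open scoped Matrix.Norms.L2Operator in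
theorem key_psi (d : TensorData A B T) (dF : TensorData A C TF) (π : B →⋆ₙₐ[ℂ] C) (hπ : Surjective π)
    (Θ : T →⋆ₙₐ[ℂ] TF) (hΘ : ∀ a b, Θ (d.tmul a b) = dF.tmul a (π b))
    (σ : B →⋆ₙₐ[ℂ] (K →L[ℂ] K)) (e : HilbertBasis ι ℂ K)
    {I : Type} (U : Ultrafilter I) (p : I → PT A ι) 
    (hJ : ∀ b, π b = 0 → Tendsto (fun i => om (NM (p i).D 1) (ph σ e (p i).S (b * star b))) U (𝓝 0))
    {m : Type} [Fintype m] [DecidableEq m] (τ : I → Type) [∀ i, Fintype (τ i)] (V : ∀ i, τ i → Matrix m (p i).S ℂ)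
    (hV : ∀ i, (1 - kr (V i) 1).PosSemidef)
    (D : m → m → A →ₗ[ℂ] ℂ) (hD : CPf D) (Z : Matrix m m ℂ) (hZ : Z.IsHermitian) (hZ1 : Z * NM D 1 * Z = 1) :
    ∃ F : T →L[ℂ] ℂ, ‖F‖ ≤ 1 ∧ (∀ t, Θ t = 0 → F t = 0) ∧
      ∀ a b, Tendsto (fun i => Gm (p i).W (ph σ e (p i).S b) (kr (V i) (Z * NM D a * Z)ᴴ)) U (𝓝 (F (d.tmul a b))) := by
  set Ps : I → m → m → B →ₗ[ℂ] ℂ := fun i => krD (fun k l : (p i).S => vf σ (e k) (e l)) (fun t => (p i).W * (V i t)ᴴ * Z) with hPs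
  have hcp : ∀ i, CPf (Ps i) := fun i => (ph_cpf σ e (p i).S).krD _
  have hent : ∀ i k l b, Ps i k l b = Gm (p i).W (ph σ e (p i).S b) (kr (V i) (Z * Matrix.single l k 1 * Z)ᴴ) := by
    intro i k l b
    rw [← tr_kr (V i) (p i).W_psd.1 hZ, hPs]
    simp only [krD_kr]
    rw [Matrix.trace_single_mul]
    simp
  have hbd : ∀ i b (X : Matrix m m ℂ), ‖Gm (p i).W (ph σ e (p i).S b) (kr (V i) X)‖ ≤ ‖b‖ * ‖X‖ := fun i b X =>
    (Gm_norm (p i).W_psd.1 (p i).W_mass _ _).trans (mul_le_mul (ph_norm _ _ _ _) (kr_norm _ (hV i) _) (norm_nonneg _) (norm_nonneg _))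
  choose Ψ hΨ using fun k l => ulin U (fun i => Ps i k l) (fun b => ⟨‖b‖ * ‖(Z * Matrix.single l k 1 * Z)ᴴ‖, fun i => by
    rw [hent]; exact hbd i b _⟩)
  have hΨc : CPf Ψ := cpf_lim U Ps Ψ hcp hΨ
  have hpair : ∀ a b, Tendsto (fun i => Gm (p i).W (ph σ e (p i).S b) (kr (V i) (Z * NM D a * Z)ᴴ)) U (𝓝 (∑ k, ∑ l, D k l a * Ψ k l b)) := by
    intro a b
    have h1 : ∀ i, Gm (p i).W (ph σ e (p i).S b) (kr (V i) (Z * NM D a * Z)ᴴ) = ∑ k, ∑ l, D k l a * Ps i k l b := by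
      intro i
      rw [← tr_kr (V i) (p i).W_psd.1 hZ, hPs]
      simp only [krD_kr]
      simp only [Matrix.trace, Matrix.diag, Matrix.mul_apply, NM_apply]
      exact Finset.sum_comm
    simp only [h1]
    exact tendsto_finset_sum _ fun k _ => tendsto_finset_sum _ fun l _ => (hΨ k l b).const_mul _
  have hker : ∀ k l b, π b = 0 → Ψ k l b = 0 := by
    intro k l b hb
    refine tendsto_nhds_unique (hΨ k l b) ?_
    simp only [hent]
    set X := (Z * Matrix.single l k 1 * Z)ᴴ
    refine tendsto_sq (g := fun i => (om (NM (p i).D 1) (ph σ e (p i).S (b * star b))).re * ‖X‖ ^ 2) (fun i => ?_) ?_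
    · refine ((p i).ps_bd σ e b _).trans ?_
      have h0 : 0 ≤ (om (NM (p i).D 1) (ph σ e (p i).S (b * star b))).re := by
        have := ph_schwarz σ e (p i).S (star b)
        rw [star_star, ph_star, Matrix.conjTranspose_conjTranspose] at this
        exact (om_psd (p i).cp.NM_one (Matrix.posSemidef_self_mul_conjTranspose _)).trans (om_mono (p i).cp.NM_one this)
      have := kr_norm (V i) (hV i) X
      gcongr
    · have := ((Complex.continuous_re.tendsto _).comp (hJ b hb)).mul_const (‖X‖^2)
      simpa using this
  obtain ⟨F, hF, hFp, hFn⟩ := hD.prod_ext d hΨc 1 (fun b hb => by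
    have h1 := (Complex.continuous_re.tendsto _).comp (hpair 1 (star b * b))
    refine le_of_tendsto' h1 fun i => ?_
    refine (Complex.re_le_norm _).trans ((hbd _ _ _).trans ?_)
    rw [hZ1, Matrix.conjTranspose_one, CStarRing.norm_star_mul_self]
    have h2 : ‖(1 : Matrix m m ℂ)‖ ≤ 1 := by
      rcases subsingleton_or_nontrivial (Matrix m m ℂ) with h | h
      · rw [Subsingleton.elim (1 : Matrix m m ℂ) 0, norm_zero]; norm_num
      · exact (CStarRing.norm_one).le
    nlinarith [norm_nonneg b, norm_nonneg (1 : Matrix m m ℂ), mul_le_one₀ hb (norm_nonneg b) hb])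
  -- descend
  choose s hs using hπ
  have hdesc : ∀ k l b b', π b = π b' → Ψ k l b = Ψ k l b' := fun k l b b' h => by
    rw [← sub_eq_zero, ← map_sub]; exact hker k l _ (by rw [map_sub, h, sub_self])
  let Ψ' : m → m → C →ₗ[ℂ] ℂ := fun k l =>
    { toFun := fun c => Ψ k l (s c)
      map_add' := fun x y => by rw [← map_add]; exact hdesc _ _ _ _ (by rw [hs, map_add, hs, hs])
      map_smul' := fun c x => by rw [RingHom.id_apply, ← map_smul]; exact hdesc _ _ _ _ (by rw [hs, map_smul, hs]) }
  have hΨ' : ∀ k l b, Ψ' k l (π b) = Ψ k l b := fun k l b => hdesc _ _ _ _ (hs _)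
  have hΨ'c : CPf Ψ' := fun c => by
    have := hΨc (fun i => s (c i))
    refine this.trans_eq (Finset.sum_congr rfl fun k _ => Finset.sum_congr rfl fun l _ => ?_)
    rw [← hΨ', map_mul, map_star, hs, hs]
  obtain ⟨F', hF'⟩ := (hD.prod_TBdd dF hΨ'c).ext
  have hfac : ∀ t, F t = F' (Θ t) := by
    intro t
    have h1 : (fun t => F t) = fun t => F' (Θ t) := by
      refine Continuous.ext_on (TJ_dense d) F.continuous (F'.continuous.comp (nush_cont Θ)) ?_
      rintro _ ⟨z, rfl⟩
      dsimp only
      rw [hF]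
      induction z using TensorProduct.induction_on with
      | zero => simp
      | add x y hx hy => rw [map_add, map_add, map_add, map_add, hx, hy]
      | tmul a b => rw [TJ_tmul, hΘ, ← TJ_tmul, hF', prodF_tmul, prodF_tmul]; simp only [hΨ']
    exact congrFun h1 t
  refine ⟨F, hFn, fun t ht => by rw [hfac, ht, map_zero], fun a b => ?_⟩
  rw [← TJ_tmul, hF, prodF_tmul]
  exact hpair a b
end kk
end FM

namespace FM
set_option linter.all false
set_option linter.style.haveILetI false
set_option linter.unnecessarySimpa false
open scoped ComplexOrder InnerProductSpace ComplexStarModule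
open scoped TensorProduct Topology Kronecker Matrix
open Filter

lemma ex_level {I X : Type} [Nonempty I] (N : I → Set X) (hN : ∀ i, (N i).Nonempty) (v : X → ℝ) (M : ℝ) (h0 : ∀ x, 0 ≤ v x) (hM : ∀ x, v x ≤ M)
    (η : ℝ) (hη : 0 < η) : ∃ Q : ℝ, Q ≤ M ∧ (∃ i, ∀ x ∈ N i, v x ≤ Q + η) ∧ ∀ i, ∃ x ∈ N i, Q - η ≤ v x := by
  set s : I → ℝ := fun i => sSup (v '' N i) with hs
  have hbd : ∀ i, BddAbove (v '' N i) := fun i => ⟨M, by rintro _ ⟨x, -, rfl⟩; exact hM x⟩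
  have hs0 : BddBelow (Set.range s) := ⟨0, by
    rintro _ ⟨i, rfl⟩
    obtain ⟨x, hx⟩ := hN i
    exact (h0 x).trans (le_csSup (hbd i) ⟨x, hx, rfl⟩)⟩
  have hsM : ∀ i, s i ≤ M := fun i => csSup_le ((hN i).image v) (by rintro _ ⟨x, -, rfl⟩; exact hM x)
  refine ⟨⨅ i, s i, ?_, ?_, fun i => ?_⟩
  · obtain ⟨i⟩ := ‹Nonempty I›
    exact (ciInf_le hs0 i).trans (hsM i)
  · obtain ⟨i, hi⟩ := exists_lt_of_ciInf_lt (lt_add_of_pos_right (⨅ i, s i) hη)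
    exact ⟨i, fun x hx => (le_csSup (hbd i) ⟨x, hx, rfl⟩).trans hi.le⟩
  · have h1 : (⨅ i, s i) - η < s i := by linarith [ciInf_le hs0 i]
    obtain ⟨_, ⟨x, hx, rfl⟩, h⟩ := exists_lt_of_lt_csSup ((hN i).image v) h1
    exact ⟨x, hx, h.le⟩

lemma PForm_lim {V I : Type} [AddCommGroup V] [Module ℂ V] (U : Ultrafilter I) (f : I → V → V → ℂ) (g : V → V → ℂ)
    (hf : ∀ i, PForm (f i)) (h : ∀ x y, Tendsto (fun i => f i x y) U (𝓝 (g x y))) : PForm g := by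
  refine ⟨fun x y z => ?_, fun c x z => ?_, fun x y => ?_, fun x => ?_⟩
  · refine tendsto_nhds_unique (h _ _) ?_
    simp only [(hf _).add]
    exact (h _ _).add (h _ _)
  · refine tendsto_nhds_unique (h _ _) ?_
    simp only [(hf _).smul]
    exact (h _ _).const_mul _
  · refine tendsto_nhds_unique ?_ (h y x)
    have := (continuous_star.tendsto _).comp (h x y)
    refine this.congr fun i => (hf i).symm x y
  · exact ge_of_tendsto' ((Complex.continuous_re.tendsto _).comp (h x x)) fun i => (hf i).nonneg x

lemma PForm_comp {V V' : Type} [AddCommGroup V] [Module ℂ V] [AddCommGroup V'] [Module ℂ V'] {q : V → V → ℂ} (hq : PForm q) (g : V' →ₗ[ℂ] V) :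
    PForm fun x y => q (g x) (g y) :=
  ⟨fun x y z => by rw [map_add, hq.add], fun c x z => by rw [map_smul, hq.smul], fun x y => hq.symm _ _, fun x => hq.nonneg _⟩

lemma PForm.rsmul {V : Type} [AddCommGroup V] [Module ℂ V] {q : V → V → ℂ} (hq : PForm q) (r : ℝ) (hr : 0 ≤ r) :
    PForm fun x y => (r:ℂ) * q x y :=
  ⟨fun x y z => by rw [hq.add, mul_add], fun c x z => by rw [hq.smul]; ring, fun x y => by rw [star_mul', hq.symm]; simp,
    fun x => by simpa using mul_nonneg hr (hq.nonneg x)⟩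

lemma PForm.sub {V : Type} [AddCommGroup V] [Module ℂ V] {q q' : V → V → ℂ} (hq : PForm q) (hq' : PForm q') (h : ∀ x, (q' x x).re ≤ (q x x).re) :
    PForm fun x y => q x y - q' x y :=
  ⟨fun x y z => by rw [hq.add, hq'.add]; ring, fun c x z => by rw [hq.smul, hq'.smul]; ring, fun x y => by rw [star_sub, hq.symm, hq'.symm],
    fun x => by rw [Complex.sub_re]; linarith [h x]⟩

section mix
variable {A : Type} [CStarAlgebra A]
variable {τ m n : Type} [Fintype τ] [Fintype m] [Fintype n] [DecidableEq n] [DecidableEq m]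

lemma om_one {R : Matrix n n ℂ} : om R 1 = R.trace := by rw [om_apply, one_mul]

lemma krD_mass {D : n → n → A →ₗ[ℂ] ℂ} (hD : CPf D) (hm : (∑ i, D i i 1).re ≤ 1) (V : τ → Matrix m n ℂ) (hV : (1 - kr V 1).PosSemidef) :
    (∑ i, krD D (fun t => (V t)ᵀ) i i 1).re ≤ 1 := by
  rw [← NM_trace, ← om_one, om_krD]
  refine (om_mono hD.NM_one hV).trans ?_
  rwa [om_one, NM_trace]

def mixD (δ : ℝ) (D : n → n → A →ₗ[ℂ] ℂ) (χ : A →ₗ[ℂ] ℂ) : n → n → A →ₗ[ℂ] ℂ := fun k l =>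
  ((1 - δ : ℝ) : ℂ) • D k l + if k = l then ((δ / (Fintype.card n + 1) : ℝ) : ℂ) • χ else 0

lemma mixD_apply (δ : ℝ) (D : n → n → A →ₗ[ℂ] ℂ) (χ : A →ₗ[ℂ] ℂ) (k l : n) (a : A) :
    mixD δ D χ k l a = ((1 - δ : ℝ) : ℂ) * D k l a + if k = l then ((δ / (Fintype.card n + 1) : ℝ) : ℂ) * χ a else 0 := by
  simp only [mixD]
  split_ifs <;> simp

lemma mixD_cp (δ : ℝ) (h0 : 0 ≤ δ) (h1 : δ ≤ 1) {D : n → n → A →ₗ[ℂ] ℂ} (hD : CPf D) {χ : A →ₗ[ℂ] ℂ} (hχ : QState χ) : CPf (mixD δ D χ) := by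
  intro c
  simp only [mixD_apply, Finset.sum_add_distrib, Finset.sum_ite_eq, Finset.mem_univ, if_true, ← Finset.mul_sum]
  refine add_nonneg (mul_nonneg ?_ (hD c)) (mul_nonneg ?_ (Finset.sum_nonneg fun i _ => hχ.pos _))
  · exact_mod_cast sub_nonneg.2 h1
  · have : (0:ℝ) ≤ δ / (Fintype.card n + 1) := by positivity
    exact_mod_cast this

lemma mixD_mass (δ : ℝ) (h0 : 0 ≤ δ) (h1 : δ ≤ 1) {D : n → n → A →ₗ[ℂ] ℂ} (hm : (∑ i, D i i 1).re ≤ 1) {χ : A →ₗ[ℂ] ℂ} (hχ : χ 1 = 1) :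
    (∑ i, mixD δ D χ i i 1).re ≤ 1 := by
  simp only [mixD_apply, if_true, Finset.sum_add_distrib, ← Finset.mul_sum, hχ, mul_one, Finset.sum_const, Finset.card_univ, nsmul_eq_mul]
  have e : ((((1 - δ : ℝ) : ℂ) * ∑ i, D i i 1) + (Fintype.card n : ℂ) * ((δ / (Fintype.card n + 1) : ℝ) : ℂ)).re
    = (1 - δ) * (∑ i, D i i 1).re + Fintype.card n * (δ / (Fintype.card n + 1)) := by
    rw [Complex.add_re, Complex.re_ofReal_mul, ← Complex.ofReal_natCast, Complex.re_ofReal_mul, Complex.ofReal_re]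
  rw [e]
  have h3 : (Fintype.card n : ℝ) * (δ / (Fintype.card n + 1)) ≤ δ := by
    rw [← mul_div_assoc, div_le_iff₀ (by positivity)]
    nlinarith
  nlinarith

lemma NM_mixD (δ : ℝ) (D : n → n → A →ₗ[ℂ] ℂ) (χ : A →ₗ[ℂ] ℂ) (a : A) :
    NM (mixD δ D χ) a = ((1 - δ : ℝ) : ℂ) • NM D a + (((δ / (Fintype.card n + 1) : ℝ) : ℂ) * χ a) • (1 : Matrix n n ℂ) := by
  ext i j
  rw [NM_apply, mixD_apply, Matrix.add_apply, Matrix.smul_apply, Matrix.smul_apply, NM_apply, Matrix.one_apply, smul_eq_mul, smul_eq_mul]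
  by_cases h : j = i
  · subst h; simp
  · rw [if_neg h, if_neg (Ne.symm h), mul_zero]

lemma mixD_def (δ : ℝ) (h0 : 0 < δ) (h1 : δ ≤ 1) {D : n → n → A →ₗ[ℂ] ℂ} (hD : CPf D) {χ : A →ₗ[ℂ] ℂ} (hχ : χ 1 = 1) :
    (NM (mixD δ D χ) 1).PosDef := by
  rw [NM_mixD, hχ, mul_one]
  refine Matrix.PosDef.posSemidef_add ((hD.NM_one).smul ?_) (Matrix.PosDef.one.smul ?_)
  · exact_mod_cast sub_nonneg.2 h1
  · have : (0:ℝ) < δ / (Fintype.card n + 1) := by positivity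
    exact_mod_cast this

lemma om_mix (δ : ℝ) (D : n → n → A →ₗ[ℂ] ℂ) (χ : A →ₗ[ℂ] ℂ) (a : A) (x : Matrix n n ℂ) :
    om (NM (mixD δ D χ) a) x = ((1 - δ : ℝ) : ℂ) * om (NM D a) x + (((δ / (Fintype.card n + 1) : ℝ) : ℂ) * χ a) * x.trace := by
  rw [NM_mixD, om_apply, Matrix.mul_add, Matrix.trace_add, Matrix.mul_smul, Matrix.mul_smul, Matrix.trace_smul, Matrix.trace_smul, om_apply, mul_one]
  rfl

open scoped Matrix.Norms.L2Operator in
lemma om_mix_err (δ : ℝ) (h0 : 0 ≤ δ) {D : n → n → A →ₗ[ℂ] ℂ} {χ : A →ₗ[ℂ] ℂ} (hχ : QState χ) (a : A) (x : Matrix n n ℂ) :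
    ‖om (NM (mixD δ D χ) a) x - om (NM D a) x‖ ≤ δ * (‖om (NM D a) x‖ + ‖a‖ * ‖x‖) := by
  have e : om (NM (mixD δ D χ) a) x - om (NM D a) x = ((-δ : ℝ) : ℂ) * om (NM D a) x + (((δ / (Fintype.card n + 1) : ℝ) : ℂ) * χ a) * x.trace := by
    rw [om_mix]; push_cast; ring
  rw [e]
  refine (norm_add_le _ _).trans ?_
  have h1 : ‖x.trace‖ ≤ ‖x‖ * (Fintype.card n + 1) := by
    have := om_norm' (R := (1 : Matrix n n ℂ)) Matrix.PosSemidef.one x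
    rw [om_apply, mul_one, Matrix.trace_one, Complex.natCast_re] at this
    nlinarith [norm_nonneg x]
  rw [norm_mul, norm_mul, norm_mul, Complex.norm_real, Complex.norm_real, norm_neg, Real.norm_of_nonneg h0, Real.norm_of_nonneg (by positivity), mul_add]
  refine add_le_add le_rfl ?_
  calc δ / (Fintype.card n + 1) * ‖χ a‖ * ‖x.trace‖ ≤ δ / (Fintype.card n + 1) * ‖a‖ * (‖x‖ * (Fintype.card n + 1)) := by
        gcongr
        exact hχ.le a
    _ = _ := by field_simp

open scoped Matrix.Norms.L2Operator in
lemma ymat {D : n → n → A →ₗ[ℂ] ℂ} (hD : CPf D) {W : Matrix n n ℂ} (hW : W.PosDef) (h : W * W = NM D 1) :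
    ∃ Z : Matrix n n ℂ, Z.IsHermitian ∧ Z * NM D 1 * Z = 1 ∧ (∀ a x, om (NM D a) x = Gm W x (Z * NM D a * Z)ᴴ) ∧
      ∀ a, IsSelfAdjoint a → (Z * NM D a * Z).IsHermitian ∧ ‖Z * NM D a * Z‖ ≤ ‖a‖ := by
  have hu : IsUnit W.det := (Matrix.isUnit_iff_isUnit_det _).1 hW.isUnit
  have e1 : W⁻¹ * W = 1 := Matrix.nonsing_inv_mul _ hu
  have e2 : W * W⁻¹ = 1 := Matrix.mul_nonsing_inv _ hu
  have hZ : (W⁻¹).IsHermitian := hW.1.inv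
  have hZ1 : W⁻¹ * NM D 1 * W⁻¹ = 1 := by
    rw [← h, ← Matrix.mul_assoc, e1, Matrix.one_mul, e2]
  refine ⟨W⁻¹, hZ, hZ1, fun a x => ?_, fun a ha => ?_⟩
  · rw [Gm, Matrix.conjTranspose_conjTranspose, om_apply]
    have : W * x * W * (W⁻¹ * NM D a * W⁻¹) = W * (x * (NM D a * W⁻¹)) := by
      calc _ = W * (x * ((W * W⁻¹) * (NM D a * W⁻¹))) := by simp only [Matrix.mul_assoc]
        _ = _ := by rw [e2, Matrix.one_mul]
    rw [this, Matrix.trace_mul_comm W]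
    have e3 : x * (NM D a * W⁻¹) * W = x * NM D a := by
      calc _ = x * NM D a * (W⁻¹ * W) := by simp only [Matrix.mul_assoc]
        _ = _ := by rw [e1, Matrix.mul_one]
    rw [e3]
  · have hh : (NM D a).IsHermitian := by
      exact herm_of_sub (R := (‖a‖:ℂ) • NM D 1) ((hD.NM_one.smul (show (0:ℂ) ≤ ‖a‖ by exact_mod_cast norm_nonneg a))) (hD.NM_sub a ha)
    have hy : (W⁻¹ * NM D a * W⁻¹).IsHermitian := by
      have := Matrix.isHermitian_conjTranspose_mul_mul W⁻¹ hh
      rwa [hZ.eq] at this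
    refine ⟨hy, matrix_norm_le _ hy _ (norm_nonneg _) ?_ ?_⟩
    · have := (hD.NM_sub a ha).conjTranspose_mul_mul_same W⁻¹
      rw [hZ.eq] at this
      convert this using 1
      rw [Matrix.mul_sub, Matrix.sub_mul, Matrix.mul_smul, Matrix.smul_mul, hZ1]
    · have := (hD.NM_sub (-a) ha.neg).conjTranspose_mul_mul_same W⁻¹
      rw [hZ.eq, norm_neg, map_neg, sub_neg_eq_add] at this
      convert this using 1
      rw [Matrix.mul_add, Matrix.add_mul, Matrix.mul_smul, Matrix.smul_mul, hZ1]
end mix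
end FM

namespace FM
set_option linter.all false
set_option linter.style.haveILetI false
set_option linter.unnecessarySimpa false
open scoped ComplexOrder InnerProductSpace ComplexStarModule
open scoped TensorProduct Topology Kronecker Matrix
open Filter

section kk
variable {A B C T TF : Type} [CStarAlgebra A] [NonUnitalCStarAlgebra B] [NonUnitalCStarAlgebra C] [NonUnitalCStarAlgebra T] [NonUnitalCStarAlgebra TF]
variable {K : Type} [NormedAddCommGroup K] [InnerProductSpace ℂ K] [CompleteSpace K] {ι : Type} [DecidableEq ι]

open scoped Matrix.Norms.L2Operator in
theorem key_gamma {I : Type} (U : Ultrafilter I) (p : I → PT A ι) 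
    {m : Type} [Fintype m] [DecidableEq m] (τ : I → Type) [∀ i, Fintype (τ i)] (V : ∀ i, τ i → Matrix m (p i).S ℂ)
    (hV : ∀ i, (1 - kr (V i) 1).PosSemidef) :
    ∃ D : m → m → A →ₗ[ℂ] ℂ, CPf D ∧ (∑ i, D i i 1).re ≤ 1 ∧
      (∀ a x, Tendsto (fun i => om (NM (p i).D a) (kr (V i) x)) U (𝓝 (om (NM D a) x))) ∧
      ∃ γ : Matrix m m ℂ → Matrix m m ℂ → ℂ, PForm γ ∧ (∀ x y, Tendsto (fun i => Gm (p i).W (kr (V i) x) (kr (V i) y)) U (𝓝 (γ x y))) ∧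
        ∀ x y, ‖γ x y‖ ^ 2 ≤ (om (NM D 1) (x * xᴴ)).re * (om (NM D 1) (yᴴ * y)).re := by
  set Di : I → m → m → A →ₗ[ℂ] ℂ := fun i => krD (p i).D (fun t => (V i t)ᵀ) with hDi
  have hcp : ∀ i, CPf (Di i) := fun i => (p i).cp.krD _
  have hma : ∀ i, (∑ k, Di i k k 1).re ≤ 1 := fun i => krD_mass (p i).cp (p i).mass (V i) (hV i)
  choose D hD using fun k l => ulin U (fun i => Di i k l) (fun a => ⟨1 + ‖a‖ ^ 2, fun i => (hcp i).bound (hma i) k l a⟩)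
  have hDc : CPf D := cpf_lim U Di D hcp hD
  have hlim : ∀ a x, Tendsto (fun i => om (NM (p i).D a) (kr (V i) x)) U (𝓝 (om (NM D a) x)) := by
    intro a x
    have h0 : ∀ i, om (NM (p i).D a) (kr (V i) x) = om (NM (Di i) a) x := fun i => (om_krD (p i).D (V i) a x).symm
    simp only [h0, om_NM]
    exact tendsto_finset_sum _ fun k _ => tendsto_finset_sum _ fun l _ => (hD k l a).const_mul _
  have hgb : ∀ i x y, ‖Gm (p i).W (kr (V i) x) (kr (V i) y)‖ ≤ ‖x‖ * ‖y‖ := fun i x y =>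
    (Gm_norm (p i).W_psd.1 (p i).W_mass _ _).trans (mul_le_mul (kr_norm _ (hV i) _) (kr_norm _ (hV i) _) (norm_nonneg _) (norm_nonneg _))
  choose γ hγ using fun x y => ulim U (fun i => Gm (p i).W (kr (V i) x) (kr (V i) y)) (‖x‖ * ‖y‖) (fun i => hgb i x y)
  refine ⟨D, hDc, ?_, hlim, γ, ?_, hγ, fun x y => ?_⟩
  · refine le_of_tendsto' ((Complex.continuous_re.tendsto _).comp (tendsto_finset_sum _ fun k _ => hD k k 1)) hma
  · exact PForm_lim U _ γ (fun i => PForm_comp (Gm_form (p i).W_psd) (kr (V i))) hγ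
  · refine le_of_tendsto_of_tendsto' ((hγ x y).norm.pow 2)
      (((Complex.continuous_re.tendsto _).comp (hlim 1 (x * xᴴ))).mul ((Complex.continuous_re.tendsto _).comp (hlim 1 (yᴴ * y)))) fun i => ?_
    have h1 := Gm_cs (p i).W_psd.1 (kr (V i) x) (kr (V i) y)
    rw [(p i).W_sq] at h1
    have hR := (p i).cp.NM_one
    have h2 := kr_schwarz (V i) (hV i) y
    have h3 := kr_schwarz (V i) (hV i) xᴴ
    rw [Matrix.conjTranspose_conjTranspose, kr_star, Matrix.conjTranspose_conjTranspose] at h3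
    refine h1.trans (mul_le_mul (om_mono hR h3) (om_mono hR h2) (om_psd hR (Matrix.posSemidef_conjTranspose_mul_self _)) ?_)
    exact (om_psd hR (Matrix.posSemidef_self_mul_conjTranspose _)).trans (om_mono hR h3)

/-- evaluation -/
def PT.ev (p : PT A ι) (σ : B →⋆ₙₐ[ℂ] (K →L[ℂ] K)) (e : HilbertBasis ι ℂ K) (a : A) (b : B) : ℂ :=
  om (NM p.D a) (ph σ e p.S b)

def PT.v (p : PT A ι) (σ : B →⋆ₙₐ[ℂ] (K →L[ℂ] K)) (e : HilbertBasis ι ℂ K) (b : B) : ℝ :=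
  (Gm p.W (ph σ e p.S b) (ph σ e p.S b)).re

lemma PT.v_nonneg (p : PT A ι) (σ : B →⋆ₙₐ[ℂ] (K →L[ℂ] K)) (e : HilbertBasis ι ℂ K) (b : B) : 0 ≤ p.v σ e b :=
  (Gm_form p.W_psd).nonneg _

open scoped Matrix.Norms.L2Operator in
lemma PT.v_le (p : PT A ι) (σ : B →⋆ₙₐ[ℂ] (K →L[ℂ] K)) (e : HilbertBasis ι ℂ K) (b : B) : p.v σ e b ≤ ‖b‖ ^ 2 := by
  refine (Complex.re_le_norm _).trans ((Gm_norm p.W_psd.1 p.W_mass _ _).trans ?_)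
  rw [← sq]
  have := ph_norm σ e p.S b
  gcongr

lemma Gm_sub {n : Type} [Fintype n] [DecidableEq n] {W : Matrix n n ℂ} (hW : W.PosSemidef) (x x' y : Matrix n n ℂ) : Gm W (x - x') y = Gm W x y - Gm W x' y := by
  rw [sub_eq_add_neg, (Gm_form hW).add, ← neg_one_smul ℂ x', (Gm_form hW).smul]; ring

lemma Gm_sub_r {n : Type} [Fintype n] [DecidableEq n] {W : Matrix n n ℂ} (hW : W.PosSemidef) (x y y' : Matrix n n ℂ) : Gm W x (y - y') = Gm W x y - Gm W x y' := by
  rw [← (Gm_form hW).symm, Gm_sub hW, star_sub, (Gm_form hW).symm, (Gm_form hW).symm]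

open scoped Matrix.Norms.L2Operator in
lemma Gm_close {n : Type} [Fintype n] [DecidableEq n] {W : Matrix n n ℂ} (hW : W.PosSemidef) (hm : (W * W).trace.re ≤ 1) (x x' : Matrix n n ℂ) (κ C : ℝ)
    (h : ‖x - x'‖ ≤ κ) (hx : ‖x‖ ≤ C) (hx' : ‖x'‖ ≤ C) : (Gm W x' x').re - 2 * κ * C ≤ (Gm W x x).re := by
  have e : Gm W x x - Gm W x' x' = Gm W (x - x') x + Gm W x' (x - x') := by
    rw [Gm_sub hW, Gm_sub_r hW]; ring
  have h1 := (Gm_norm hW.1 hm (x - x') x)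
  have h2 := (Gm_norm hW.1 hm x' (x - x'))
  have h3 : ‖Gm W x x - Gm W x' x'‖ ≤ 2 * κ * C := by
    rw [e]
    refine (norm_add_le _ _).trans ?_
    have : ‖x - x'‖ * ‖x‖ ≤ κ * C := mul_le_mul h hx (norm_nonneg _) ((norm_nonneg _).trans h)
    have : ‖x'‖ * ‖x - x'‖ ≤ C * κ := mul_le_mul hx' h (norm_nonneg _) ((norm_nonneg _).trans hx')
    linarith
  have := (Complex.abs_re_le_norm _).trans h3
  rw [Complex.sub_re] at this
  linarith [(abs_le.1 this).1]
end kk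
end FM

namespace FM
set_option linter.all false
set_option linter.style.haveILetI false
set_option linter.unnecessarySimpa false
open scoped ComplexOrder InnerProductSpace ComplexStarModule
open scoped TensorProduct Topology Kronecker Matrix
open Filter

section kk
variable {A B C T TF : Type} [CStarAlgebra A] [NonUnitalCStarAlgebra B] [NonUnitalCStarAlgebra C] [NonUnitalCStarAlgebra T] [NonUnitalCStarAlgebra TF]
variable {K : Type} [NormedAddCommGroup K] [InnerProductSpace ℂ K] [CompleteSpace K] {ι : Type} [DecidableEq ι]

open scoped Matrix.Norms.L2Operator in
lemma om_sub {n : Type} [Fintype n] (R x y : Matrix n n ℂ) : om R x - om R y = om R (x - y) := (map_sub _ _ _).symm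

set_option maxHeartbeats 1600000 in
open scoped Matrix.Norms.L2Operator in
theorem key_est (d : TensorData A B T) (dF : TensorData A C TF) (π : B →⋆ₙₐ[ℂ] C) (hπ : Surjective π)
    (Θ : T →⋆ₙₐ[ℂ] TF) (hΘ : ∀ a b, Θ (d.tmul a b) = dF.tmul a (π b)) (hB : IsExactCStar B)
    (σ : B →⋆ₙₐ[ℂ] (K →L[ℂ] K)) (hσ : Injective σ) (e : HilbertBasis ι ℂ K) (χ : A →ₗ[ℂ] ℂ) (hχ : QState χ) (hχ1 : χ 1 = 1)
    {I : Type} (U : Ultrafilter I) (p : I → PT A ι) (Fv : A → B → ℂ)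
    (hp : ∀ a b, Tendsto (fun i => (p i).ev σ e a b) U (𝓝 (Fv a b)))
    (hJ : ∀ b, π b = 0 → Fv 1 b = 0) {J : Type} [Fintype J] (a : J → A) (b : J → B) (ha : ∀ j, IsSelfAdjoint (a j))
    (E0 : Finset (A × B)) (hE0 : ∀ j, (a j, b j) ∈ E0) (ε0 : ℝ) (hε0 : 0 < ε0) (Q η M θ : ℝ) (hη : 0 ≤ η) (hQM : Q ≤ M) (hM : 0 ≤ M) (hθ : 0 < θ) (hθ1 : θ ≤ 1)
    (hQ1 : ∀ q : PT A ι, (∀ x ∈ E0, ‖q.ev σ e x.1 x.2 - Fv x.1 x.2‖ ≤ ε0) → ∑ j, q.v σ e (b j) ≤ Q + η)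
    (hQ2 : ∀ i, Q - η ≤ ∑ j, (p i).v σ e (b j)) :
    ∃ F : T →L[ℂ] ℂ, ‖F‖ ≤ 1 ∧ (∀ t, Θ t = 0 → F t = 0) ∧
      ∀ j, ‖F (d.tmul (a j) (b j)) - Fv (a j) (b j)‖ ≤ θ * ‖a j‖ + ε0 + θ * (‖a j‖ * ‖b j‖) + ‖a j‖ * Real.sqrt (2 * η + θ * M + 2 * θ * ∑ j, ‖b j‖) := by
  classical
  choose Ca hCa0 hCa using fun a : A => evD_bound a
  set C0 := ∑ x ∈ E0, (Ca x.1 + (Ca x.1 * ‖x.2‖ + ‖x.1‖ * ‖x.2‖)) with hC0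
  have hterm : ∀ x : A × B, 0 ≤ Ca x.1 + (Ca x.1 * ‖x.2‖ + ‖x.1‖ * ‖x.2‖) := fun x => by have := hCa0 x.1; positivity
  have hC00 : 0 ≤ C0 := Finset.sum_nonneg fun x _ => hterm x
  set κ := min θ (ε0 / (C0 + 1)) with hκ
  have hκ0 : 0 < κ := lt_min hθ (by positivity)
  have hκθ : κ ≤ θ := min_le_left _ _
  have hκ1 : κ ≤ 1 := hκθ.trans hθ1
  have hκC : κ * C0 ≤ ε0 := by
    have h1 : κ ≤ ε0 / (C0 + 1) := min_le_right _ _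
    rw [le_div_iff₀ (by positivity)] at h1
    nlinarith
  obtain ⟨S, hS⟩ := kraus_approx' hB σ hσ e (E0.image Prod.snd) κ hκ0
  choose τ iτ V hV hVE using fun i => hS (p i).S
  have hVE' : ∀ i, ∀ x ∈ E0, ‖kr (V i) (ph σ e S x.2) - ph σ e (p i).S x.2‖ ≤ κ := fun i x hx => hVE i _ (Finset.mem_image_of_mem _ hx)
  obtain ⟨D, hD, hDm, hlim, γ, hγ, hγl, hγb⟩ := key_gamma U p τ V hV
  set P : PT A ι := ⟨S, mixD κ D χ, mixD_cp κ hκ0.le hκ1 hD hχ, mixD_mass κ hκ0.le hκ1 hDm hχ1⟩ with hP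
  have hPev : ∀ x ∈ E0, ‖P.ev σ e x.1 x.2 - Fv x.1 x.2‖ ≤ ε0 := by
    intro x hx
    have h1 : ‖om (NM D x.1) (ph σ e S x.2) - Fv x.1 x.2‖ ≤ κ * Ca x.1 := by
      refine le_of_tendsto' ((hlim x.1 (ph σ e S x.2)).sub (hp x.1 x.2)).norm fun i => ?_
      rw [PT.ev, om_sub, mul_comm]
      refine (hCa x.1 _ _ (p i).cp (p i).mass _).trans ?_
      exact mul_le_mul_of_nonneg_left (hVE' i x hx) (hCa0 _)
    have h2 : ‖om (NM D x.1) (ph σ e S x.2)‖ ≤ Ca x.1 * ‖x.2‖ := (hCa x.1 _ _ hD hDm _).trans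
      (mul_le_mul_of_nonneg_left (ph_norm _ _ _ _) (hCa0 _))
    have h3 : ‖P.ev σ e x.1 x.2 - om (NM D x.1) (ph σ e S x.2)‖ ≤ κ * (Ca x.1 * ‖x.2‖ + ‖x.1‖ * ‖x.2‖) := by
      refine (om_mix_err κ hκ0.le (D := D) hχ x.1 (ph σ e S x.2)).trans ?_
      refine mul_le_mul_of_nonneg_left (add_le_add h2 ?_) hκ0.le
      exact mul_le_mul_of_nonneg_left (ph_norm _ _ _ _) (norm_nonneg _)
    have h4 : Ca x.1 + (Ca x.1 * ‖x.2‖ + ‖x.1‖ * ‖x.2‖) ≤ C0 := Finset.single_le_sum (f := fun x : A × B => Ca x.1 + (Ca x.1 * ‖x.2‖ + ‖x.1‖ * ‖x.2‖)) (fun x _ => hterm x) hx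
    calc ‖P.ev σ e x.1 x.2 - Fv x.1 x.2‖ ≤ ‖P.ev σ e x.1 x.2 - om (NM D x.1) (ph σ e S x.2)‖ + ‖om (NM D x.1) (ph σ e S x.2) - Fv x.1 x.2‖ := norm_sub_le_norm_sub_add_norm_sub _ _ _
      _ ≤ κ * (Ca x.1 + (Ca x.1 * ‖x.2‖ + ‖x.1‖ * ‖x.2‖)) := by linarith
      _ ≤ κ * C0 := mul_le_mul_of_nonneg_left h4 hκ0.le
      _ ≤ ε0 := hκC
  have hPv := hQ1 P hPev
  have hWd : P.W.PosDef := psd_sqrt_def (mixD_def κ hκ0 hκ1 hD hχ1) P.W_psd P.W_sq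
  obtain ⟨Z, hZ, hZ1, hZG, hZa⟩ := ymat P.cp hWd P.W_sq
  obtain ⟨F, hF1, hF2, hF3⟩ := key_psi d dF π hπ Θ hΘ σ e U p (fun b hb => by
    have := hp 1 (b * star b)
    rw [hJ (b * star b) (by rw [map_mul, hb, zero_mul])] at this
    exact this) τ V hV P.D P.cp Z hZ hZ1
  refine ⟨F, hF1, hF2, ?_⟩
  -- the form q
  have hk0 : (0:ℝ) ≤ 1 - κ := by linarith
  have hmixR : ∀ x : Matrix S S ℂ, x.PosSemidef → (1 - κ) * (om (NM D 1) x).re ≤ (om (P.W * P.W) x).re := by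
    intro x hx
    rw [P.W_sq]
    have h1 : om (NM P.D 1) x = _ := om_mix κ D χ 1 x
    rw [h1, hχ1, mul_one, Complex.add_re, Complex.re_ofReal_mul, Complex.re_ofReal_mul]
    have h2 : 0 ≤ κ / (Fintype.card S + 1) * x.trace.re := mul_nonneg (by positivity) (Complex.le_def.1 hx.trace_nonneg).1
    linarith
  have hgam : PForm fun x y => (((1 - κ : ℝ) : ℂ)) * γ x y := hγ.rsmul _ hk0
  have hq : PForm fun x y => Gm P.W x y - (((1 - κ : ℝ) : ℂ)) * γ x y := by
    refine (Gm_form P.W_psd).sub hgam (Gm_max hWd hgam fun x y => ?_)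
    have hx := hmixR (x * xᴴ) (Matrix.posSemidef_self_mul_conjTranspose _)
    have hy := hmixR (yᴴ * y) (Matrix.posSemidef_conjTranspose_mul_self _)
    have hx0 := om_psd hD.NM_one (Matrix.posSemidef_self_mul_conjTranspose x)
    have hy0 := om_psd hD.NM_one (Matrix.posSemidef_conjTranspose_mul_self y)
    rw [norm_mul, Complex.norm_real, Real.norm_of_nonneg hk0, mul_pow]
    calc (1 - κ) ^ 2 * ‖γ x y‖ ^ 2 ≤ (1 - κ) ^ 2 * ((om (NM D 1) (x * xᴴ)).re * (om (NM D 1) (yᴴ * y)).re) := mul_le_mul_of_nonneg_left (hγb x y) (by positivity)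
      _ = ((1 - κ) * (om (NM D 1) (x * xᴴ)).re) * ((1 - κ) * (om (NM D 1) (yᴴ * y)).re) := by ring
      _ ≤ _ := mul_le_mul hx hy (mul_nonneg hk0 hy0) ((mul_nonneg hk0 hx0).trans hx)
  set L := ∑ j, ‖b j‖ with hL
  -- sum of gammas
  have hgs : Q - η - 2 * κ * L ≤ ∑ j, (γ (ph σ e S (b j)) (ph σ e S (b j))).re := by
    refine ge_of_tendsto' (tendsto_finset_sum _ fun j _ => (Complex.continuous_re.tendsto _).comp (hγl (ph σ e S (b j)) (ph σ e S (b j)))) fun i => ?_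
    have h1 : ∀ j, (p i).v σ e (b j) - 2 * κ * ‖b j‖ ≤ (Gm (p i).W (kr (V i) (ph σ e S (b j))) (kr (V i) (ph σ e S (b j)))).re := fun j =>
      Gm_close (p i).W_psd (p i).W_mass _ _ κ ‖b j‖ (hVE' i (a j, b j) (hE0 j)) ((kr_norm _ (hV i) _).trans (ph_norm _ _ _ _)) (ph_norm _ _ _ _)
    have h2 := Finset.sum_le_sum fun j (_ : j ∈ Finset.univ) => h1 j
    rw [Finset.sum_sub_distrib, ← Finset.mul_sum] at h2
    have h3 := hQ2 i
    simp only [Function.comp]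
    linarith
  have hL0 : 0 ≤ L := Finset.sum_nonneg fun j _ => norm_nonneg _
  set R := 2 * η + θ * M + 2 * θ * L with hR
  have hqs : ∑ j, (Gm P.W (ph σ e S (b j)) (ph σ e S (b j)) - (((1 - κ : ℝ) : ℂ)) * γ (ph σ e S (b j)) (ph σ e S (b j))).re ≤ R := by
    simp only [Complex.sub_re, Complex.re_ofReal_mul]
    rw [Finset.sum_sub_distrib, ← Finset.mul_sum]
    have h1 : ∑ j, (Gm P.W (ph σ e S (b j)) (ph σ e S (b j))).re ≤ Q + η := hPv
    have h2 := mul_le_mul_of_nonneg_left hgs hk0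
    have h3 : κ * Q ≤ κ * M := by gcongr
    have h4 : κ * M ≤ θ * M := by gcongr
    have h5 : κ * L ≤ θ * L := by gcongr
    have h6 : 0 ≤ κ * η := by positivity
    have h7 : 0 ≤ κ * (κ * L) := by positivity
    rw [hR]
    nlinarith
  intro j
  obtain ⟨hyh, hyn⟩ := hZa (a j) (ha j)
  set y := Z * NM P.D (a j) * Z with hy
  set x := ph σ e S (b j) with hx
  have hqx : (Gm P.W x x - (((1 - κ : ℝ) : ℂ)) * γ x x).re ≤ R :=
    (Finset.single_le_sum (f := fun j => (Gm P.W (ph σ e S (b j)) (ph σ e S (b j)) - (((1 - κ : ℝ) : ℂ)) * γ (ph σ e S (b j)) (ph σ e S (b j))).re)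
      (fun j _ => hq.nonneg _) (Finset.mem_univ j)).trans hqs
  have hqy : (Gm P.W y y - (((1 - κ : ℝ) : ℂ)) * γ y y).re ≤ ‖a j‖ ^ 2 := by
    rw [Complex.sub_re]
    have h1 := hgam.nonneg y
    have h2 := (Complex.re_le_norm _).trans (Gm_norm hWd.1 P.W_mass y y)
    nlinarith [norm_nonneg y]
  have hR0 : 0 ≤ R := (hq.nonneg x).trans hqx
  have hqn : ‖Gm P.W x y - (((1 - κ : ℝ) : ℂ)) * γ x y‖ ≤ ‖a j‖ * Real.sqrt R := by
    have h1 : ‖Gm P.W x y - (((1 - κ : ℝ) : ℂ)) * γ x y‖ ^ 2 ≤ R * ‖a j‖ ^ 2 := (hq.cs x y).trans (mul_le_mul hqx hqy (hq.nonneg _) hR0)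
    refine le_of_sq_le_sq (h1.trans_eq ?_) (by positivity)
    rw [mul_pow, Real.sq_sqrt hR0]; ring
  have hγn : ‖γ x y‖ ≤ ‖b j‖ * ‖a j‖ := by
    refine le_of_tendsto' (hγl x y).norm fun i => ?_
    refine (Gm_norm (p i).W_psd.1 (p i).W_mass _ _).trans ?_
    exact mul_le_mul ((kr_norm _ (hV i) _).trans (ph_norm _ _ _ _)) ((kr_norm _ (hV i) _).trans hyn) (norm_nonneg _) (norm_nonneg _)
  have hFγ : ‖F (d.tmul (a j) (b j)) - γ x y‖ ≤ κ * ‖a j‖ := by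
    have h0 := hF3 (a j) (b j)
    rw [← hy, hyh.eq] at h0
    refine le_of_tendsto' (h0.sub (hγl x y)).norm fun i => ?_
    rw [← Gm_sub (p i).W_psd]
    refine (Gm_norm (p i).W_psd.1 (p i).W_mass _ _).trans ?_
    refine mul_le_mul ?_ ((kr_norm _ (hV i) _).trans hyn) (norm_nonneg _) hκ0.le
    rw [norm_sub_rev]
    exact hVE' i (a j, b j) (hE0 j)
  have hPF : ‖Gm P.W x y - Fv (a j) (b j)‖ ≤ ε0 := by
    have h1 := hPev _ (hE0 j)
    have h2 : P.ev σ e (a j) (b j) = Gm P.W x y := by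
      rw [PT.ev, hZG, ← hy, hyh.eq]
    rwa [h2] at h1
  have key : F (d.tmul (a j) (b j)) - Fv (a j) (b j) = (F (d.tmul (a j) (b j)) - γ x y) - (Gm P.W x y - (((1 - κ : ℝ) : ℂ)) * γ x y) + (Gm P.W x y - Fv (a j) (b j)) + (κ : ℂ) * γ x y := by
    push_cast; ring
  rw [key]
  refine (norm_add_le _ _).trans ?_
  have hA := norm_add_le ((F (d.tmul (a j) (b j)) - γ x y) - (Gm P.W x y - (((1 - κ : ℝ) : ℂ)) * γ x y)) (Gm P.W x y - Fv (a j) (b j))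
  have hB' := norm_sub_le (F (d.tmul (a j) (b j)) - γ x y) (Gm P.W x y - (((1 - κ : ℝ) : ℂ)) * γ x y)
  have hC' : ‖(κ : ℂ) * γ x y‖ ≤ θ * (‖a j‖ * ‖b j‖) := by
    rw [norm_mul, Complex.norm_real, Real.norm_of_nonneg hκ0.le, mul_comm ‖a j‖]
    exact mul_le_mul hκθ hγn (norm_nonneg _) hθ.le
  have hD' : κ * ‖a j‖ ≤ θ * ‖a j‖ := by gcongr
  linarith
end kk
end FM

namespace FM
set_option linter.all false
set_option linter.style.haveILetI false
set_option linter.unnecessarySimpa false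
open scoped ComplexOrder InnerProductSpace ComplexStarModule
open scoped TensorProduct Topology Kronecker Matrix
open Filter

section kk
variable {A B C T TF : Type} [CStarAlgebra A] [NonUnitalCStarAlgebra B] [NonUnitalCStarAlgebra C] [NonUnitalCStarAlgebra T] [NonUnitalCStarAlgebra TF]
variable {K : Type} [NormedAddCommGroup K] [InnerProductSpace ℂ K] [CompleteSpace K] {ι : Type} [DecidableEq ι]

lemma sa_decomp (z : A ⊗[ℂ] B) : ∃ (J : Type) (_ : Fintype J) (a : J → A) (b : J → B), (∀ j, IsSelfAdjoint (a j)) ∧ z = ∑ j, a j ⊗ₜ b j := by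
  induction z using TensorProduct.induction_on with
  | zero => exact ⟨Empty, inferInstance, fun j => j.elim, fun j => j.elim, fun j => j.elim, by simp⟩
  | tmul a b =>
    refine ⟨Bool, inferInstance, fun j => if j then (ℜ a : A) else (ℑ a : A), fun j => if j then b else Complex.I • b, ?_, ?_⟩
    · rintro (_ | _)
      · simpa using (ℑ a).2
      · simpa using (ℜ a).2
    · rw [Fintype.sum_bool]
      simp only [if_true, Bool.false_eq_true, if_false]
      rw [← TensorProduct.smul_tmul, ← TensorProduct.add_tmul, realPart_add_I_smul_imaginaryPart]
  | add x y hx hy =>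
    obtain ⟨J1, i1, a1, b1, h1, e1⟩ := hx
    obtain ⟨J2, i2, a2, b2, h2, e2⟩ := hy
    refine ⟨J1 ⊕ J2, inferInstance, Sum.elim a1 a2, Sum.elim b1 b2, ?_, ?_⟩
    · rintro (j | j)
      · exact h1 j
      · exact h2 j
    · rw [Fintype.sum_sum_type, e1, e2]; rfl

lemma exists_chi [Nontrivial A] : ∃ χ : A →ₗ[ℂ] ℂ, QState χ ∧ χ 1 = 1 := by
  letI := CStarAlgebra.spectralOrder A
  haveI := CStarAlgebra.spectralOrderedRing A
  obtain ⟨g, hg, h⟩ := exists_qstate_pp (1 : A) (IsSelfAdjoint.one A)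
  have h1 : ((1 : A)⁺) = 1 := (CFC.posPart_eq_self _).2 zero_le_one
  rw [h1, CStarRing.norm_one] at h
  have h2 := hg.pos 1
  rw [star_one, one_mul] at h2
  refine ⟨g, hg, Complex.ext (by simpa using h) ?_⟩
  simpa using (Complex.le_def.1 h2).2.symm

lemma pick_theta {J : Type} [Fintype J] (x y : J → ℝ) (M L ε : ℝ) (hε : 0 < ε) :
    ∃ θ : ℝ, 0 < θ ∧ θ ≤ 1 ∧ ∀ j, θ * x j + θ + θ * (x j * y j) + x j * Real.sqrt (2 * θ + θ * M + 2 * θ * L) ≤ ε := by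
  have h1 : ∀ j, Tendsto (fun θ : ℝ => θ * x j + θ + θ * (x j * y j) + x j * Real.sqrt (2 * θ + θ * M + 2 * θ * L)) (𝓝[>] 0) (𝓝 0) := by
    intro j
    have hc : Continuous (fun θ : ℝ => θ * x j + θ + θ * (x j * y j) + x j * Real.sqrt (2 * θ + θ * M + 2 * θ * L)) := by fun_prop
    have := hc.tendsto 0
    simp only [zero_mul, mul_zero, add_zero, Real.sqrt_zero] at this
    exact this.mono_left nhdsWithin_le_nhds
  have h2 : ∀ᶠ θ in 𝓝[>] (0:ℝ), ∀ j, θ * x j + θ + θ * (x j * y j) + x j * Real.sqrt (2 * θ + θ * M + 2 * θ * L) ≤ ε :=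
    eventually_all.2 fun j => ((h1 j).eventually_lt_const hε).mono fun _ h => h.le
  have h3 : ∀ᶠ θ in 𝓝[>] (0:ℝ), θ ≤ 1 := by
    have : ∀ᶠ θ in 𝓝 (0:ℝ), θ ≤ 1 := (eventually_lt_nhds one_pos).mono fun _ h => h.le
    exact this.filter_mono nhdsWithin_le_nhds
  obtain ⟨θ, ⟨h2, h3⟩, h4⟩ := ((h2.and h3).and self_mem_nhdsWithin).exists
  exact ⟨θ, h4, h3, h2⟩

theorem key_step [Nontrivial A] (d : TensorData A B T) (dF : TensorData A C TF) (π : B →⋆ₙₐ[ℂ] C) (hπ : Surjective π)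
    (Θ : T →⋆ₙₐ[ℂ] TF) (hΘ : ∀ a b, Θ (d.tmul a b) = dF.tmul a (π b)) (hB : IsExactCStar B)
    (σ : B →⋆ₙₐ[ℂ] (K →L[ℂ] K)) (hσ : Injective σ) (e : HilbertBasis ι ℂ K)
    (F : T →ₗ[ℂ] ℂ) (hFj : ∀ b, π b = 0 → F (d.tmul 1 b) = 0)
    (NB : ∀ (E : Finset (A × B)) (ε : ℝ), 0 < ε → ∃ p : PT A ι, ∀ x ∈ E, ‖p.ev σ e x.1 x.2 - F (d.tmul x.1 x.2)‖ ≤ ε)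
    {J : Type} [Fintype J] (a : J → A) (b : J → B) (ha : ∀ j, IsSelfAdjoint (a j)) (ε : ℝ) (hε : 0 < ε) :
    ∃ Fk : T →L[ℂ] ℂ, ‖Fk‖ ≤ 1 ∧ (∀ t, Θ t = 0 → Fk t = 0) ∧ ∀ j, ‖Fk (d.tmul (a j) (b j)) - F (d.tmul (a j) (b j))‖ ≤ ε := by
  classical
  obtain ⟨χ, hχ, hχ1⟩ := exists_chi (A := A)
  set M := ∑ j, ‖b j‖ ^ 2 with hM
  obtain ⟨θ, hθ, hθ1, hθe⟩ := pick_theta (fun j => ‖a j‖) (fun j => ‖b j‖) M (∑ j, ‖b j‖) ε hε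
  set N : Finset (A × B) × ℕ → Set (PT A ι) := fun i => {p | ∀ x ∈ i.1, ‖p.ev σ e x.1 x.2 - F (d.tmul x.1 x.2)‖ ≤ 1 / ((i.2 : ℝ) + 1)} with hN
  obtain ⟨Q, hQM, ⟨i0, hi0⟩, hQ⟩ := ex_level N (fun i => NB i.1 _ (by positivity)) (fun p => ∑ j, p.v σ e (b j)) M
    (fun p => Finset.sum_nonneg fun j _ => p.v_nonneg σ e _) (fun p => Finset.sum_le_sum fun j _ => p.v_le σ e _) θ hθ
  choose p hpN hpQ using hQ
  set U := Ultrafilter.of (atTop : Filter (Finset (A × B) × ℕ)) with hU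
  have hp : ∀ a b, Tendsto (fun i => (p i).ev σ e a b) U (𝓝 (F (d.tmul a b))) := by
    intro a b
    refine Tendsto.mono_left ?_ (Ultrafilter.of_le _)
    rw [Metric.tendsto_atTop]
    intro δ hδ
    obtain ⟨n, hn⟩ := exists_nat_one_div_lt hδ
    refine ⟨({(a, b)}, n), fun i hi => ?_⟩
    rw [dist_eq_norm]
    refine (hpN i (a, b) (hi.1 (Finset.mem_singleton_self _))).trans_lt (lt_of_le_of_lt ?_ hn)
    have : (n : ℝ) ≤ i.2 := by exact_mod_cast hi.2
    gcongr
  obtain ⟨n, hn⟩ := exists_nat_one_div_lt hθ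
  set E0 : Finset (A × B) := i0.1 ∪ Finset.univ.image (fun j => (a j, b j)) with hE0
  obtain ⟨Fk, h1, h2, h3⟩ := key_est d dF π hπ Θ hΘ hB σ hσ e χ hχ hχ1 U p (fun a b => F (d.tmul a b)) hp hFj a b ha E0
    (fun j => Finset.mem_union_right _ (Finset.mem_image_of_mem _ (Finset.mem_univ j))) (1 / ((max i0.2 n : ℕ) + 1 : ℝ)) (by positivity) Q θ M θ hθ.le hQM (by positivity) hθ hθ1
    (fun q hq => hi0 q fun x hx => (hq x (Finset.mem_union_left _ hx)).trans (by
      have : (i0.2 : ℝ) ≤ (max i0.2 n : ℕ) := by exact_mod_cast le_max_left _ _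
      gcongr)) hpQ
  refine ⟨Fk, h1, h2, fun j => (h3 j).trans (le_trans ?_ (hθe j))⟩
  have : 1 / ((max i0.2 n : ℕ) + 1 : ℝ) ≤ θ := by
    refine le_trans ?_ hn.le
    have : (n : ℝ) ≤ (max i0.2 n : ℕ) := by exact_mod_cast le_max_right _ _
    gcongr
  linarith

theorem key_kill [Nontrivial A] (d : TensorData A B T) (dF : TensorData A C TF) (π : B →⋆ₙₐ[ℂ] C) (hπ : Surjective π)
    (Θ : T →⋆ₙₐ[ℂ] TF) (hΘ : ∀ a b, Θ (d.tmul a b) = dF.tmul a (π b)) (hB : IsExactCStar B)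
    (σ : B →⋆ₙₐ[ℂ] (K →L[ℂ] K)) (hσ : Injective σ) (e : HilbertBasis ι ℂ K)
    (F : T →ₗ[ℂ] ℂ) (hFle : ∀ t, ‖F t‖ ≤ ‖t‖) (hFj : ∀ b, π b = 0 → F (d.tmul 1 b) = 0)
    (NB : ∀ (E : Finset (A × B)) (ε : ℝ), 0 < ε → ∃ p : PT A ι, ∀ x ∈ E, ‖p.ev σ e x.1 x.2 - F (d.tmul x.1 x.2)‖ ≤ ε)
    (t : T) (ht : Θ t = 0) : F t = 0 := by
  by_contra hne
  have hpos : 0 < ‖F t‖ / 4 := by have := norm_pos_iff.2 hne; positivity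
  obtain ⟨_, hz, ⟨z, rfl⟩⟩ := Metric.dense_iff.1 (TJ_dense d) t _ hpos
  rw [Metric.mem_ball, dist_eq_norm] at hz
  obtain ⟨J, _, a, b, ha, rfl⟩ := sa_decomp z
  obtain ⟨Fk, h1, h2, h3⟩ := key_step d dF π hπ Θ hΘ hB σ hσ e F hFj NB a b ha (‖F t‖ / 4 / (Fintype.card J + 1)) (by positivity)
  set z := TJ d (∑ j, a j ⊗ₜ b j) with hzd
  have hz2 : ‖Fk z - F z‖ ≤ ‖F t‖ / 4 := by
    rw [hzd, map_sum, map_sum, map_sum, ← Finset.sum_sub_distrib]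
    simp only [TJ_tmul]
    refine (norm_sum_le _ _).trans ((Finset.sum_le_sum fun j _ => h3 j).trans ?_)
    rw [Finset.sum_const, Finset.card_univ, nsmul_eq_mul, ← mul_div_assoc, div_le_iff₀ (by positivity)]
    nlinarith
  have e1 : F t = (Fk z - Fk t) - (F z - F t) - (Fk z - F z) := by rw [h2 t ht]; ring
  have h4 : ‖Fk z - Fk t‖ ≤ ‖z - t‖ := by
    rw [← map_sub]
    exact (Fk.le_opNorm _).trans (by nlinarith [norm_nonneg (z - t)])
  have h5 : ‖F z - F t‖ ≤ ‖z - t‖ := by rw [← map_sub]; exact hFle _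
  have h6 := norm_sub_le ((Fk z - Fk t) - (F z - F t)) (Fk z - F z)
  have h7 := norm_sub_le (Fk z - Fk t) (F z - F t)
  rw [← e1] at h6
  linarith
end kk
end FM

namespace FM
set_option linter.all false
set_option linter.style.haveILetI false
set_option linter.unnecessarySimpa false
open scoped ComplexOrder InnerProductSpace ComplexStarModule
open scoped TensorProduct Topology Kronecker Matrix
open Filter

section pext
variable {A : Type} [CStarAlgebra A] {ι : Type} 

lemma sum_incl [DecidableEq ι] {S : Finset ι} (k : ι) (hk : k ∈ S) (f : S → ℂ) :
    ∑ i : S, (if k = (i : ι) then (1:ℂ) else 0) * f i = f ⟨k, hk⟩ := by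
  rw [Finset.sum_eq_single (⟨k, hk⟩ : S)]
  · simp
  · intro b _ hb
    rw [if_neg, zero_mul]
    rintro rfl
    exact hb rfl
  · simp

lemma pt_extend [DecidableEq ι] (p : PT A ι) (S : Finset ι) (h : p.S ⊆ S) : ∃ D : S → S → A →ₗ[ℂ] ℂ, CPf D ∧
    ∀ (G : S → S → ℂ) a, ∑ i, ∑ j, D i j a * G i j = ∑ k : p.S, ∑ l : p.S, p.D k l a * G ⟨k, h k.2⟩ ⟨l, h l.2⟩ := by
  let Q : Unit → Matrix p.S S ℂ := fun _ => Matrix.of fun k i => if (k : ι) = (i : ι) then (1:ℂ) else 0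
  refine ⟨krD p.D Q, p.cp.krD Q, fun G a => ?_⟩
  have h1 : ∀ i j : S, krD p.D Q i j a * G i j = ∑ k : p.S, ∑ l : p.S, 
     p.D k l a * ((if (k:ι) = (i:ι) then (1:ℂ) else 0) * ((if (l:ι) = (j:ι) then (1:ℂ) else 0) * G i j)) := by
    intro i j
    rw [krD_apply]
    simp only [Finset.univ_unique, Finset.sum_singleton, Finset.sum_mul]
    refine Finset.sum_congr rfl fun k _ => Finset.sum_congr rfl fun l _ => ?_
    simp only [Q, Matrix.of_apply]
    split_ifs <;> simp
  simp only [h1]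
  have h2 : ∀ k l : p.S, ∑ i : S, ∑ j : S, p.D k l a * ((if (k:ι) = (i:ι) then (1:ℂ) else 0) * ((if (l:ι) = (j:ι) then (1:ℂ) else 0) * G i j))
     = p.D k l a * G ⟨k, h k.2⟩ ⟨l, h l.2⟩ := by
    intro k l
    simp only [← Finset.mul_sum]
    congr 1
    rw [← sum_incl (k:ι) (h k.2) fun i => G i ⟨l, h l.2⟩]
    refine Finset.sum_congr rfl fun i _ => ?_
    rw [sum_incl (l:ι) (h l.2) fun j => G i j]
  simp only [← h2]
  calc _ = ∑ i : S, ∑ k : p.S, ∑ j : S, ∑ l : p.S, _ := Finset.sum_congr rfl fun i _ => Finset.sum_comm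
    _ = ∑ k : p.S, ∑ i : S, ∑ j : S, ∑ l : p.S, _ := Finset.sum_comm
    _ = ∑ k : p.S, ∑ i : S, ∑ l : p.S, ∑ j : S, _ := Finset.sum_congr rfl fun i _ => Finset.sum_congr rfl fun i _ => Finset.sum_comm
    _ = _ := Finset.sum_congr rfl fun i _ => Finset.sum_comm

lemma CPf.add' {A n : Type} [NonUnitalCStarAlgebra A] [Fintype n] {D E : n → n → A →ₗ[ℂ] ℂ} (hD : CPf D) (hE : CPf E) :
    CPf (fun i j => D i j + E i j) := by
  intro c
  simp only [LinearMap.add_apply, Finset.sum_add_distrib]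
  exact add_nonneg (hD c) (hE c)

lemma CPf.smul' {A n : Type} [NonUnitalCStarAlgebra A] [Fintype n] {D : n → n → A →ₗ[ℂ] ℂ} (hD : CPf D) (r : ℝ) (hr : 0 ≤ r) :
    CPf (fun i j => (r : ℂ) • D i j) := by
  intro c
  simp only [LinearMap.smul_apply, smul_eq_mul, ← Finset.mul_sum]
  exact mul_nonneg (by exact_mod_cast hr) (hD c)

variable {B : Type} [NonUnitalCStarAlgebra B]
variable {K : Type} [NormedAddCommGroup K] [InnerProductSpace ℂ K] [CompleteSpace K]

def PT.evL (p : PT A ι) (σ : B →⋆ₙₐ[ℂ] (K →L[ℂ] K)) (e : HilbertBasis ι ℂ K) : A ⊗[ℂ] B →ₗ[ℂ] ℂ :=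
  prodF p.D (fun i j => vf σ (e i) (e j))

lemma PT.evL_tmul (p : PT A ι) (σ : B →⋆ₙₐ[ℂ] (K →L[ℂ] K)) (e : HilbertBasis ι ℂ K) (a b) :
    p.evL σ e (a ⊗ₜ b) = p.ev σ e a b := by
  classical
  rw [PT.evL, prodF_tmul, PT.ev, om_NM]
  exact Finset.sum_congr rfl fun i _ => Finset.sum_congr rfl fun j _ => mul_comm _ _

lemma pt_mix (p q : PT A ι) (σ : B →⋆ₙₐ[ℂ] (K →L[ℂ] K)) (e : HilbertBasis ι ℂ K) (s t : ℝ) (hs : 0 ≤ s) (ht : 0 ≤ t) (hst : s + t = 1) :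
    ∃ r : PT A ι, r.evL σ e = (s : ℂ) • p.evL σ e + (t : ℂ) • q.evL σ e := by
  classical
  obtain ⟨D, hD, hDe⟩ := pt_extend p (p.S ∪ q.S) Finset.subset_union_left
  obtain ⟨E, hE, hEe⟩ := pt_extend q (p.S ∪ q.S) Finset.subset_union_right
  have hm : ∀ (S S' : Finset ι) (h : S ⊆ S') (D' : S' → S' → A →ₗ[ℂ] ℂ) (D : S → S → A →ₗ[ℂ] ℂ), (∀ (G : S' → S' → ℂ) a, ∑ i, ∑ j, D' i j a * G i j = ∑ k : S, ∑ l : S, D k l a * G ⟨k, h k.2⟩ ⟨l, h l.2⟩) → ∑ i, D' i i 1 = ∑ i, D i i 1 := by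
    intro S S' h D' D hh
    have := hh (fun i j => if i = j then 1 else 0) 1
    simpa [Subtype.ext_iff, ← Subtype.ext_iff] using this
  refine ⟨⟨p.S ∪ q.S, fun i j => (s : ℂ) • D i j + (t : ℂ) • E i j, (hD.smul' s hs).add' (hE.smul' t ht), ?_⟩, ?_⟩
  · simp only [LinearMap.add_apply, LinearMap.smul_apply, smul_eq_mul, Finset.sum_add_distrib, ← Finset.mul_sum]
    rw [hm _ _ _ _ _ hDe, hm _ _ _ _ _ hEe, Complex.add_re, Complex.re_ofReal_mul, Complex.re_ofReal_mul]
    nlinarith [p.mass, q.mass]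
  · ext a b
    simp only [TensorProduct.AlgebraTensorModule.curry_apply, LinearMap.restrictScalars_self, TensorProduct.curry_apply, LinearMap.add_apply, LinearMap.smul_apply, PT.evL, prodF_tmul, smul_eq_mul, add_mul, Finset.sum_add_distrib, mul_assoc, ← Finset.mul_sum]
    rw [hDe fun i j => vf σ (e i) (e j) b, hEe fun i j => vf σ (e i) (e j) b]

variable {H : Type} [NormedAddCommGroup H] [InnerProductSpace ℂ H] [CompleteSpace H]

lemma vf_cpf {S : Type} [Fintype S] {C : Type} [NonUnitalCStarAlgebra C] (π : C →⋆ₙₐ[ℂ] (H →L[ℂ] H)) (ξ : S → H) : CPf (fun k l : S => vf π (ξ k) (ξ l)) := by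
  intro c
  have h : ∑ i : S, ∑ j : S, vf π (ξ i) (ξ j) (star (c i) * c j) = ((‖∑ j : S, π (c j) (ξ j)‖ ^ 2 : ℝ) : ℂ) := by
    have := inner_self_eq_norm_sq_to_K (𝕜 := ℂ) (∑ j : S, π (c j) (ξ j))
    rw [Complex.ofReal_pow]
    refine Eq.trans ?_ this
    rw [sum_inner]
    refine Finset.sum_congr rfl fun i _ => ?_
    rw [inner_sum]
    refine Finset.sum_congr rfl fun j _ => ?_
    rw [vf_apply, map_mul, map_star]
    change ⟪ξ i, star (π (c i)) (π (c j) _)⟫_ℂ = _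
    rw [ContinuousLinearMap.star_eq_adjoint, ContinuousLinearMap.adjoint_inner_right]
  rw [h]
  exact_mod_cast sq_nonneg (‖∑ j : S, π (c j) (ξ j)‖ : ℝ)

lemma vft_basis (π : A →⋆ₙₐ[ℂ] (H →L[ℂ] H)) (σ : B →⋆ₙₐ[ℂ] (K →L[ℂ] K)) (e : HilbertBasis ι ℂ K) (S : Finset ι) (ξ : ι → H) :
    vft π σ (hti H K (∑ i ∈ S, ξ i ⊗ₜ[ℂ] e i)) = prodF (fun i j : S => vf π (ξ i) (ξ j)) (fun i j : S => vf σ (e i) (e j)) := by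
  rw [← Finset.sum_coe_sort S]
  ext a b
  simp only [TensorProduct.AlgebraTensorModule.curry_apply, LinearMap.restrictScalars_self, TensorProduct.curry_apply,
    prodF_tmul, vf_apply]
  change ⟪_, rho π σ (a ⊗ₜ b) _⟫_ℂ = _
  rw [rho_tmul, RT_coe, LinearIsometry.inner_map_map]
  simp only [map_sum, sum_inner, inner_sum, TensorProduct.mapL_tmul, TensorProduct.inner_tmul]
  exact Finset.sum_comm

lemma pt_rho (π : A →⋆ₙₐ[ℂ] (H →L[ℂ] H)) (σ : B →⋆ₙₐ[ℂ] (K →L[ℂ] K)) (e : HilbertBasis ι ℂ K) (z : A ⊗[ℂ] B) (u : ℝ) (hu : 0 < u) 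
    (h : ∀ p : PT A ι, (p.evL σ e z).re ≤ u) (x : HT H K) : (vft π σ x z).re ≤ u * ‖x‖ ^ 2 := by
  refine hb_dense e (fun x => (vft π σ x z).re ≤ u * ‖x‖ ^ 2) ?_ ?_ x
  · refine isClosed_le ?_ (by fun_prop)
    change Continuous fun x : HT H K => (⟪x, rho π σ z x⟫_ℂ).re
    fun_prop
  · intro S ξ
    set x := hti H K (∑ i ∈ S, ξ i ⊗ₜ[ℂ] e i) with hx
    by_cases hx0 : x = 0
    · have : vft π σ x z = ⟪x, rho π σ z x⟫_ℂ := rfl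
      rw [this, hx0]; simp
    have hm : 0 < ‖x‖ ^ 2 := by positivity
    have hb : (∑ i : S, vf π (ξ i) (ξ i) 1).re ≤ ‖x‖ ^ 2 := by
      rw [hx, hb_norm, Complex.re_sum, ← Finset.sum_coe_sort S]
      refine Finset.sum_le_sum fun i _ => ?_
      rw [vf_apply]
      calc _ ≤ ‖⟪ξ i, π 1 (ξ i)⟫_ℂ‖ := Complex.re_le_norm _
        _ ≤ ‖ξ i‖ * ‖π 1 (ξ i)‖ := norm_inner_le_norm _ _
        _ ≤ ‖ξ i‖ * (‖π 1‖ * ‖ξ i‖) := by gcongr; exact (π 1).le_opNorm _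
        _ ≤ ‖ξ i‖ * (1 * ‖ξ i‖) := by 
            gcongr
            refine (nush_norm_le π 1).trans ?_
            rcases subsingleton_or_nontrivial A with hA | hA
            · rw [Subsingleton.elim (1:A) 0, norm_zero]; exact zero_le_one
            · exact CStarRing.norm_one.le
        _ = _ := by ring
    have h2 := h ⟨S, fun i j => (((‖x‖ ^ 2)⁻¹ : ℝ) : ℂ) • vf π (ξ i) (ξ j), (vf_cpf π (fun i : S => ξ i)).smul' _ (by positivity), by
      simp only [LinearMap.smul_apply, smul_eq_mul, ← Finset.mul_sum]
      rw [Complex.re_ofReal_mul, inv_mul_le_iff₀ hm, mul_one]; exact hb⟩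
    have h3 : prodF (fun i j : S => (((‖x‖ ^ 2)⁻¹ : ℝ) : ℂ) • vf π (ξ i) (ξ j)) (fun i j : S => vf σ (e i) (e j)) 
      = (((‖x‖ ^ 2)⁻¹ : ℝ) : ℂ) • vft π σ x := by
      rw [hx, vft_basis]
      ext a b
      simp only [TensorProduct.AlgebraTensorModule.curry_apply, LinearMap.restrictScalars_self, TensorProduct.curry_apply, LinearMap.smul_apply, prodF_tmul, smul_eq_mul, mul_assoc, ← Finset.mul_sum]
    rw [PT.evL, h3, LinearMap.smul_apply, smul_eq_mul, Complex.re_ofReal_mul, inv_mul_le_iff₀ hm] at h2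
    linarith

lemma pt_max {T : Type} [NonUnitalCStarAlgebra T] (d : MinTensorData A B T) (σ : B →⋆ₙₐ[ℂ] (K →L[ℂ] K)) (hσ : Injective σ) (e : HilbertBasis ι ℂ K) (z : A ⊗[ℂ] B) (u : ℝ) (hu : 0 < u) 
    (h : ∀ p : PT A ι, (p.evL σ e z).re ≤ u) (F : T →ₗ[ℂ] ℂ) (hF : QState F) : (F (TJ d.toTensorData z)).re ≤ u := by
  obtain ⟨H, i1, i2, i3, π, hπ⟩ := exists_faithful_rep A
  obtain ⟨j, hj, hjz⟩ := exists_spatial d π σ hπ hσ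
  set y : T := ((ℜ (TJ d.toTensorData z) : selfAdjoint T) : T) with hy
  have hys : IsSelfAdjoint y := (ℜ (TJ d.toTensorData z)).2
  have hF1 : (F (TJ d.toTensorData z)).re = (F y).re := by
    have h1 := realPart_add_I_smul_imaginaryPart (TJ d.toTensorData z)
    have h2 : (F ((ℑ (TJ d.toTensorData z) : selfAdjoint T) : T)).im = 0 := by
      have := hF.pos.map_star ((ℑ (TJ d.toTensorData z) : selfAdjoint T) : T)
      rw [(ℑ (TJ d.toTensorData z)).2.star_eq] at this
      exact Complex.conj_eq_iff_im.1 this.symm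
    conv_lhs => rw [← h1]
    rw [map_add, map_smul, Complex.add_re, smul_eq_mul]
    simp [h2, hy]
  rw [hF1]
  set y' := (u⁻¹ : ℝ) • y with hy'
  have hys' : IsSelfAdjoint y' := IsSelfAdjoint.smul (by simp [IsSelfAdjoint]) hys
  have hjy : IsSelfAdjoint (j y) := hys.map j
  have hq : ∀ x, (⟪x, j y x⟫_ℂ).re ≤ u * ‖x‖ ^ 2 := by
    intro x
    refine le_trans (le_of_eq ?_) (pt_rho π σ e z u hu h x)
    change _ = (⟪x, rho π σ z x⟫_ℂ).re
    rw [← hjz]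
    have h1 := realPart_add_I_smul_imaginaryPart (TJ d.toTensorData z)
    conv_rhs => rw [← h1]
    rw [map_add, map_smul]
    have h2 : (⟪x, j ((ℑ (TJ d.toTensorData z) : selfAdjoint T) : T) x⟫_ℂ).im = 0 := by
      have h3 : IsSelfAdjoint (j ((ℑ (TJ d.toTensorData z) : selfAdjoint T) : T)) := IsSelfAdjoint.map (ℑ (TJ d.toTensorData z)).2 j
      have := h3.isSymmetric
      exact Complex.conj_eq_iff_im.1 ((inner_conj_symm _ _).trans (this x x))
    rw [ContinuousLinearMap.add_apply, inner_add_right, Complex.add_re, ContinuousLinearMap.smul_apply, inner_smul_right]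
    simp [h2, hy]
  have hq' : ∀ t ∈ quasispectrum ℝ (j y'), t ≤ 1 := by
    refine op_le _ (hys'.map j) fun x => ?_
    have e1 : j y' = ((u⁻¹ : ℝ) : ℂ) • j y := by
      rw [hy', ← map_smul]; congr 1
    rw [e1, ContinuousLinearMap.smul_apply, inner_smul_right, Complex.re_ofReal_mul, inv_mul_le_iff₀ hu]
    exact hq x
  have hn := (norm_posPart_le_iff (j y') (hys'.map j) 1 zero_le_one).2 hq'
  have hjp : j (y'⁺) = (j y')⁺ := by
    rw [CFC.posPart_def, CFC.posPart_def]
    exact NonUnitalStarAlgHom.map_cfcₙ (S := ℂ) j _ _ (hφ := nush_cont j) (ha := hys') (hφa := hys'.map j) (hf := by fun_prop) (hf₀ := by simp)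
  rw [← hjp, NonUnitalStarAlgHom.norm_map j hj] at hn
  have h5 := (hF.le_pp y' hys').trans hn
  have e2 : F y' = ((u⁻¹ : ℝ) : ℂ) * F y := by
    rw [← smul_eq_mul, ← map_smul]; congr 1
  rw [e2, Complex.re_ofReal_mul, inv_mul_le_iff₀ hu] at h5
  linarith

lemma pt_dense {T : Type} [NonUnitalCStarAlgebra T] (d : MinTensorData A B T) (σ : B →⋆ₙₐ[ℂ] (K →L[ℂ] K)) (hσ : Injective σ) (e : HilbertBasis ι ℂ K) 
    (F : T →ₗ[ℂ] ℂ) (hF : QState F) (E : Finset (A × B)) (ε : ℝ) (hε : 0 < ε) : 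
    ∃ p : PT A ι, ∀ x ∈ E, ‖p.ev σ e x.1 x.2 - F (d.tmul x.1 x.2)‖ ≤ ε := by
  set 𝒞 : Set (A ⊗[ℂ] B → ℂ) := Set.range fun p : PT A ι => (⇑(p.evL σ e) : A ⊗[ℂ] B → ℂ)
  set G : A ⊗[ℂ] B →ₗ[ℂ] ℂ := F ∘ₗ TJ d.toTensorData with hG
  have hcv : Convex ℝ 𝒞 := by
    rintro _ ⟨p, rfl⟩ _ ⟨q, rfl⟩ s t hs ht hst
    obtain ⟨r, hr⟩ := pt_mix p q σ e s t hs ht hst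
    refine ⟨r, ?_⟩
    funext z
    simp [hr]
  have hmem : (⇑G : A ⊗[ℂ] B → ℂ) ∈ closure 𝒞 := by
    by_contra hne
    obtain ⟨l, u, h1, h2⟩ := geometric_hahn_banach_closed_point hcv.closure isClosed_closure hne
    obtain ⟨z, hz⟩ := pi_dual l
    have h3 : ∀ p : PT A ι, (p.evL σ e z).re < u := fun p => by
      rw [← hz]; exact h1 _ (subset_closure ⟨p, rfl⟩)
    have hu : 0 < u := by
      have := h3 ⟨∅, fun _ _ => 0, fun c => by simp, by simp⟩
      simpa [PT.evL, prodF] using this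
    have h4 := pt_max d σ hσ e z u hu (fun p => (h3 p).le) F hF
    rw [hz] at h2
    exact absurd h4 (not_le.2 h2)
  have hopen : ∀ᶠ φ in 𝓝 (⇑G : A ⊗[ℂ] B → ℂ), ∀ x ∈ E, ‖φ (x.1 ⊗ₜ x.2) - G (x.1 ⊗ₜ x.2)‖ ≤ ε := by
    rw [Filter.eventually_all_finset]
    intro x _
    have hc : Continuous fun φ : A ⊗[ℂ] B → ℂ => ‖φ (x.1 ⊗ₜ x.2) - G (x.1 ⊗ₜ x.2)‖ := by fun_prop
    have := hc.tendsto (⇑G)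
    simp only [sub_self, norm_zero] at this
    exact this.eventually (ge_mem_nhds hε)
  obtain ⟨_, h5, ⟨p, rfl⟩⟩ := mem_closure_iff_nhds.1 hmem _ hopen
  refine ⟨p, fun x hx => ?_⟩
  have : ‖p.evL σ e (x.1 ⊗ₜ x.2) - G (x.1 ⊗ₜ x.2)‖ ≤ ε := h5 x hx
  rwa [PT.evL_tmul, hG, LinearMap.comp_apply, TJ_tmul] at this
end pext
end FM

namespace FM
set_option linter.all false
set_option linter.style.haveILetI false
set_option linter.unnecessarySimpa false
open scoped ComplexOrder InnerProductSpace ComplexStarModule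
open scoped TensorProduct Topology Kronecker Matrix
open Filter

section core
variable {A B C T TF : Type} [NonUnitalCStarAlgebra B] [NonUnitalCStarAlgebra C] [NonUnitalCStarAlgebra T] [NonUnitalCStarAlgebra TF]

theorem core_unital [CStarAlgebra A] [Nontrivial A] (d : MinTensorData A B T) (dF : TensorData A C TF) (π : B →⋆ₙₐ[ℂ] C) (hπ : Surjective π)
    (Θ : T →⋆ₙₐ[ℂ] TF) (hΘ : ∀ a b, Θ (d.tmul a b) = dF.tmul a (π b)) (hB : IsExactCStar B)
    (K : Submodule ℂ T) (hK : IsCIdeal K) (hKj : ∀ a b, π b = 0 → d.tmul a b ∈ K) (t : T) (ht : Θ t = 0) : t ∈ K := by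
  classical
  by_contra hne
  obtain ⟨F, hF, hF0, hF1⟩ := exists_qstate_ideal K hK t hne
  obtain ⟨H, i1, i2, i3, σ, hσ⟩ := exists_faithful_rep B
  obtain ⟨w, e, -⟩ := exists_hilbertBasis ℂ H
  refine hF1 (key_kill d.toTensorData dF π hπ Θ hΘ hB σ hσ e F hF.le (fun b hb => hF0 _ (hKj _ _ hb)) 
    (fun E ε hε => pt_dense d σ hσ e F hF E ε hε) _ ?_)
  rw [map_mul, ht, mul_zero]

/-- equality of homs on elementary tensors -/
lemma hom_eq [NonUnitalCStarAlgebra A] (d : TensorData A B T) (f g : T →⋆ₙₐ[ℂ] TF) (h : ∀ a b, f (d.tmul a b) = g (d.tmul a b)) (t : T) : f t = g t := by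
  have : (⇑f : T → TF) = ⇑g := by
    refine DenseRange.equalizer (TJ_dense d) (nush_cont f) (nush_cont g) ?_
    funext z
    change f (TJ d z) = g (TJ d z)
    induction z with
    | zero => simp
    | add x y hx hy => simp only [map_add, hx, hy]
    | tmul a b => rw [TJ_tmul, h]
  rw [this]

lemma span_ind [NonUnitalCStarAlgebra A] (d : TensorData A B T) (M : Submodule ℂ T) (hM : IsClosed (M : Set T)) (h : ∀ a b, d.tmul a b ∈ M) (t : T) : t ∈ M := by
  have h1 : Submodule.span ℂ (Set.range fun p : A × B => d.tmul p.1 p.2) ≤ M := by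
    rw [Submodule.span_le]; rintro _ ⟨p, rfl⟩; exact h _ _
  have h2 := Submodule.topologicalClosure_minimal _ h1 hM
  rw [d.dense] at h2
  exact h2 trivial

/-- ideals generated by sets -/
lemma gen_ideal [NonUnitalCStarAlgebra A] (d : TensorData A B T) (G : Set T) (hs : ∀ g ∈ G, star g ∈ G)
    (hl : ∀ a b, ∀ g ∈ G, d.tmul a b * g ∈ G) : IsCIdeal (Submodule.span ℂ G).topologicalClosure := by
  have hcl := Submodule.isClosed_topologicalClosure (Submodule.span ℂ G)
  set M := (Submodule.span ℂ G).topologicalClosure with hM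
  have hGM : ∀ g ∈ G, g ∈ M := fun g hg => Submodule.le_topologicalClosure _ (Submodule.subset_span hg)
  have hind : ∀ (N : Submodule ℂ T), IsClosed (N : Set T) → (∀ g ∈ G, g ∈ N) → ∀ k ∈ M, k ∈ N := fun N hN h k hk =>
    Submodule.topologicalClosure_minimal _ (Submodule.span_le.2 h) hN hk
  have hstar : ∀ k ∈ M, star k ∈ M := by
    intro k hk
    have h0 : M ≤ M.map (starₗᵢ ℂ : T ≃ₗᵢ⋆[ℂ] T).toLinearEquiv.toLinearMap := by
      refine fun k hk => hind _ ?_ ?_ k hk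
      · rw [Submodule.map_coe]
        exact (starₗᵢ ℂ : T ≃ₗᵢ⋆[ℂ] T).toHomeomorph.isClosedMap _ hcl
      · intro g hg
        exact ⟨star g, hGM _ (hs g hg), star_star g⟩
    obtain ⟨y, hy, rfl⟩ := h0 hk
    change star (star y) ∈ M
    rwa [star_star]
  have hleft : ∀ a, ∀ k ∈ M, a * k ∈ M := by
    intro a k hk
    refine span_ind d (M.comap (LinearMap.mulRight ℂ k)) (hcl.preimage (by change Continuous fun x => x * k; fun_prop)) ?_ a
    intro x y
    refine hind (M.comap (LinearMap.mulLeft ℂ (d.tmul x y))) (hcl.preimage (by change Continuous fun z => d.tmul x y * z; fun_prop)) ?_ k hk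
    intro g hg
    exact hGM _ (hl x y g hg)
  refine ⟨hcl, hleft, fun k a hk => ?_, hstar⟩
  have := hstar _ (hleft (star a) _ (hstar k hk))
  simpa using this

theorem core_nu [NonUnitalCStarAlgebra A] (d : MinTensorData A B T) (dF : TensorData A C TF) (π : B →⋆ₙₐ[ℂ] C) (hπ : Surjective π)
    (Θ : T →⋆ₙₐ[ℂ] TF) (hΘ : ∀ a b, Θ (d.tmul a b) = dF.tmul a (π b)) (hB : IsExactCStar B)
    (K : Submodule ℂ T) (hK : IsCIdeal K) (hKj : ∀ a b, π b = 0 → d.tmul a b ∈ K) (t : T) (ht : Θ t = 0) : t ∈ K := by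
  obtain ⟨T1, iT1, ⟨d1⟩⟩ := exists_min' (Unitization ℂ A) B
  obtain ⟨TF1, iTF1, ⟨dF1⟩⟩ := exists_min' (Unitization ℂ A) C
  obtain ⟨h, hh⟩ := min_functor d.toTensorData d1 (Unitization.inrNonUnitalStarAlgHom ℂ A) (NonUnitalStarAlgHom.id ℂ B)
  obtain ⟨Θ1, hΘ1⟩ := min_functor d1.toTensorData dF1 (NonUnitalStarAlgHom.id ℂ (Unitization ℂ A)) π
  obtain ⟨hf, hhf⟩ := min_functor dF dF1 (Unitization.inrNonUnitalStarAlgHom ℂ A) (NonUnitalStarAlgHom.id ℂ C)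
  have hinj : Injective h := by
    obtain ⟨H, i1, i2, i3, π1, hπ1⟩ := exists_faithful_rep (Unitization ℂ A)
    obtain ⟨L, j1, j2, j3, σ, hσ⟩ := exists_faithful_rep B
    obtain ⟨j, hj, hjz⟩ := exists_spatial d (π1.comp (Unitization.inrNonUnitalStarAlgHom ℂ A)) σ (hπ1.comp Unitization.inr_injective) hσ
    obtain ⟨j', hj', hjz'⟩ := exists_spatial d1 π1 σ hπ1 hσ
    have : ∀ t, (j'.comp h) t = j t := by
      refine hom_eq d.toTensorData _ _ fun a b => ?_
      rw [NonUnitalStarAlgHom.comp_apply, hh, ← TJ_tmul, ← TJ_tmul, hjz, hjz', rho_tmul, rho_tmul]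
      rfl
    intro x y hxy
    apply hj
    rw [← this, ← this, NonUnitalStarAlgHom.comp_apply, NonUnitalStarAlgHom.comp_apply, hxy]
  have hiso : Isometry h := NonUnitalStarAlgHom.isometry h hinj
  have hcomm : ∀ t, (Θ1.comp h) t = (hf.comp Θ) t := by
    refine hom_eq d.toTensorData _ _ fun a b => ?_
    rw [NonUnitalStarAlgHom.comp_apply, NonUnitalStarAlgHom.comp_apply, hh, hΘ, hΘ1, hhf]
    rfl
  have h0 : Θ1 (h t) = 0 := by
    have := hcomm t
    rwa [NonUnitalStarAlgHom.comp_apply, NonUnitalStarAlgHom.comp_apply, ht, map_zero] at this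
  set G : Set T1 := {x | ∃ a b, π b = 0 ∧ x = d1.tmul a b} with hG
  have hK1 : IsCIdeal (Submodule.span ℂ G).topologicalClosure := by
    refine gen_ideal d1.toTensorData G ?_ ?_
    · rintro _ ⟨a, b, hb, rfl⟩
      exact ⟨star a, star b, by rw [map_star, hb, star_zero], d1.star_tmul _ _⟩
    · rintro a' b' _ ⟨a, b, hb, rfl⟩
      exact ⟨a' * a, b' * b, by rw [map_mul, hb, mul_zero], d1.mul_tmul _ _ _ _⟩
  have h1 := core_unital d1 dF1.toTensorData π hπ Θ1 hΘ1 hB _ hK1 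
    (fun a b hb => Submodule.le_topologicalClosure _ (Submodule.subset_span ⟨a, b, hb, rfl⟩)) _ h0
  let hl : T →ₗ[ℂ] T1 := { toFun := h, map_add' := map_add h, map_smul' := fun c x => map_smul h c x }
  set M : Submodule ℂ T1 := K.map hl with hM
  have hMc : IsClosed (M : Set T1) := by
    rw [hM, Submodule.map_coe]
    exact hiso.isClosedEmbedding.isClosedMap _ hK.closed
  have h2 : ∀ s : T, ∀ k ∈ (Submodule.span ℂ G).topologicalClosure, k * h s ∈ M := by
    intro s k hk
    refine Submodule.topologicalClosure_minimal _ (t := M.comap (LinearMap.mulRight ℂ (h s))) (Submodule.span_le.2 ?_) 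
      (hMc.preimage (by change Continuous fun z => z * h s; fun_prop)) hk
    rintro _ ⟨a, b, hb, rfl⟩
    have hc := nush_cont h
    refine span_ind d.toTensorData (M.comap (LinearMap.mulLeft ℂ (d1.tmul a b) ∘ₗ hl)) 
      (hMc.preimage (by change Continuous fun z => d1.tmul a b * h z; fun_prop)) ?_ s
    intro a' b'
    refine ⟨d.tmul (a.fst • a' + a.snd * a') (b * b'), hKj _ _ (by rw [map_mul, hb, zero_mul]), ?_⟩
    change h _ = d1.tmul a b * h (d.tmul a' b')
    rw [hh, hh, d1.mul_tmul]
    congr 1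
    ext <;> simp
  obtain ⟨y, hy, hyt⟩ := h2 (star t) _ h1
  have h3 : y = t * star t := hinj (hyt.trans (map_mul h t (star t)).symm)
  have h4 := mem_of_star_mul_self_mem K hK (star t) (by rw [star_star, ← h3]; exact hy)
  simpa using hK.star_mem _ h4
end core
end FM

namespace FM
set_option linter.all false
set_option linter.style.haveILetI false
set_option linter.unnecessarySimpa false
open scoped ComplexOrder InnerProductSpace ComplexStarModule
open scoped TensorProduct Topology Kronecker Matrix
open Filter

section general
variable {A B FA FB T TF : Type} [NonUnitalCStarAlgebra A] [NonUnitalCStarAlgebra B] [NonUnitalCStarAlgebra FA] [NonUnitalCStarAlgebra FB] [NonUnitalCStarAlgebra T] [NonUnitalCStarAlgebra TF]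

/-- kernel as a subalgebra -/
def kerS (π : A →⋆ₙₐ[ℂ] FA) : NonUnitalStarSubalgebra ℂ A where
  carrier := {a | π a = 0}
  zero_mem' := map_zero π
  add_mem' := by
    intro a b ha hb
    change π (a + b) = 0
    rw [map_add, show π a = 0 from ha, show π b = 0 from hb, add_zero]
  mul_mem' := by
    intro a b ha hb
    change π (a * b) = 0
    rw [map_mul, show π a = 0 from ha, zero_mul]
  smul_mem' := by
    intro c a ha
    change π (c • a) = 0
    rw [map_smul, show π a = 0 from ha, smul_zero]
  star_mem' := by
    intro a ha
    change π (star a) = 0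
    rw [map_star, show π a = 0 from ha, star_zero]

theorem general (d : MinTensorData A B T) (dF : MinTensorData FA FB TF) (πA : A →⋆ₙₐ[ℂ] FA) (hπA : Surjective πA)
    (πB : B →⋆ₙₐ[ℂ] FB) (hπB : Surjective πB)
    (Θ : T →⋆ₙₐ[ℂ] TF) (hΘ : ∀ a b, Θ (d.tmul a b) = dF.tmul (πA a) (πB b)) (hB : IsExactCStar B)
    (K : Submodule ℂ T) (hK : IsCIdeal K) (hKi : ∀ a b, πA a = 0 → d.tmul a b ∈ K) (hKj : ∀ a b, πB b = 0 → d.tmul a b ∈ K)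
    (t : T) (ht : Θ t = 0) : t ∈ K := by
  haveI hIc : IsClosed (kerS πA : Set A) := isClosed_singleton.preimage (nush_cont πA)
  let i0 : kerS πA →⋆ₙₐ[ℂ] A := NonUnitalStarSubalgebraClass.subtype (kerS πA)
  have hi0 : Injective i0 := Subtype.val_injective
  obtain ⟨TI, _, ⟨dI⟩⟩ := exists_min' (kerS πA) B
  obtain ⟨TM, _, ⟨dM⟩⟩ := exists_min' FA B
  obtain ⟨iT, hiT⟩ := min_functor dI.toTensorData d i0 (NonUnitalStarAlgHom.id ℂ B)
  obtain ⟨q, hq⟩ := min_functor d.toTensorData dM πA (NonUnitalStarAlgHom.id ℂ B)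
  obtain ⟨Ψ, hΨ⟩ := min_functor dM.toTensorData dF (NonUnitalStarAlgHom.id ℂ FA) πB
  have hker : {a | πA a = 0} = Set.range i0 := by
    ext a
    exact ⟨fun h => ⟨⟨a, h⟩, rfl⟩, by rintro ⟨y, rfl⟩; exact y.2⟩
  obtain ⟨-, hqs, hex⟩ := hB _ _ _ i0 πA hi0 hπA hker TI T TM dI d dM iT q hiT hq
  have hqK : ∀ s, q s = 0 → s ∈ K := by
    intro s hs
    have : s ∈ Set.range iT := by rw [← hex]; exact hs
    obtain ⟨y, rfl⟩ := this
    let il : TI →ₗ[ℂ] T := { toFun := iT, map_add' := map_add iT, map_smul' := fun c x => map_smul iT c x }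
    refine span_ind dI.toTensorData (K.comap il) (hK.closed.preimage (nush_cont iT)) ?_ y
    intro a b
    change iT (dI.tmul a b) ∈ K
    rw [hiT]
    exact hKi _ _ a.2
  have hcomm : ∀ t, (Ψ.comp q) t = Θ t := by
    refine hom_eq d.toTensorData _ _ fun a b => ?_
    rw [NonUnitalStarAlgHom.comp_apply, hq, hΨ, hΘ]
    rfl
  let ql : T →L[ℂ] TM := ⟨{ toFun := q, map_add' := map_add q, map_smul' := fun c x => map_smul q c x }, nush_cont q⟩
  have hquot : Topology.IsQuotientMap ql := (ql.isOpenMap hqs).isQuotientMap ql.continuous hqs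
  set M : Submodule ℂ TM := K.map ql.toLinearMap with hM
  have hMq : ∀ s, q s ∈ M ↔ s ∈ K := by
    intro s
    constructor
    · rintro ⟨k, hk, hks⟩
      have h1 : s - k ∈ K := hqK _ (by rw [map_sub]; exact sub_eq_zero.2 hks.symm)
      have := K.add_mem h1 hk
      simpa using this
    · exact fun h => ⟨s, h, rfl⟩
  have hMI : IsCIdeal M := by
    refine ⟨?_, ?_, ?_, ?_⟩
    · rw [← hquot.isClosed_preimage]
      convert hK.closed using 1
      ext s
      exact hMq s
    · intro a k hk
      obtain ⟨a, rfl⟩ := hqs a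
      obtain ⟨k, rfl⟩ := hqs k
      rw [← map_mul, hMq]
      exact hK.mul_left _ _ ((hMq _).1 hk)
    · intro k a hk
      obtain ⟨a, rfl⟩ := hqs a
      obtain ⟨k, rfl⟩ := hqs k
      rw [← map_mul, hMq]
      exact hK.mul_right _ _ ((hMq _).1 hk)
    · intro k hk
      obtain ⟨k, rfl⟩ := hqs k
      rw [← map_star, hMq]
      exact hK.star_mem _ ((hMq _).1 hk)
  have h0 : Ψ (q t) = 0 := by rw [← ht, ← hcomm]; rfl
  refine (hMq t).1 (core_nu dM dF.toTensorData πB hπB Ψ hΨ hB M hMI ?_ _ h0)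
  intro a b hb
  obtain ⟨a, rfl⟩ := hπA a
  have := (hMq _).2 (hKj a b hb)
  rwa [hq] at this

/-- flip -/
def flipT (d : TensorData A B T) : TensorData B A T where
  tmul b a := d.tmul a b
  add_left _ _ _ := d.add_right _ _ _
  add_right _ _ _ := d.add_left _ _ _
  smul_left _ _ _ := d.smul_right _ _ _
  smul_right _ _ _ := d.smul_left _ _ _
  mul_tmul _ _ _ _ := d.mul_tmul _ _ _ _
  star_tmul _ _ := d.star_tmul _ _
  norm_tmul _ _ := (d.norm_tmul _ _).trans (mul_comm _ _)
  dense := by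
    rw [← d.dense]
    congr 2
    ext t
    constructor
    · rintro ⟨p, rfl⟩; exact ⟨p.swap, rfl⟩
    · rintro ⟨p, rfl⟩; exact ⟨p.swap, rfl⟩

def flipM (d : MinTensorData A B T) : MinTensorData B A T where
  toTensorData := flipT d.toTensorData
  minimal T' _ d' := by
    obtain ⟨θ, hθ⟩ := d.minimal T' (flipT d')
    exact ⟨θ, fun b a => hθ a b⟩

theorem general' (d : MinTensorData A B T) (dF : MinTensorData FA FB TF) (πA : A →⋆ₙₐ[ℂ] FA) (hπA : Surjective πA)
    (πB : B →⋆ₙₐ[ℂ] FB) (hπB : Surjective πB)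
    (Θ : T →⋆ₙₐ[ℂ] TF) (hΘ : ∀ a b, Θ (d.tmul a b) = dF.tmul (πA a) (πB b)) (hAB : IsExactCStar A ∨ IsExactCStar B)
    (K : Submodule ℂ T) (hK : IsCIdeal K) (hKi : ∀ a b, πA a = 0 → d.tmul a b ∈ K) (hKj : ∀ a b, πB b = 0 → d.tmul a b ∈ K)
    (t : T) (ht : Θ t = 0) : t ∈ K := by
  rcases hAB with hA | hB
  · exact general (flipM d) (flipM dF) πB hπB πA hπA Θ (fun b a => hΘ a b) hA K hK (fun b a h => hKj a b h) (fun b a h => hKi a b h) t ht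
  · exact general d dF πA hπA πB hπB Θ hΘ hB K hK hKi hKj t ht

/-- left tensor map as a continuous linear map -/
def tmL (d : TensorData A B T) (b : B) : A →L[ℂ] T :=
  LinearMap.mkContinuous { toFun := fun a => d.tmul a b, map_add' := fun _ _ => d.add_left _ _ _, map_smul' := fun _ _ => d.smul_left _ _ _ } ‖b‖
    fun a => le_of_eq ((d.norm_tmul a b).trans (mul_comm _ _))

lemma surj_of_tmul (d : TensorData A B T) (dF : TensorData FA FB TF) (πA : A →⋆ₙₐ[ℂ] FA) (hπA : Surjective πA)
    (πB : B →⋆ₙₐ[ℂ] FB) (hπB : Surjective πB)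
    (Θ : T →⋆ₙₐ[ℂ] TF) (hΘ : ∀ a b, Θ (d.tmul a b) = dF.tmul (πA a) (πB b)) : Surjective Θ := by
  let Θl : T →ₗ[ℂ] TF := { toFun := Θ, map_add' := map_add Θ, map_smul' := fun c x => map_smul Θ c x }
  intro y
  have : y ∈ LinearMap.range Θl := by
    refine span_ind dF (LinearMap.range Θl) ?_ ?_ y
    · rw [LinearMap.coe_range]; exact isClosed_range Θ
    · intro a b
      obtain ⟨a, rfl⟩ := hπA a
      obtain ⟨b, rfl⟩ := hπB b
      exact ⟨d.tmul a b, hΘ a b⟩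
  exact this

lemma tmul_mem_of_fiber {X : Type} [TopologicalSpace X] (SA : C0Structure X A) (x : X) (d : TensorData A B T) (K : Submodule ℂ T) (hK : IsClosed (K : Set T))
    (b : B) (h : ∀ (f : C₀(X, ℂ)) (a : A), f x = 0 → d.tmul (SA.smul f a) b ∈ K) (a : A) (ha : a ∈ fiberIdeal SA x) : d.tmul a b ∈ K := by
  have h1 : Submodule.span ℂ {y : A | ∃ (f : C₀(X, ℂ)) (a : A), f x = 0 ∧ y = SA.smul f a} ≤ K.comap (tmL d b).toLinearMap := by
    rw [Submodule.span_le]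
    rintro _ ⟨f, a, hf, rfl⟩
    exact h f a hf
  exact closure_minimal (t := (K.comap (tmL d b).toLinearMap : Set A)) h1 (hK.preimage (tmL d b).continuous) ha

theorem final {X Y : Type} [TopologicalSpace X] [TopologicalSpace Y]
    (SA : C0Structure X A) (SB : C0Structure Y B) (hAB : IsExactCStar A ∨ IsExactCStar B)
    (d : MinTensorData A B T) (x : X) (y : Y) (πA : FibreData SA x FA) (πB : FibreData SB y FB)
    (dF : MinTensorData FA FB TF) (Θ : T →⋆ₙₐ[ℂ] TF)
    (hΘ : ∀ (a : A) (b : B), Θ (d.tmul a b) = dF.tmul (πA.π a) (πB.π b)) :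
    Function.Surjective Θ ∧ {t : T | Θ t = 0} = closure (Submodule.span ℂ
        ({t : T | ∃ (f : C₀(X, ℂ)) (a : A) (b : B), f x = 0 ∧ t = d.tmul (SA.smul f a) b} ∪
         {t : T | ∃ (g : C₀(Y, ℂ)) (a : A) (b : B), g y = 0 ∧ t = d.tmul a (SB.smul g b)}) :
        Set T) := by
  refine ⟨surj_of_tmul d.toTensorData dF.toTensorData πA.π πA.surjective πB.π πB.surjective Θ hΘ, ?_⟩
  have hkA : ∀ (f : C₀(X, ℂ)) a, f x = 0 → πA.π (SA.smul f a) = 0 := fun f a hf => by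
    have : SA.smul f a ∈ {a : A | πA.π a = 0} := by
      rw [πA.ker_eq]; exact subset_closure (Submodule.subset_span ⟨f, a, hf, rfl⟩)
    exact this
  have hkB : ∀ (f : C₀(Y, ℂ)) a, f y = 0 → πB.π (SB.smul f a) = 0 := fun f a hf => by
    have : SB.smul f a ∈ {a : B | πB.π a = 0} := by
      rw [πB.ker_eq]; exact subset_closure (Submodule.subset_span ⟨f, a, hf, rfl⟩)
    exact this
  have hz1 : ∀ b, dF.tmul 0 b = 0 := fun b => by simpa using dF.smul_left 0 0 b
  have hz2 : ∀ a, dF.tmul a 0 = 0 := fun a => by simpa using dF.smul_right 0 a 0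
  set G := ({t : T | ∃ (f : C₀(X, ℂ)) (a : A) (b : B), f x = 0 ∧ t = d.tmul (SA.smul f a) b} ∪
         {t : T | ∃ (g : C₀(Y, ℂ)) (a : A) (b : B), g y = 0 ∧ t = d.tmul a (SB.smul g b)}) with hG
  set K := (Submodule.span ℂ G).topologicalClosure with hKdef
  have hKc : IsClosed (K : Set T) := Submodule.isClosed_topologicalClosure _
  have hGK : ∀ g ∈ G, g ∈ K := fun g hg => Submodule.le_topologicalClosure _ (Submodule.subset_span hg)
  have hKi : ∀ a b, πA.π a = 0 → d.tmul a b ∈ K := by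
    intro a b ha
    have ha' : a ∈ fiberIdeal SA x := by rw [← πA.ker_eq]; exact ha
    exact tmul_mem_of_fiber SA x d.toTensorData K hKc b (fun f a hf => hGK _ (Or.inl ⟨f, a, b, hf, rfl⟩)) a ha'
  have hKj : ∀ a b, πB.π b = 0 → d.tmul a b ∈ K := by
    intro a b hb
    have hb' : b ∈ fiberIdeal SB y := by rw [← πB.ker_eq]; exact hb
    exact tmul_mem_of_fiber SB y (flipT d.toTensorData) K hKc a (fun f b hf => hGK _ (Or.inr ⟨f, a, b, hf, rfl⟩)) b hb'
  set G' : Set T := {t | ∃ a b, (πA.π a = 0 ∨ πB.π b = 0) ∧ t = d.tmul a b} with hG'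
  have hI : IsCIdeal (Submodule.span ℂ G').topologicalClosure := by
    refine gen_ideal d.toTensorData G' ?_ ?_
    · rintro _ ⟨a, b, h, rfl⟩
      exact ⟨star a, star b, h.imp (fun h => by rw [map_star, h, star_zero]) (fun h => by rw [map_star, h, star_zero]), d.star_tmul _ _⟩
    · rintro a' b' _ ⟨a, b, h, rfl⟩
      exact ⟨a' * a, b' * b, h.imp (fun h => by rw [map_mul, h, mul_zero]) (fun h => by rw [map_mul, h, mul_zero]), d.mul_tmul _ _ _ _⟩
  have hle : (Submodule.span ℂ G').topologicalClosure ≤ K := by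
    refine Submodule.topologicalClosure_minimal _ (Submodule.span_le.2 ?_) hKc
    rintro _ ⟨a, b, h | h, rfl⟩
    · exact hKi a b h
    · exact hKj a b h
  apply Set.Subset.antisymm
  · intro t ht
    exact hle (general' d dF πA.π πA.surjective πB.π πB.surjective Θ hΘ hAB _ hI
      (fun a b h => Submodule.le_topologicalClosure _ (Submodule.subset_span ⟨a, b, Or.inl h, rfl⟩))
      (fun a b h => Submodule.le_topologicalClosure _ (Submodule.subset_span ⟨a, b, Or.inr h, rfl⟩)) t ht)
  · let Θl : T →ₗ[ℂ] TF := { toFun := Θ, map_add' := map_add Θ, map_smul' := fun c x => map_smul Θ c x }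
    refine closure_minimal ?_ (isClosed_singleton.preimage (nush_cont Θ))
    have : Submodule.span ℂ G ≤ LinearMap.ker Θl := by
      rw [Submodule.span_le]
      rintro _ (⟨f, a, b, hf, rfl⟩ | ⟨f, a, b, hf, rfl⟩)
      · change Θ _ = 0
        rw [hΘ, hkA f a hf, hz1]
      · change Θ _ = 0
        rw [hΘ, hkB f b hf, hz2]
    exact this
end general
end FM

/-- Let `A` be a `C₀(X)`-algebra and `B` a `C₀(Y)`-algebra, with either
`A` or `B` separable and exact.  Let `T = A ⊗ B` be the minimal tensor product with its
`C₀(X×Y)`-algebra structure `S` (via `Φ_X ⊗ Φ_Y`, so that the ideal of `S` at `(x,y)`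
is `Iₓ ⊗ B + A ⊗ J_y`).  Then for every `(x, y) ∈ X × Y` the fibre of `A ⊗ B` at `(x,y)`
is `A_x ⊗ B_y`; i.e. the canonical map `Θ : A ⊗ B → A_x ⊗ B_y` is surjective with kernel
exactly the ideal of `A ⊗ B` at `(x, y)`. -/
theorem fibre_of_minimal_tensorProduct
    (X Y : Type) [TopologicalSpace X] [LocallyCompactSpace X] [T2Space X]
    [TopologicalSpace Y] [LocallyCompactSpace Y] [T2Space Y]
    (A B : Type) [NonUnitalCStarAlgebra A] [NonUnitalCStarAlgebra B]
    (SA : C0Structure X A) (SB : C0Structure Y B)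
    (hsepexact :
      (TopologicalSpace.SeparableSpace A ∧ IsExactCStar A) ∨
      (TopologicalSpace.SeparableSpace B ∧ IsExactCStar B))
    -- the minimal tensor product `T = A ⊗ B`
    (T : Type) [NonUnitalCStarAlgebra T] (dT : MinTensorData A B T)
    -- its `C₀(X × Y)`-algebra structure `Φ_X ⊗ Φ_Y`, whose ideal at `(x,y)` is
    -- `Iₓ ⊗ B + A ⊗ J_y`
    (S : C0Structure (X × Y) T)
    (hS : ∀ p : X × Y, fiberIdeal S p =
      closure (Submodule.span ℂ
        ({t : T | ∃ (f : C₀(X, ℂ)) (a : A) (b : B), f p.1 = 0 ∧ t = dT.tmul (SA.smul f a) b} ∪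
         {t : T | ∃ (g : C₀(Y, ℂ)) (a : A) (b : B), g p.2 = 0 ∧ t = dT.tmul a (SB.smul g b)}) :
        Set T))
    (x : X) (y : Y)
    -- the fibres `A_x` and `B_y`
    (FA FB : Type) [NonUnitalCStarAlgebra FA] [NonUnitalCStarAlgebra FB]
    (πA : FibreData SA x FA) (πB : FibreData SB y FB)
    -- the minimal tensor product `A_x ⊗ B_y`
    (TF : Type) [NonUnitalCStarAlgebra TF] (dF : MinTensorData FA FB TF)
    -- the canonical map `A ⊗ B → A_x ⊗ B_y`
    (Θ : T →⋆ₙₐ[ℂ] TF)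
    (hΘ : ∀ (a : A) (b : B), Θ (dT.tmul a b) = dF.tmul (πA.π a) (πB.π b)) :
    Function.Surjective Θ ∧ {t : T | Θ t = 0} = fiberIdeal S (x, y) := by
  have h := FM.final SA SB (hsepexact.imp (fun h => h.2) (fun h => h.2)) dT x y πA πB dF Θ hΘ
  rw [hS (x, y)]
  exact h

end
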